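/- Let φ₃ and φ₄ be homogeneous polynomials of degrees 3 and 4 in (x,y), and let f : ℝ² → ℝ be a smooth function whose 5-jet at the origin is j⁵f(0) = y² + x⁵ + y·(φ₃(x,y) + φ₄(x,y)) (the class Π^p_{v,3}, where the Monge form has an A₄-singularity at the origin). Write c₃₁ and c₂₂ for the coefficients of x³y and x²y² in the Taylor expansion of f at 0 (i.e. of x³ and x²y in φ₃). Let δ = f_xy² − f_xx·f_yy. Then δ(0) = 0, ∇δ(0) = (0,0), the 2-jet of δ at the origin equals −12c₃₁xy − 4c₂₂y², and det Hess δ(0) = −144 c₃₁². Moreover, if c₃₁ ≠ 0 then the asymptotic BDE of f is topologically equivalent at 0 to the non-transversal Morse type BDE dy² + (xy + x³)dx² = 0, i.e. the BDE with coefficients (a,b,c) = (1, 0, xy + x³). -/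

import Mathlib

open Asymptotics Filter Set

noncomputable section

/-- Partial derivative in the first variable (∂/∂x). -/
def pdx (f : ℝ × ℝ → ℝ) (p : ℝ × ℝ) : ℝ := deriv (fun s => f (s, p.2)) p.1

/-- Partial derivative in the second variable (∂/∂y). -/
def pdy (f : ℝ × ℝ → ℝ) (p : ℝ × ℝ) : ℝ := deriv (fun s => f (p.1, s)) p.2

/-- f_xx -/
def fxx (f : ℝ × ℝ → ℝ) : ℝ × ℝ → ℝ := pdx (pdx f)
/-- f_xy -/
def fxy (f : ℝ × ℝ → ℝ) : ℝ × ℝ → ℝ := pdy (pdx f)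
/-- f_yy -/
def fyy (f : ℝ × ℝ → ℝ) : ℝ × ℝ → ℝ := pdy (pdy f)

/-- The discriminant δ = f_xy² − f_xx·f_yy of the asymptotic BDE of `f`. -/
def bdeDiscr (f : ℝ × ℝ → ℝ) : ℝ × ℝ → ℝ := fun p => (fxy f p) ^ 2 - fxx f p * fyy f p

/-- The BDE `a dy² + 2b dxdy + c dx² = 0`, regarded as the family of quadratic
forms `ω_p(v) = a(p)v₂² + 2b(p)v₁v₂ + c(p)v₁²`. -/
def BDE (a b c : ℝ × ℝ → ℝ) : (ℝ × ℝ) → (ℝ × ℝ) → ℝ :=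
  fun p v => a p * v.2 ^ 2 + 2 * b p * v.1 * v.2 + c p * v.1 ^ 2

/-- The asymptotic BDE `f_yy dy² + 2 f_xy dxdy + f_xx dx² = 0` of the surface `z = f(x,y)`. -/
def asymBDE (f : ℝ × ℝ → ℝ) : (ℝ × ℝ) → (ℝ × ℝ) → ℝ := BDE (fyy f) (fxy f) (fxx f)

/-- `j^k f(0) = P` : the degree-k Taylor polynomial of `f` at the origin is `P`,
i.e. `f − P = o(‖(x,y)‖^k)` as `(x,y) → 0`. -/
def HasJetAt0 (f P : ℝ × ℝ → ℝ) (k : ℕ) : Prop :=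
  (fun p => f p - P p) =o[nhds (0 : ℝ × ℝ)] fun p => ‖p‖ ^ k

/-- `γ` is an integral curve of the BDE `ω` on the open interval `I`:
`γ` is C¹ on `I` with nowhere-vanishing derivative annihilating `ω`. -/
def IsIntegralCurveOnBDE (ω : (ℝ × ℝ) → (ℝ × ℝ) → ℝ) (γ : ℝ → ℝ × ℝ) (I : Set ℝ) : Prop :=
  (∃ a b : ℝ, I = Set.Ioo a b) ∧
  ∃ dγ : ℝ → ℝ × ℝ, ContinuousOn dγ I ∧
    ∀ t ∈ I, HasDerivAt γ (dγ t) t ∧ dγ t ≠ 0 ∧ ω (γ t) (dγ t) = 0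

/-- Topological equivalence of two BDEs at the origin: a local homeomorphism
fixing `0` sending integral curves of one to integral curves of the other. -/
def TopEquivAt0 (ω Ω : (ℝ × ℝ) → (ℝ × ℝ) → ℝ) : Prop :=
  ∃ (U V : Set (ℝ × ℝ)) (h hinv : ℝ × ℝ → ℝ × ℝ),
    IsOpen U ∧ IsOpen V ∧ (0 : ℝ × ℝ) ∈ U ∧ (0 : ℝ × ℝ) ∈ V ∧ h 0 = 0 ∧
    ContinuousOn h U ∧ ContinuousOn hinv V ∧
    Set.BijOn h U V ∧ Set.InvOn hinv h U V ∧
    (∀ γ I, IsIntegralCurveOnBDE ω γ I → Set.MapsTo γ I U →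
      ∃ σ J, IsIntegralCurveOnBDE Ω σ J ∧ h '' (γ '' I) = σ '' J) ∧
    (∀ σ J, IsIntegralCurveOnBDE Ω σ J → Set.MapsTo σ J V →
      ∃ γ I, IsIntegralCurveOnBDE ω γ I ∧ hinv '' (σ '' J) = γ '' I)

/-- Smooth equivalence of two BDEs at the origin: a local C^∞ diffeomorphism `h`
fixing `0` pulling one family of quadratic forms back to a nonvanishing multiple
of the other. -/
def SmoothEquivAt0 (ω Ω : (ℝ × ℝ) → (ℝ × ℝ) → ℝ) : Prop :=
  ∃ (U V : Set (ℝ × ℝ)) (h hinv : ℝ × ℝ → ℝ × ℝ) (ρ : ℝ × ℝ → ℝ),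
    IsOpen U ∧ IsOpen V ∧ (0 : ℝ × ℝ) ∈ U ∧ (0 : ℝ × ℝ) ∈ V ∧ h 0 = 0 ∧
    ContDiffOn ℝ (⊤ : ℕ∞) h U ∧ ContDiffOn ℝ (⊤ : ℕ∞) hinv V ∧
    Set.BijOn h U V ∧ Set.InvOn hinv h U V ∧
    ContDiffOn ℝ (⊤ : ℕ∞) ρ U ∧ (∀ p ∈ U, ρ p ≠ 0) ∧
    (∀ p ∈ U, ∀ v : ℝ × ℝ, Ω (h p) (fderiv ℝ h p v) = ρ p * ω p v)

/-- Fiber topological equivalence at `0` of two 2-parameter families of BDEs: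
a homeomorphism `φ` of parameter spaces (onto its image), fixing `0`, such that
corresponding members of the families are topologically equivalent at `0`. -/
def FiberTopEquivAt0 (ω Ω : (ℝ × ℝ) → (ℝ × ℝ) → (ℝ × ℝ) → ℝ) : Prop :=
  ∃ (W : Set (ℝ × ℝ)) (φ ψ : ℝ × ℝ → ℝ × ℝ),
    W ∈ nhds (0 : ℝ × ℝ) ∧ φ 0 = 0 ∧
    ContinuousOn φ W ∧ ContinuousOn ψ (φ '' W) ∧
    Set.InvOn ψ φ W (φ '' W) ∧
    ∀ q ∈ W, TopEquivAt0 (ω q) (Ω (φ q))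

structure Strip (ε c K : ℝ) (s S : ℝ → ℝ) (Φ : ℝ → ℝ → ℝ) : Prop where
  hε : 0 < ε
  hc : 0 < c
  hK : 0 ≤ K
  s_nonneg : ∀ t ∈ Icc 0 ε, 0 ≤ s t
  s_le : ∀ t ∈ Icc 0 ε, s t ≤ ε
  S_deriv : ∀ t, HasDerivAt S (s t) t
  S_lb : ∀ t t0, 0 ≤ t → t ≤ t0 → t0 ≤ ε → s t * (t0 - t) / 2 ≤ S t0 - S t
  cont : ∀ v, 0 < v → ContinuousOn (fun t => Φ t v) (Icc 0 ε)
  bound : ∀ t ∈ Icc 0 ε, ∀ v, 0 < v → |Φ t v| ≤ 1 / 2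
  upper : ∀ t ∈ Icc 0 ε, ∀ v, 0 < v → Φ t v ≤ -c * s t + K * v
  lip : ∀ t ∈ Icc 0 ε, ∀ v1 v2, 0 < v1 → 0 < v2 →
    |Φ t v1 - Φ t v2| ≤ K * (1 + √(s t / v1)) * |v1 - v2|

/-- positive solution on `[t1,t0]`. -/
def Sol (Φ : ℝ → ℝ → ℝ) (w : ℝ → ℝ) (t1 t0 : ℝ) : Prop :=
  ∀ t ∈ Icc t1 t0, HasDerivWithinAt w (Φ t (w t)) (Icc t1 t0) t ∧ 0 < w t

lemma Sol.mono {Φ : ℝ → ℝ → ℝ} {w : ℝ → ℝ} {t1 t0 r1 r0 : ℝ} (h : Sol Φ w t1 t0)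
    (h1 : t1 ≤ r1) (h0 : r0 ≤ t0) : Sol Φ w r1 r0 := fun t ht =>
  ⟨(h t ⟨h1.trans ht.1, ht.2.trans h0⟩).1.mono (Icc_subset_Icc h1 h0),
    (h t ⟨h1.trans ht.1, ht.2.trans h0⟩).2⟩

lemma Sol.cont {Φ : ℝ → ℝ → ℝ} {w : ℝ → ℝ} {t1 t0 : ℝ} (h : Sol Φ w t1 t0) :
    ContinuousOn w (Icc t1 t0) := fun t ht => (h t ht).1.continuousWithinAt

lemma Sol.deriv {Φ : ℝ → ℝ → ℝ} {w : ℝ → ℝ} {t1 t0 : ℝ} (h : Sol Φ w t1 t0) :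
    ∀ t ∈ Ioo t1 t0, HasDerivAt w (Φ t (w t)) t := fun t ht =>
  (h t ⟨ht.1.le, ht.2.le⟩).1.hasDerivAt (Icc_mem_nhds ht.1 ht.2)

lemma Strip.exists_sol {ε c K : ℝ} {s S : ℝ → ℝ} {Φ : ℝ → ℝ → ℝ} (h : Strip ε c K s S Φ)
    {t0 v0 : ℝ} (ht0 : t0 ∈ Icc 0 ε) (hv0 : 0 < v0) : ∃ w, w t0 = v0 ∧ Sol Φ w 0 t0 := by
  set κ := v0 * Real.exp (-((K+1) * ε)) / 2 with hκ
  have hκ0 : 0 < κ := by positivity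
  have hm : ∀ v, 0 < max v κ := fun v => lt_max_of_lt_right hκ0
  have hPL : IsPicardLindelof (fun t v => Φ t (max v κ)) (tmin := 0) (tmax := t0)
      ⟨t0, ht0.1, le_rfl⟩ v0 (1/2 * Real.toNNReal ε) 0 (1/2) (Real.toNNReal (K * (1 + √(ε / κ)))) := by
    constructor
    · intro t ht
      apply LipschitzOnWith.of_dist_le_mul
      intro x _ y _
      have ht' : t ∈ Icc 0 ε := ⟨ht.1, ht.2.trans ht0.2⟩
      rw [Real.dist_eq, Real.dist_eq]
      refine (h.lip t ht' _ _ (hm x) (hm y)).trans ?_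
      have h1 : |max x κ - max y κ| ≤ |x - y| := by
        exact abs_max_sub_max_le_abs x y κ
      have h2 : √(s t / max x κ) ≤ √(ε / κ) := by
        apply Real.sqrt_le_sqrt
        apply div_le_div₀ h.hε.le (h.s_le t ht') hκ0 (le_max_right _ _)
      have := h.hK
      rw [Real.coe_toNNReal _ (by positivity)]
      gcongr
    · intro x _
      exact (h.cont _ (hm x)).mono (Icc_subset_Icc le_rfl ht0.2)
    · intro t ht x _
      have := h.bound t ⟨ht.1, ht.2.trans ht0.2⟩ _ (hm x)
      simpa using this
    · have := ht0.1
      have := ht0.2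
      simp only [NNReal.coe_mul, Real.coe_toNNReal _ h.hε.le, sub_self, sub_zero, NNReal.coe_zero]
      rw [max_eq_right (by linarith)]; push_cast; linarith
  obtain ⟨w, hw0, hw⟩ := hPL.exists_eq_forall_mem_Icc_hasDerivWithinAt₀
  simp only at hw0
  refine ⟨w, hw0, ?_⟩
  have hκlt : ∀ t ∈ Icc 0 t0, κ < w t := by
    intro t1 ht1
    by_contra hcon
    push Not at hcon
    have hB := image_le_of_deriv_right_lt_deriv_boundary (f := w)
      (f' := fun t => Φ t (max (w t) κ)) (a := t1) (b := t0)
      (B := fun t => κ * Real.exp ((K+1) * (t - t1)))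
      (B' := fun t => κ * (Real.exp ((K+1) * (t - t1)) * (K+1)))
      (fun t ht => (hw t ⟨ht1.1.trans ht.1, ht.2⟩).continuousWithinAt.mono
        (Icc_subset_Icc ht1.1 le_rfl))
      (fun t ht => (hw t ⟨ht1.1.trans ht.1, ht.2.le⟩).mono_of_mem_nhdsWithin
        (mem_of_superset (Icc_mem_nhdsGE ht.2) (Icc_subset_Icc (ht1.1.trans ht.1) le_rfl)))
      (by simpa using hcon)
      (fun x => by
        have h1 : HasDerivAt (fun t => (K+1) * (t - t1)) (K+1) x := by
          simpa using ((hasDerivAt_id x).sub_const t1).const_mul (K+1)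
        exact h1.exp.const_mul κ)
      (by
        intro x hx hxe
        have hx' : x ∈ Icc 0 ε := ⟨ht1.1.trans hx.1, hx.2.le.trans ht0.2⟩
        have h1 := h.upper x hx' _ (hm (w x))
        have h2 : κ ≤ w x := by
          rw [hxe]
          have : 1 ≤ Real.exp ((K+1) * (x - t1)) := by
            apply Real.one_le_exp
            have := h.hK
            have := hx.1
            apply mul_nonneg <;> linarith
          nlinarith
        have h3 := h.s_nonneg x hx'
        have h4 := h.hc
        rw [max_eq_left h2] at h1 ⊢
        have : κ * (Real.exp ((K+1) * (x - t1)) * (K+1)) = w x * (K+1) := by rw [hxe]; ring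
        rw [this]
        nlinarith)
      (right_mem_Icc.2 ht1.2)
    rw [hw0] at hB
    have h1 : Real.exp ((K+1) * (t0 - t1)) ≤ Real.exp ((K+1)*ε) := by
      apply Real.exp_le_exp.2
      have := h.hK; have := ht1.1; have := ht0.2
      apply mul_le_mul_of_nonneg_left <;> linarith
    have h2 : κ * Real.exp ((K+1)*ε) = v0 / 2 := by
      rw [hκ, div_mul_eq_mul_div, mul_assoc, ← Real.exp_add]; simp
    nlinarith
  intro t ht
  have := hκlt t ht
  refine ⟨?_, hκ0.trans this⟩
  have h1 := hw t ht
  rwa [max_eq_left this.le] at h1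

lemma Strip.lower {ε c K : ℝ} {s S : ℝ → ℝ} {Φ : ℝ → ℝ → ℝ} (h : Strip ε c K s S Φ)
    {w : ℝ → ℝ} {t1 t0 : ℝ} (h1 : 0 ≤ t1) (h0 : t0 ≤ ε) (hw : Sol Φ w t1 t0) :
    ∀ t ∈ Icc t1 t0, c * Real.exp (-(K * ε)) / 2 * (s t * (t0 - t)) < w t := by
  intro t ht
  have hle : t1 ≤ t0 := ht.1.trans ht.2
  have hanti : AntitoneOn (fun t => w t * Real.exp (-(K * t)) + c * Real.exp (-(K * ε)) * S t)
      (Icc t1 t0) := by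
    have hd : ∀ x ∈ Ioo t1 t0, HasDerivAt
        (fun t => w t * Real.exp (-(K * t)) + c * Real.exp (-(K * ε)) * S t)
        (Φ x (w x) * Real.exp (-(K * x)) + w x * (Real.exp (-(K * x)) * (-K))
          + c * Real.exp (-(K * ε)) * s x) x := by
      intro x hx
      have e1 : HasDerivAt (fun t => -(K * t)) (-K) x := by
        simpa using (hasDerivAt_id x).const_mul (-K)
      exact ((hw.deriv x hx).mul e1.exp).add ((h.S_deriv x).const_mul _)
    apply antitoneOn_of_deriv_nonpos (convex_Icc _ _)
    · apply ContinuousOn.add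
      · exact hw.cont.mul (by fun_prop)
      · exact ContinuousOn.mul continuousOn_const
          (fun x _ => (h.S_deriv x).continuousAt.continuousWithinAt)
    · intro x hx
      rw [interior_Icc] at hx
      exact (hd x hx).differentiableAt.differentiableWithinAt
    · intro x hx
      rw [interior_Icc] at hx
      rw [(hd x hx).deriv]
      have hx' : x ∈ Icc 0 ε := ⟨h1.trans hx.1.le, hx.2.le.trans h0⟩
      have u := h.upper x hx' _ (hw x ⟨hx.1.le, hx.2.le⟩).2
      have hs := h.s_nonneg x hx'
      have hex : Real.exp (-(K * ε)) ≤ Real.exp (-(K * x)) := by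
        apply Real.exp_le_exp.2
        have := h.hK; have := hx'.2
        nlinarith
      have hp := Real.exp_pos (-(K * x))
      have h2 := mul_le_mul_of_nonneg_right u hp.le
      have h3 := mul_le_mul_of_nonneg_left hex (mul_nonneg h.hc.le hs)
      nlinarith
  have := hanti ht (right_mem_Icc.2 hle) ht.2
  simp only at this
  have hpos := (hw t0 (right_mem_Icc.2 hle)).2
  have hpost := (hw t ht).2
  have ht' : 0 ≤ t := h1.trans ht.1
  have hS := h.S_lb t t0 ht' ht.2 h0
  have e1 : Real.exp (-(K * t)) ≤ 1 := Real.exp_le_one_iff.2 (by have := h.hK; nlinarith)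
  have e2 := Real.exp_pos (-(K * t0))
  have e3 := mul_pos hpos e2
  have e4 := mul_le_mul_of_nonneg_left e1 hpost.le
  have e5 := mul_le_mul_of_nonneg_left hS (mul_nonneg h.hc.le (Real.exp_pos (-(K * ε))).le)
  nlinarith

lemma Strip.bilip {ε c K : ℝ} {s S : ℝ → ℝ} {Φ : ℝ → ℝ → ℝ} (h : Strip ε c K s S Φ) :
    ∃ C : ℝ, 1 ≤ C ∧ ∀ t1 t0 w1 w2, 0 ≤ t1 → t1 ≤ t0 → t0 ≤ ε → Sol Φ w1 t1 t0 → Sol Φ w2 t1 t0 →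
      |w1 t1 - w2 t1| ≤ C * |w1 t0 - w2 t0| ∧ |w1 t0 - w2 t0| ≤ C * |w1 t1 - w2 t1| := by
  set c' := c * Real.exp (-(K * ε)) / 2 with hc'
  have hc'0 : 0 < c' := by have := h.hc; positivity
  set C1 := 1 / √c' with hC1
  have hC10 : 0 < C1 := by positivity
  refine ⟨Real.exp (K * (ε + 2 * C1 * √ε)), ?_, ?_⟩
  · apply Real.one_le_exp
    have := h.hK; have := h.hε; positivity
  intro t1 t0 w1 w2 ht1 hle ht0 hw1 hw2
  have hK := h.hK
  set N : ℝ → ℝ := fun t => K * (t - 2 * C1 * √(t0 - t)) with hN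
  have hNc : Continuous N := by simp only [hN]; fun_prop
  have hNd : ∀ x ∈ Ioo t1 t0, HasDerivAt N (K * (1 + C1 / √(t0 - x))) x := by
    intro x hx
    have h1 : HasDerivAt (fun t => t0 - t) (-1) x := by
      simpa using (hasDerivAt_id x).const_sub t0
    have h2 : t0 - x ≠ 0 := by have := hx.2; intro h; linarith
    have h3 := (((hasDerivAt_id x).sub ((h1.sqrt h2).const_mul (2 * C1))).const_mul K)
    have e : K * (1 + C1 / √(t0 - x)) = K * (1 - 2 * C1 * (-1 / (2 * √(t0 - x)))) := by
      have : √(t0 - x) ≠ 0 := (Real.sqrt_pos.2 (by have := hx.2; linarith)).ne'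
      field_simp
      ring
    rw [e]
    exact h3
  have hDd : ∀ x ∈ Ioo t1 t0, HasDerivAt (fun t => w1 t - w2 t) (Φ x (w1 x) - Φ x (w2 x)) x :=
    fun x hx => (hw1.deriv x hx).sub (hw2.deriv x hx)
  have hbd : ∀ x ∈ Ioo t1 t0, |Φ x (w1 x) - Φ x (w2 x)| ≤ K * (1 + C1 / √(t0 - x)) * |w1 x - w2 x| := by
    intro x hx
    have hx1 : x ∈ Icc t1 t0 := ⟨hx.1.le, hx.2.le⟩
    have hx' : x ∈ Icc 0 ε := ⟨ht1.trans hx.1.le, hx.2.le.trans ht0⟩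
    have p1 := (hw1 x hx1).2
    refine (h.lip x hx' _ _ p1 (hw2 x hx1).2).trans ?_
    have hl := h.lower ht1 ht0 hw1 x hx1
    have hpos : 0 < t0 - x := by have := hx.2; linarith
    have : √(s x / w1 x) ≤ C1 / √(t0 - x) := by
      rw [hC1, div_div, ← Real.sqrt_mul hc'0.le, ← Real.sqrt_one, ← Real.sqrt_div zero_le_one]
      apply Real.sqrt_le_sqrt
      rw [div_le_div_iff₀ p1 (by positivity)]
      nlinarith
    gcongr
  have hDc : ContinuousOn (fun t => w1 t - w2 t) (Icc t1 t0) := hw1.cont.sub hw2.cont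
  have key : ∀ x ∈ Ioo t1 t0, |(w1 x - w2 x) * (Φ x (w1 x) - Φ x (w2 x))| ≤
      K * (1 + C1 / √(t0 - x)) * (w1 x - w2 x)^2 := by
    intro x hx
    rw [abs_mul, ← sq_abs (w1 x - w2 x)]
    nlinarith [hbd x hx, abs_nonneg (w1 x - w2 x)]
  have hmono : MonotoneOn (fun t => (w1 t - w2 t)^2 * Real.exp (2 * N t)) (Icc t1 t0) := by
    have hd : ∀ x ∈ Ioo t1 t0, HasDerivAt (fun t => (w1 t - w2 t)^2 * Real.exp (2 * N t)) _ x :=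
      fun x hx => ((hDd x hx).pow 2).mul ((hNd x hx).const_mul 2).exp
    apply monotoneOn_of_deriv_nonneg (convex_Icc _ _)
    · exact (hDc.pow 2).mul (by fun_prop)
    · intro x hx
      rw [interior_Icc] at hx
      exact (hd x hx).differentiableAt.differentiableWithinAt
    · intro x hx
      rw [interior_Icc] at hx
      rw [(hd x hx).deriv]
      have := key x hx
      rw [abs_le] at this
      have e := Real.exp_pos (2 * N x)
      have : 0 ≤ (2 * ((w1 x - w2 x) * (Φ x (w1 x) - Φ x (w2 x))) + 2 * (K * (1 + C1 / √(t0 - x)) * (w1 x - w2 x)^2)) * Real.exp (2 * N x) := by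
        apply mul_nonneg _ e.le
        linarith
      refine this.trans_eq ?_
      simp
      ring
  have hanti : AntitoneOn (fun t => (w1 t - w2 t)^2 * Real.exp (-2 * N t)) (Icc t1 t0) := by
    have hd : ∀ x ∈ Ioo t1 t0, HasDerivAt (fun t => (w1 t - w2 t)^2 * Real.exp (-2 * N t)) _ x :=
      fun x hx => ((hDd x hx).pow 2).mul ((hNd x hx).const_mul (-2)).exp
    apply antitoneOn_of_deriv_nonpos (convex_Icc _ _)
    · exact (hDc.pow 2).mul (by fun_prop)
    · intro x hx
      rw [interior_Icc] at hx
      exact (hd x hx).differentiableAt.differentiableWithinAt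
    · intro x hx
      rw [interior_Icc] at hx
      rw [(hd x hx).deriv]
      have := key x hx
      rw [abs_le] at this
      have e := Real.exp_pos (-2 * N x)
      have : 0 ≤ (-2 * ((w1 x - w2 x) * (Φ x (w1 x) - Φ x (w2 x))) + 2 * (K * (1 + C1 / √(t0 - x)) * (w1 x - w2 x)^2)) * Real.exp (-2 * N x) := by
        apply mul_nonneg _ e.le
        linarith
      rw [← neg_nonneg]
      refine this.trans_eq ?_
      simp
      ring
  have hNN : N t0 - N t1 ≤ K * (ε + 2 * C1 * √ε) := by
    simp only [hN, sub_self, Real.sqrt_zero]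
    have : √(t0 - t1) ≤ √ε := Real.sqrt_le_sqrt (by linarith)
    have : 2 * C1 * √(t0 - t1) ≤ 2 * C1 * √ε := by gcongr
    have : K * (t0 - t1 + 2 * C1 * √(t0 - t1)) ≤ K * (ε + 2 * C1 * √ε) := by
      gcongr; linarith
    linarith
  have hm1 := hmono (left_mem_Icc.2 hle) (right_mem_Icc.2 hle) hle
  have hm2 := hanti (left_mem_Icc.2 hle) (right_mem_Icc.2 hle) hle
  simp only at hm1 hm2
  have fin : ∀ A B n m : ℝ, A^2 * Real.exp (2 * n) ≤ B^2 * Real.exp (2 * m) → m - n ≤ K * (ε + 2 * C1 * √ε) →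
      |A| ≤ Real.exp (K * (ε + 2 * C1 * √ε)) * |B| := by
    intro A B n m hh hmn
    have h1 : |A| * Real.exp n ≤ |B| * Real.exp m := by
      refine abs_le_of_sq_le_sq' ?_ (by positivity) |>.2
      have e1 : Real.exp (2*n) = Real.exp n ^ 2 := by rw [← Real.exp_nat_mul]; norm_num
      have e2 : Real.exp (2*m) = Real.exp m ^ 2 := by rw [← Real.exp_nat_mul]; norm_num
      rw [mul_pow, mul_pow, sq_abs, sq_abs, ← e1, ← e2]; exact hh
    have h2 : |A| ≤ Real.exp (m - n) * |B| := by
      rw [Real.exp_sub, div_mul_eq_mul_div, le_div_iff₀ (Real.exp_pos n)]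
      linarith
    refine h2.trans ?_
    gcongr
  refine ⟨fin _ _ _ _ hm1 hNN, fin _ _ (-N t0) (-N t1) ?_ (by linarith)⟩
  simpa only [mul_neg, neg_mul] using hm2

structure FI (ε : ℝ) (s : ℝ → ℝ) (Φ a : ℝ → ℝ → ℝ) : Prop where
  cont : Continuous (fun p : ℝ × ℝ => a p.1 p.2)
  zero : ∀ v, 0 ≤ v → a 0 v = v
  mono : ∃ m, 0 < m ∧ ∀ t ∈ Icc 0 ε, ∀ v1 v2, 0 ≤ v1 → v1 ≤ v2 → m * (v2 - v1) ≤ a t v2 - a t v1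
  leaf : ∃ c', 0 < c' ∧ ∀ t0 ∈ Icc 0 ε, ∀ v0, 0 < v0 → ∃ w, w t0 = v0 ∧ Sol Φ w 0 t0 ∧
    ∀ t ∈ Icc 0 t0, a t (w t) = a t0 v0 ∧ |w t - v0| ≤ (t0 - t) / 2 ∧ c' * (s t * (t0 - t)) ≤ w t
  const : ∀ t1 t0 w, 0 ≤ t1 → t1 ≤ t0 → t0 ≤ ε → Sol Φ w t1 t0 → a t1 (w t1) = a t0 (w t0)

lemma Strip.sol_bound {ε c K : ℝ} {s S : ℝ → ℝ} {Φ : ℝ → ℝ → ℝ} (h : Strip ε c K s S Φ)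
    {w : ℝ → ℝ} {t1 t0 : ℝ} (h1 : 0 ≤ t1) (h0 : t0 ≤ ε) (hw : Sol Φ w t1 t0) :
    ∀ t ∈ Icc t1 t0, |w t - w t0| ≤ (t0 - t) / 2 := by
  intro t ht
  have := Convex.norm_image_sub_le_of_norm_hasDerivWithin_le (f := w) (C := 1/2)
    (fun x hx => (hw x hx).1)
    (fun x hx => by
      rw [Real.norm_eq_abs]
      exact h.bound x ⟨h1.trans hx.1, hx.2.trans h0⟩ _ (hw x hx).2) (convex_Icc t1 t0)
    (right_mem_Icc.2 (ht.1.trans ht.2)) ht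
  rw [Real.norm_eq_abs, Real.norm_eq_abs, abs_of_nonpos (a := t - t0) (by linarith [ht.2])] at this
  linarith

lemma Strip.exists_FI {ε c K : ℝ} {s S : ℝ → ℝ} {Φ : ℝ → ℝ → ℝ} (h : Strip ε c K s S Φ) :
    ∃ a, FI ε s Φ a := by
  classical
  obtain ⟨C, hC1, hC⟩ := h.bilip
  have hex : ∀ p : ℝ × ℝ, ∃ w : ℝ → ℝ, p.1 ∈ Icc 0 ε → 0 < p.2 → w p.1 = p.2 ∧ Sol Φ w 0 p.1 := by
    intro p
    by_cases h1 : p.1 ∈ Icc 0 ε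
    · by_cases h2 : 0 < p.2
      · obtain ⟨w, hw⟩ := h.exists_sol h1 h2
        exact ⟨w, fun _ _ => hw⟩
      · exact ⟨0, fun _ h => absurd h h2⟩
    · exact ⟨0, fun h => absurd h h1⟩
  choose W hW using hex
  set T : Set (ℝ × ℝ) := {p | p.1 ∈ Icc 0 ε ∧ 0 < p.2} with hT
  set A0 : ℝ × ℝ → ℝ := fun p => W p 0 with hA0
  have huniq : ∀ t0 w, t0 ∈ Icc 0 ε → Sol Φ w 0 t0 → A0 (t0, w t0) = w 0 := by
    intro t0 w ht0 hw
    have hp := (hw t0 (right_mem_Icc.2 ht0.1)).2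
    obtain ⟨e1, e2⟩ := hW (t0, w t0) ht0 hp
    have := (hC 0 t0 _ _ le_rfl ht0.1 ht0.2 e2 hw).1
    simp only at e1
    rw [e1] at this
    simp at this
    simp only [hA0]
    linarith [sub_eq_zero.1 this]
  have hdiff : ∀ t ∈ Icc 0 ε, ∀ v1 v2, 0 < v1 → 0 < v2 →
      |A0 (t, v1) - A0 (t, v2)| ≤ C * |v1 - v2| ∧ |v1 - v2| ≤ C * |A0 (t, v1) - A0 (t, v2)| := by
    intro t ht v1 v2 h1 h2
    obtain ⟨e1, e2⟩ := hW (t, v1) ht h1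
    obtain ⟨e3, e4⟩ := hW (t, v2) ht h2
    have := hC 0 t _ _ le_rfl ht.1 ht.2 e2 e4
    simp only at e1 e3
    rwa [e1, e3] at this
  have hconst : ∀ t1 t0 w, 0 ≤ t1 → t1 ≤ t0 → t0 ≤ ε → Sol Φ w t1 t0 →
      A0 (t1, w t1) = A0 (t0, w t0) := by
    intro t1 t0 w h1 h2 h3 hw
    have ht0 : t0 ∈ Icc 0 ε := ⟨h1.trans h2, h3⟩
    have hp := (hw t0 (right_mem_Icc.2 h2)).2
    obtain ⟨e1, e2⟩ := hW (t0, w t0) ht0 hp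
    simp only at e1 e2
    have h4 := (hC t1 t0 _ _ h1 h2 h3 (e2.mono h1 le_rfl) hw).1
    rw [e1] at h4
    simp at h4
    rw [← sub_eq_zero.1 h4, huniq t1 _ ⟨h1, h2.trans h3⟩ (e2.mono le_rfl h2)]
  have hlipaux : ∀ t ∈ Icc 0 ε, ∀ t' ∈ Icc 0 ε, t ≤ t' → ∀ v v', 0 < v → 0 < v' →
      |A0 (t, v) - A0 (t', v')| ≤ 2 * C * max |t - t'| |v - v'| := by
    intro t ht t' ht' htt v v' hv hv'
    obtain ⟨e1, e2⟩ := hW (t', v') ht' hv'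
    simp only at e1 e2
    have hb := h.sol_bound le_rfl ht'.2 e2 t ⟨ht.1, htt⟩
    have hcc := hconst t t' _ ht.1 htt ht'.2 (e2.mono ht.1 le_rfl)
    rw [e1] at hb hcc
    rw [← hcc]
    refine (hdiff t ht v _ hv (e2 t ⟨ht.1, htt⟩).2).1.trans ?_
    have m1 := le_max_left |t - t'| |v - v'|
    have m2 := le_max_right |t - t'| |v - v'|
    have m3 : t' - t ≤ |t - t'| := by rw [abs_sub_comm]; exact le_abs_self _
    have m4 : |v - W (t', v') t| ≤ |v - v'| + |W (t', v') t - v'| := by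
      rw [abs_sub_comm (W (t', v') t)]; exact abs_sub_le _ _ _
    have m5 := abs_nonneg (t - t')
    nlinarith
  have hLip : LipschitzOnWith (Real.toNNReal (2 * C)) A0 T := by
    apply LipschitzOnWith.of_dist_le_mul
    rintro ⟨t, v⟩ ⟨ht, hv⟩ ⟨t', v'⟩ ⟨ht', hv'⟩
    rw [Real.coe_toNNReal _ (by linarith), Real.dist_eq, Prod.dist_eq, Real.dist_eq, Real.dist_eq]
    rcases le_total t t' with hh | hh
    · exact hlipaux t ht t' ht' hh v v' hv hv'
    · have := hlipaux t' ht' t ht hh v' v hv' hv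
      rwa [abs_sub_comm, abs_sub_comm t', abs_sub_comm v'] at this
  obtain ⟨g, hg, hgA⟩ := hLip.extend_real
  have hgA' : ∀ t ∈ Icc 0 ε, ∀ v, 0 < v → g (t, v) = A0 (t, v) := fun t ht v hv =>
    (hgA (show (t, v) ∈ T from ⟨ht, hv⟩)).symm
  have hgc : Continuous g := hg.continuous
  -- strict order for positive v
  have hpos : ∀ t ∈ Icc 0 ε, ∀ v1 v2, 0 < v1 → v1 ≤ v2 → (1 / C) * (v2 - v1) ≤ g (t, v2) - g (t, v1) := by
    intro t ht v1 v2 h1 h12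
    rw [hgA' t ht _ h1, hgA' t ht _ (h1.trans_le h12)]
    obtain ⟨e1, e2⟩ := hW (t, v1) ht h1
    obtain ⟨e3, e4⟩ := hW (t, v2) ht (h1.trans_le h12)
    simp only at e1 e2 e3 e4
    have hd := (hdiff t ht v2 v1 (h1.trans_le h12) h1).2
    rw [abs_of_nonneg (by linarith)] at hd
    have hsgn : A0 (t, v1) ≤ A0 (t, v2) := by
      by_contra hcon
      push Not at hcon
      have hcont : ContinuousOn (fun τ => W (t, v2) τ - W (t, v1) τ) (Icc 0 t) := e4.cont.sub e2.cont
      have := intermediate_value_Icc ht.1 hcont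
      have h0 : (0 : ℝ) ∈ Icc (W (t, v2) 0 - W (t, v1) 0) (W (t, v2) t - W (t, v1) t) := by
        constructor
        · simp only [hA0] at hcon; linarith
        · rw [e1, e3]; linarith
      obtain ⟨τ, hτ, hτ0⟩ := this h0
      simp only at hτ0
      have := (hC τ t _ _ hτ.1 hτ.2 ht.2 (e4.mono hτ.1 le_rfl) (e2.mono hτ.1 le_rfl)).2
      rw [hτ0, e1, e3] at this
      simp at this
      have : v2 = v1 := by linarith [sub_eq_zero.1 this]
      subst this
      exact lt_irrefl _ hcon
    rw [abs_of_nonneg (by linarith)] at hd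
    rw [one_div, inv_mul_le_iff₀ (by linarith)]
    exact hd
  refine ⟨fun t v => g (t, v), hgc, ?_, ⟨1 / C, by positivity, ?_⟩, ⟨c * Real.exp (-(K * ε)) / 2, by have := h.hc; positivity, ?_⟩, ?_⟩
  · have hz : ∀ v, 0 < v → g (0, v) = v := by
      intro v hv
      have h0 : (0:ℝ) ∈ Icc 0 ε := ⟨le_rfl, h.hε.le⟩
      rw [hgA' 0 h0 v hv]
      exact (hW (0, v) h0 hv).1
    intro v hv
    rcases hv.eq_or_lt with rfl | hv
    · have h1 : Tendsto (fun v => g (0, v)) (nhdsWithin 0 (Ioi 0)) (nhds (g (0, 0))) :=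
        ((hgc.comp (by fun_prop : Continuous fun v : ℝ => ((0 : ℝ), v))).tendsto 0).mono_left nhdsWithin_le_nhds
      have h2 : Tendsto (fun v : ℝ => v) (nhdsWithin 0 (Ioi 0)) (nhds 0) := tendsto_id.mono_left nhdsWithin_le_nhds
      refine tendsto_nhds_unique h1 (h2.congr' ?_)
      filter_upwards [self_mem_nhdsWithin] with v hv
      exact (hz v hv).symm
    · exact hz v hv
  · intro t ht v1 v2 h1 h12
    rcases h1.eq_or_lt with rfl | h1
    · rcases h12.eq_or_lt with rfl | h12
      · simp
      · have q1 : Tendsto (fun v => (1 / C) * (v2 - v)) (nhdsWithin 0 (Ioi 0)) (nhds ((1 / C) * (v2 - 0))) :=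
          ((by fun_prop : Continuous fun v : ℝ => (1 / C) * (v2 - v)).tendsto 0).mono_left nhdsWithin_le_nhds
        have q2 : Tendsto (fun v => g (t, v2) - g (t, v)) (nhdsWithin 0 (Ioi 0)) (nhds (g (t, v2) - g (t, 0))) :=
          ((by fun_prop : Continuous fun v : ℝ => g (t, v2) - g (t, v)).tendsto 0).mono_left nhdsWithin_le_nhds
        refine le_of_tendsto_of_tendsto q1 q2 ?_
        filter_upwards [Ioo_mem_nhdsGT h12] with v hv
        exact hpos t ht v v2 hv.1 hv.2.le
    · exact hpos t ht v1 v2 h1 h12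
  · intro t0 ht0 v0 hv0
    obtain ⟨e1, e2⟩ := hW (t0, v0) ht0 hv0
    simp only at e1 e2
    refine ⟨_, e1, e2, ?_⟩
    intro t ht
    have ht' : t ∈ Icc 0 ε := ⟨ht.1, ht.2.trans ht0.2⟩
    refine ⟨?_, ?_, (h.lower le_rfl ht0.2 e2 t ht).le⟩
    · have := hconst t t0 _ ht.1 ht.2 ht0.2 (e2.mono ht.1 le_rfl)
      rw [e1] at this
      rw [hgA' t0 ht0 _ hv0, hgA' t ht' _ (e2 t ht).2, this]
    · have := h.sol_bound le_rfl ht0.2 e2 t ht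
      rwa [e1] at this
  · intro t1 t0 w h1 h2 h3 hw
    rw [hgA' t1 ⟨h1, h2.trans h3⟩ _ (hw t1 (left_mem_Icc.2 h2)).2,
      hgA' t0 ⟨h1.trans h2, h3⟩ _ (hw t0 (right_mem_Icc.2 h2)).2]
    exact hconst t1 t0 w h1 h2 h3 hw

structure Lev (ε : ℝ) (a : ℝ → ℝ → ℝ) : Prop where
  hε : 0 < ε
  cont : Continuous (fun p : ℝ × ℝ => a p.1 p.2)
  zero : ∀ v, 0 ≤ v → a 0 v = v
  mono : ∃ m, 0 < m ∧ ∀ t ∈ Icc 0 ε, ∀ v1 v2, 0 ≤ v1 → v1 ≤ v2 → m * (v2 - v1) ≤ a t v2 - a t v1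
  level : ∀ t t0 v0, 0 ≤ t → t ≤ t0 → t0 ≤ ε → 0 ≤ v0 → ∃ v, 0 ≤ v ∧ a t v = a t0 v0 ∧
    |v - v0| ≤ (t0 - t) / 2 ∧ (0 < t → t < t0 → 0 < v)

lemma FI.lev {ε : ℝ} {s : ℝ → ℝ} {Φ a : ℝ → ℝ → ℝ} (h : FI ε s Φ a) (hε : 0 < ε)
    (hs0 : ∀ t ∈ Icc 0 ε, 0 ≤ s t) (hs : ∀ t ∈ Ioo 0 ε, 0 < s t) : Lev ε a := by
  refine ⟨hε, h.cont, h.zero, h.mono, ?_⟩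
  intro t t0 v0 ht htt ht0 hv0
  obtain ⟨m, hm, hmono⟩ := h.mono
  obtain ⟨c', hc', hleaf⟩ := h.leaf
  have ht' : t ∈ Icc 0 ε := ⟨ht, htt.trans ht0⟩
  have ht0' : t0 ∈ Icc 0 ε := ⟨ht.trans htt, ht0⟩
  have hst := hs0 t ht'
  have hlo0 : 0 ≤ c' * (s t * (t0 - t)) := by
    have : 0 ≤ t0 - t := by linarith
    positivity
  suffices H : ∃ v, c' * (s t * (t0 - t)) ≤ v ∧ a t v = a t0 v0 ∧ |v - v0| ≤ (t0 - t) / 2 by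
    obtain ⟨v, h1, h2, h3⟩ := H
    refine ⟨v, hlo0.trans h1, h2, h3, fun h4 h5 => lt_of_lt_of_le ?_ h1⟩
    have := hs t ⟨h4, by linarith⟩
    have h6 : 0 < t0 - t := by linarith
    positivity
  rcases hv0.eq_or_lt with rfl | hv0
  · set lo := c' * (s t * (t0 - t))
    have hca : ∀ t, Continuous (a t) := fun t => h.cont.comp (by fun_prop : Continuous fun v => (t, v))
    have key : ∀ v, 0 < v → lo ≤ v + (t0 - t) / 2 ∧ a t lo ≤ a t0 v ∧ a t0 v ≤ a t (v + (t0 - t) / 2) := by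
      intro v hv
      obtain ⟨w, e1, e2, e3⟩ := hleaf t0 ht0' v hv
      obtain ⟨e4, e5, e6⟩ := e3 t ⟨ht, htt⟩
      have e7 := (abs_le.1 e5).2
      refine ⟨by linarith, ?_, ?_⟩
      · rw [← e4]
        have := hmono t ht' lo (w t) hlo0 e6
        nlinarith
      · rw [← e4]
        have := hmono t ht' (w t) (v + (t0 - t)/2) (e2 t ⟨ht, htt⟩).2.le (by linarith)
        nlinarith
    have hlim : ∀ F G : ℝ → ℝ, Continuous F → Continuous G → (∀ v, 0 < v → F v ≤ G v) → F 0 ≤ G 0 := by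
      intro F G hF hG hFG
      refine le_of_tendsto_of_tendsto (b := nhdsWithin 0 (Ioi (0:ℝ))) (hF.continuousAt.continuousWithinAt.tendsto)
        (hG.continuousAt.continuousWithinAt.tendsto) ?_
      filter_upwards [self_mem_nhdsWithin] with v hv using hFG v hv
    have k1 : lo ≤ 0 + (t0 - t)/2 := hlim (fun _ => lo) (fun v => v + (t0-t)/2) (by fun_prop) (by fun_prop) (fun v hv => (key v hv).1)
    have k2 : a t lo ≤ a t0 0 := hlim (fun _ => a t lo) (a t0) (by fun_prop) (hca t0) (fun v hv => (key v hv).2.1)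
    have k3 : a t0 0 ≤ a t (0 + (t0-t)/2) := hlim (a t0) (fun v => a t (v + (t0-t)/2)) (hca t0)
      ((hca t).comp (by fun_prop)) (fun v hv => (key v hv).2.2)
    obtain ⟨v, hv, hv2⟩ := intermediate_value_Icc k1 (hca t).continuousOn ⟨k2, k3⟩
    refine ⟨v, hv.1, hv2, ?_⟩
    rw [abs_le]
    constructor <;> linarith [hv.1, hv.2]
  · obtain ⟨w, e1, e2, e3⟩ := hleaf t0 ht0' v0 hv0
    obtain ⟨e4, e5, e6⟩ := e3 t ⟨ht, htt⟩
    exact ⟨w t, e6, e4, e5⟩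

namespace Lev
variable {ε : ℝ} {a : ℝ → ℝ → ℝ}

lemma strict (h : Lev ε a) {t v1 v2 : ℝ} (ht : t ∈ Icc 0 ε) (h1 : 0 ≤ v1) (h2 : v1 < v2) :
    a t v1 < a t v2 := by
  obtain ⟨m, hm, hmono⟩ := h.mono
  have := hmono t ht v1 v2 h1 h2.le
  nlinarith [mul_pos hm (sub_pos.2 h2)]

lemma inj (h : Lev ε a) {t v1 v2 : ℝ} (ht : t ∈ Icc 0 ε) (h1 : 0 ≤ v1) (h2 : 0 ≤ v2)
    (he : a t v1 = a t v2) : v1 = v2 := by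
  rcases lt_trichotomy v1 v2 with h3 | h3 | h3
  · exact absurd he (h.strict ht h1 h3).ne
  · exact h3
  · exact absurd he (h.strict ht h2 h3).ne'

lemma le_iff (h : Lev ε a) {t v1 v2 : ℝ} (ht : t ∈ Icc 0 ε) (h1 : 0 ≤ v1) (h2 : 0 ≤ v2) :
    a t v1 ≤ a t v2 ↔ v1 ≤ v2 := by
  constructor
  · intro h3
    by_contra h4
    exact absurd h3 (not_le.2 (h.strict ht h2 (not_le.1 h4)))
  · intro h3
    rcases h3.eq_or_lt with h4 | h4
    · rw [h4]
    · exact (h.strict ht h1 h4).le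

lemma contv (h : Lev ε a) (t : ℝ) : Continuous (a t) :=
  h.cont.comp (by fun_prop : Continuous fun v => (t, v))

lemma path (h : Lev ε a) {t0 v0 : ℝ} (ht0 : t0 ∈ Icc 0 ε) (hv0 : 0 ≤ v0) :
    ∃ V : ℝ → ℝ, ContinuousOn V (Icc 0 t0) ∧ V t0 = v0 ∧ ∀ t ∈ Icc 0 t0, 0 ≤ V t ∧
      a t (V t) = a t0 v0 ∧ |V t - v0| ≤ (t0 - t) / 2 ∧ (0 < t → t < t0 → 0 < V t) := by
  have : ∀ t, ∃ v, t ∈ Icc 0 t0 → 0 ≤ v ∧ a t v = a t0 v0 ∧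
    |v - v0| ≤ (t0 - t) / 2 ∧ (0 < t → t < t0 → 0 < v) := by
    intro t
    by_cases ht : t ∈ Icc 0 t0
    · obtain ⟨v, hv⟩ := h.level t t0 v0 ht.1 ht.2 ht0.2 hv0
      exact ⟨v, fun _ => hv⟩
    · exact ⟨0, fun h => absurd h ht⟩
  choose V hV using this
  have hin : ∀ t ∈ Icc 0 t0, t ∈ Icc 0 ε := fun t ht => ⟨ht.1, ht.2.trans ht0.2⟩
  have hlip : ∀ t ∈ Icc 0 t0, ∀ t' ∈ Icc 0 t0, t ≤ t' → |V t - V t'| ≤ (t' - t) / 2 := by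
    intro t ht t' ht' htt
    obtain ⟨v, h1, h2, h3, h4⟩ := h.level t t' (V t') ht.1 htt (hin t' ht').2 (hV t' ht').1
    have : v = V t := h.inj (hin t ht) h1 (hV t ht).1 (by rw [h2, (hV t ht).2.1, (hV t' ht').2.1])
    rwa [this] at h3
  refine ⟨V, ?_, ?_, fun t ht => hV t ht⟩
  · have : LipschitzOnWith 1 V (Icc 0 t0) := by
      apply LipschitzOnWith.of_dist_le_mul
      intro x hx y hy
      rw [Real.dist_eq, Real.dist_eq]
      simp only [NNReal.coe_one, one_mul]
      rcases le_total x y with hxy | hxy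
      · have := hlip x hx y hy hxy
        rw [abs_of_nonpos (a := x - y) (by linarith)]; linarith
      · have := hlip y hy x hx hxy
        rw [abs_sub_comm, abs_of_nonneg (a := x - y) (by linarith)]; linarith
    exact this.continuousOn
  · have := (hV t0 (right_mem_Icc.2 ht0.1)).2.2.1
    simp at this
    linarith [sub_eq_zero.1 this]

lemma zero_mono (h : Lev ε a) {t t0 : ℝ} (ht : 0 ≤ t) (htt : t < t0) (ht0 : t0 ≤ ε) :
    a t 0 < a t0 0 := by
  have aux : ∀ t, 0 ≤ t → t ≤ t0 → a t 0 ≤ a t0 0 := by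
    intro t ht htt
    obtain ⟨v, h1, h2, -, -⟩ := h.level t t0 0 ht htt ht0 le_rfl
    rw [← h2]
    exact (h.le_iff ⟨ht, htt.trans ht0⟩ le_rfl h1).2 h1
  obtain ⟨v, h1, h2, -, h4⟩ := h.level ((t + t0)/2) t0 0 (by linarith) (by linarith) ht0 le_rfl
  have h5 := h4 (by linarith) (by linarith)
  obtain ⟨u, g1, g2, -, g4⟩ := h.level t ((t + t0)/2) 0 (by linarith) (by linarith) (by linarith) le_rfl
  rw [← h2]
  refine lt_of_le_of_lt ?_ (h.strict ⟨by linarith, by linarith⟩ le_rfl h5)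
  rw [← g2]
  exact (h.le_iff ⟨ht, by linarith⟩ le_rfl g1).2 g1

lemma nonneg (h : Lev ε a) {t v : ℝ} (ht : t ∈ Icc 0 ε) (hv : 0 ≤ v) : 0 ≤ a t v := by
  obtain ⟨u, h1, h2, -, -⟩ := h.level 0 t v le_rfl ht.1 ht.2 hv
  rw [← h2, h.zero u h1]; exact h1

end Lev

structure Pair (ε : ℝ) (a1 a2 : ℝ → ℝ → ℝ) : Prop where
  l1 : Lev ε a1
  l2 : Lev ε a2
  key : ∀ t t0 v v0, 0 ≤ t → t < t0 → t0 ≤ ε → 0 ≤ v → 0 ≤ v0 → a1 t v = a1 t0 v0 →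
    a2 t v < a2 t0 v0

lemma FI.pair {ε : ℝ} {s : ℝ → ℝ} {Φ1 Φ2 a1 a2 : ℝ → ℝ → ℝ} (h1 : FI ε s Φ1 a1) (h2 : FI ε s Φ2 a2)
    (hε : 0 < ε) (hs0 : ∀ t ∈ Icc 0 ε, 0 ≤ s t) (hs : ∀ t ∈ Ioo 0 ε, 0 < s t)
    (hΦ : ∀ t ∈ Ioo 0 ε, ∀ v, 0 < v → Φ2 t v < Φ1 t v) : Pair ε a1 a2 := by
  have L1 := h1.lev hε hs0 hs
  have L2 := h2.lev hε hs0 hs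
  refine ⟨L1, L2, ?_⟩
  have claim : ∀ t t0 v v0, 0 < t → t < t0 → t0 < ε → 0 < v → 0 < v0 → a1 t v = a1 t0 v0 →
    a2 t v < a2 t0 v0 := by
    intro t t0 v v0 ht htt ht0 hv hv0 he
    obtain ⟨_, -, hl1⟩ := h1.leaf
    obtain ⟨_, -, hl2⟩ := h2.leaf
    have ht0' : t0 ∈ Icc 0 ε := ⟨by linarith, ht0.le⟩
    have ht' : t ∈ Icc 0 ε := ⟨by linarith, by linarith⟩
    have htm : t ∈ Icc 0 t0 := ⟨by linarith, by linarith⟩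
    obtain ⟨w, w1, w2, w3⟩ := hl1 t0 ht0' v0 hv0
    obtain ⟨z, z1, z2, z3⟩ := hl2 t0 ht0' v0 hv0
    have hwt : v = w t := L1.inj ht' hv.le (w2 t htm).2.le (by rw [he, (w3 t htm).1])
    rw [hwt, ← (z3 t htm).1]
    apply L2.strict ht' (w2 t htm).2.le
    by_contra hcon
    push Not at hcon
    have hwm := w2.mono ht.le le_rfl
    have hzm := z2.mono ht.le le_rfl
    have hcmp : ∀ x ∈ Icc t t0, z x ≤ w x := by
      intro x hx
      have hd : ∀ {W : ℝ → ℝ} {Φ : ℝ → ℝ → ℝ}, Sol Φ W t t0 → ∀ x ∈ Ico t t0,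
          HasDerivWithinAt W (Φ x (W x)) (Ici x) x := by
        intro W Φ hS x hx
        refine ((hS x ⟨hx.1, hx.2.le⟩).1.mono (Icc_subset_Icc hx.1 le_rfl)).mono_of_mem_nhdsWithin ?_
        exact Icc_mem_nhdsGE hx.2
      refine image_le_of_deriv_right_lt_deriv_boundary' hzm.cont (hd hzm) hcon hwm.cont (hd hwm) ?_ hx
      intro y hy hyy
      rw [hyy]
      exact hΦ y ⟨by linarith [hy.1], by linarith [hy.2]⟩ _ (hwm y ⟨hy.1, hy.2.le⟩).2
    have hr : t0 ∈ Icc t t0 := right_mem_Icc.2 htt.le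
    have hD := ((hzm t0 hr).1.sub (hwm t0 hr).1)
    have hmax : IsLocalMaxOn (z - w) (Icc t t0) t0 := by
      apply IsMaxOn.localize
      intro x hx
      simp only [mem_ofPred_eq, Pi.sub_apply]
      rw [z1, w1]
      linarith [hcmp x hx]
    have := hmax.hasFDerivWithinAt_nonpos hD.hasFDerivWithinAt (y := t - t0)
      (mem_posTangentConeAt_of_segment_subset (by
        rw [show t0 + (t - t0) = t by ring, segment_symm, segment_eq_Icc htt.le]))
    simp at this
    rw [z1, w1] at this
    have h5 := hΦ t0 ⟨by linarith, ht0⟩ v0 hv0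
    nlinarith
  intro t t0 v v0 ht htt ht0 hv hv0 he
  have ht0' : t0 ∈ Icc 0 ε := ⟨by linarith, ht0⟩
  obtain ⟨V, V1, V2, V3⟩ := L1.path ht0' hv0
  have hVt : V t = v := L1.inj ⟨ht, by linarith⟩ (V3 t ⟨ht, htt.le⟩).1 hv (by
    rw [he, (V3 t ⟨ht, htt.le⟩).2.1])
  set φ : ℝ → ℝ := fun τ => a2 τ (V τ) with hφ
  have hφc : ContinuousOn φ (Icc t t0) := by
    apply L2.cont.comp_continuousOn (f := fun τ => (τ, V τ))
    exact continuousOn_id.prodMk (V1.mono (Icc_subset_Icc ht le_rfl))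
  have hin : ∀ τ ∈ Ioo t t0, 0 < V τ := fun τ hτ =>
    (V3 τ ⟨by linarith [hτ.1], hτ.2.le⟩).2.2.2 (by linarith [hτ.1]) hτ.2
  have hsm : ∀ x ∈ Ioo t t0, ∀ y ∈ Ioo t t0, x < y → φ x < φ y := by
    intro x hx y hy hxy
    apply claim x y (V x) (V y) (by linarith [hx.1]) hxy (by linarith [hy.2]) (hin x hx) (hin y hy)
    rw [(V3 x ⟨by linarith [hx.1], hx.2.le⟩).2.1, (V3 y ⟨by linarith [hy.1], hy.2.le⟩).2.1]
  have hm1 : (2*t+t0)/3 ∈ Ioo t t0 := ⟨by linarith, by linarith⟩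
  have hm2 : (t+2*t0)/3 ∈ Ioo t t0 := ⟨by linarith, by linarith⟩
  haveI := left_nhdsWithin_Ioo_neBot htt
  haveI := right_nhdsWithin_Ioo_neBot htt
  have k1 : φ t ≤ φ ((2*t+t0)/3) := by
    refine le_of_tendsto (x := nhdsWithin t (Ioo t t0)) (f := φ) ?_ ?_
    · exact ((hφc t (left_mem_Icc.2 htt.le)).mono Ioo_subset_Icc_self).tendsto
    · have : ∀ᶠ x in nhdsWithin t (Ioo t t0), x < (2*t+t0)/3 :=
        nhdsWithin_le_nhds (Iio_mem_nhds hm1.1)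
      filter_upwards [self_mem_nhdsWithin, this] with x hx hx2
      exact (hsm x hx _ hm1 hx2).le
  have k2 : φ ((t+2*t0)/3) ≤ φ t0 := by
    refine ge_of_tendsto (x := nhdsWithin t0 (Ioo t t0)) (f := φ) ?_ ?_
    · exact ((hφc t0 (right_mem_Icc.2 htt.le)).mono Ioo_subset_Icc_self).tendsto
    · have : ∀ᶠ x in nhdsWithin t0 (Ioo t t0), (t+2*t0)/3 < x :=
        nhdsWithin_le_nhds (Ioi_mem_nhds hm2.2)
      filter_upwards [self_mem_nhdsWithin, this] with x hx hx2
      exact (hsm _ hm2 x hx hx2).le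
  have k3 := hsm _ hm1 _ hm2 (by linarith)
  have : φ t < φ t0 := by linarith
  simp only [hφ, hVt, V2] at this
  exact this

namespace Pair
variable {ε : ℝ} {a1 a2 : ℝ → ℝ → ℝ}

lemma key_le (h : Pair ε a1 a2) {t t0 v v0 : ℝ} (ht : 0 ≤ t) (htt : t < t0) (ht0 : t0 ≤ ε)
    (hv : 0 ≤ v) (hv0 : 0 ≤ v0) (he : a1 t v ≤ a1 t0 v0) : a2 t v < a2 t0 v0 := by
  obtain ⟨u, h1, h2, -, -⟩ := h.l1.level t t0 v0 ht htt.le ht0 hv0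
  have h3 := h.key t t0 u v0 ht htt ht0 h1 hv0 h2
  have ht' : t ∈ Icc 0 ε := ⟨ht, by linarith⟩
  rw [← h2, h.l1.le_iff ht' hv h1] at he
  exact lt_of_le_of_lt ((h.l2.le_iff ht' hv h1).2 he) h3

lemma key2 (h : Pair ε a1 a2) {t t0 v v0 : ℝ} (ht : 0 ≤ t) (htt : t < t0) (ht0 : t0 ≤ ε)
    (hv : 0 ≤ v) (hv0 : 0 ≤ v0) (he : a2 t v = a2 t0 v0) : a1 t0 v0 < a1 t v := by
  by_contra hc
  exact absurd he (h.key_le ht htt ht0 hv hv0 (not_lt.1 hc)).ne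

lemma inj (h : Pair ε a1 a2) {t t0 v v0 : ℝ} (ht : t ∈ Icc 0 ε) (ht0 : t0 ∈ Icc 0 ε)
    (hv : 0 ≤ v) (hv0 : 0 ≤ v0) (h1 : a1 t v = a1 t0 v0) (h2 : a2 t v = a2 t0 v0) :
    t = t0 ∧ v = v0 := by
  have : t = t0 := by
    rcases lt_trichotomy t t0 with h3 | h3 | h3
    · exact absurd h2 (h.key t t0 v v0 ht.1 h3 ht0.2 hv hv0 h1).ne
    · exact h3
    · exact absurd h2 (h.key t0 t v0 v ht0.1 h3 ht.2 hv0 hv h1.symm).ne'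
  subst this
  exact ⟨rfl, h.l1.inj ht hv hv0 h1⟩

lemma lt_of_pos (h : Pair ε a1 a2) {t v : ℝ} (ht : 0 < t) (ht' : t ≤ ε) (hv : 0 ≤ v) :
    a1 t v < a2 t v := by
  obtain ⟨u, h1, h2, -, -⟩ := h.l1.level 0 t v le_rfl ht.le ht' hv
  have := h.key 0 t u v le_rfl ht ht' h1 hv h2
  rwa [h.l2.zero u h1, ← h.l1.zero u h1, h2] at this

end Pair

lemma image_open_ordConnected {φ : ℝ → ℝ} {I : Set ℝ} (hI : IsOpen I) (hI2 : I.OrdConnected)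
    (hφ : ContinuousOn φ I) (hm : StrictMonoOn φ I) : IsOpen (φ '' I) ∧ (φ '' I).OrdConnected := by
  have h2 : (φ '' I).OrdConnected := (hI2.isPreconnected.image φ hφ).ordConnected
  refine ⟨?_, h2⟩
  rw [isOpen_iff_mem_nhds]
  rintro _ ⟨x, hx, rfl⟩
  obtain ⟨l, u, hxl, hlu⟩ := mem_nhds_iff_exists_Ioo_subset.1 (hI.mem_nhds hx)
  have h3 : (l + x)/2 ∈ I := hlu ⟨by linarith [hxl.1], by linarith [hxl.1, hxl.2]⟩
  have h4 : (u + x)/2 ∈ I := hlu ⟨by linarith [hxl.1, hxl.2], by linarith [hxl.2]⟩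
  have := Icc_mem_nhds (hm h3 hx (by linarith [hxl.1])) (hm hx h4 (by linarith [hxl.2]))
  exact mem_of_superset this (h2.out (mem_image_of_mem _ h3) (mem_image_of_mem _ h4))

lemma isOpen_eq_Ioo {T : Set ℝ} (ho : IsOpen T) (hc : T.OrdConnected) {m M : ℝ}
    (hb : T ⊆ Icc m M) : ∃ α β, T = Ioo α β := by
  rcases T.eq_empty_or_nonempty with rfl | hne
  · exact ⟨1, 0, by simp⟩
  · refine ⟨sInf T, sSup T, ?_⟩
    have hbb : BddBelow T := ⟨m, fun x hx => (hb hx).1⟩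
    have hba : BddAbove T := ⟨M, fun x hx => (hb hx).2⟩
    apply Subset.antisymm
    · intro x hx
      obtain ⟨l, u, hxl, hlu⟩ := mem_nhds_iff_exists_Ioo_subset.1 (ho.mem_nhds hx)
      have h3 : (l + x)/2 ∈ T := hlu ⟨by linarith [hxl.1], by linarith [hxl.1, hxl.2]⟩
      have h4 : (u + x)/2 ∈ T := hlu ⟨by linarith [hxl.1, hxl.2], by linarith [hxl.2]⟩
      have h5 := csInf_le hbb h3
      have h6 := le_csSup hba h4
      exact ⟨by linarith [hxl.1], by linarith [hxl.2]⟩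
    · exact IsConnected.Ioo_csInf_csSup_subset ⟨hne, hc.isPreconnected⟩ hbb hba

def KeyFor (ε : ℝ) (a a' : ℝ → ℝ → ℝ) : Prop :=
  ∀ t t0 v v0, 0 ≤ t → t < t0 → t0 ≤ ε → 0 ≤ v → 0 ≤ v0 → a t v = a t0 v0 → a' t v < a' t0 v0

lemma leaf_fwd {ε : ℝ} {s : ℝ → ℝ} {Φ a a' : ℝ → ℝ → ℝ} (h : FI ε s Φ a) (hk : KeyFor ε a a')
    (hc' : Continuous (fun p : ℝ × ℝ => a' p.1 p.2)) {I : Set ℝ} {w : ℝ → ℝ}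
    (hI : IsOpen I) (hI2 : I.OrdConnected) (hI3 : I ⊆ Icc 0 ε)
    (hw : ∀ t ∈ I, HasDerivAt w (Φ t (w t)) t ∧ 0 < w t) :
    ∃ c J, IsOpen J ∧ J.OrdConnected ∧ (∀ t ∈ I, a t (w t) = c) ∧
      (fun t => a' t (w t)) '' I = J := by
  have h1 : ∀ x ∈ I, ∀ y ∈ I, x ≤ y → a x (w x) = a y (w y) := by
    intro x hx y hy hxy
    refine h.const x y w (hI3 hx).1 hxy (hI3 hy).2 ?_
    intro t ht
    have := hw t (hI2.out hx hy ht)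
    exact ⟨this.1.hasDerivWithinAt, this.2⟩
  have h2 : StrictMonoOn (fun t => a' t (w t)) I := by
    intro x hx y hy hxy
    exact hk x y _ _ (hI3 hx).1 hxy (hI3 hy).2 (hw x hx).2.le (hw y hy).2.le (h1 x hx y hy hxy.le)
  have h3 : ContinuousOn (fun t => a' t (w t)) I := by
    apply hc'.comp_continuousOn (f := fun τ => (τ, w τ))
    exact continuousOn_id.prodMk fun t ht => (hw t ht).1.continuousAt.continuousWithinAt
  obtain ⟨h4, h5⟩ := image_open_ordConnected hI hI2 h3 h2
  rcases I.eq_empty_or_nonempty with rfl | ⟨x, hx⟩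
  · exact ⟨0, _, h4, h5, by simp, rfl⟩
  · refine ⟨a x (w x), _, h4, h5, ?_, rfl⟩
    intro t ht
    rcases le_total t x with h6 | h6
    · exact h1 t ht x hx h6
    · exact (h1 x hx t ht h6).symm

lemma leaf_bwd {ε : ℝ} {s : ℝ → ℝ} {Φ a a' : ℝ → ℝ → ℝ} (h : FI ε s Φ a) (L : Lev ε a)
    (hk : KeyFor ε a a') {c : ℝ} {J : Set ℝ} {τ ν : ℝ → ℝ}
    (hJ : IsOpen J) (hJ2 : J.OrdConnected)
    (hτ : ∀ b ∈ J, τ b ∈ Icc 0 ε ∧ 0 < ν b ∧ a (τ b) (ν b) = c ∧ a' (τ b) (ν b) = b) :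
    ∃ α β w, Ioo α β = τ '' J ∧ (∀ b ∈ J, w (τ b) = ν b) ∧
      ∀ t ∈ Ioo α β, HasDerivAt w (Φ t (w t)) t := by
  obtain ⟨_, -, hleaf⟩ := h.leaf
  have huniq : ∀ b ∈ J, ∀ t v, t ∈ Icc 0 ε → 0 ≤ v → a t v = c → a' t v = b → t = τ b ∧ v = ν b := by
    intro b hb t v ht hv h1 h2
    obtain ⟨e1, e2, e3, e4⟩ := hτ b hb
    have : t = τ b := by
      rcases lt_trichotomy t (τ b) with h3 | h3 | h3
      · exact absurd (h2.trans e4.symm) (hk t _ v _ ht.1 h3 e1.2 hv e2.le (h1.trans e3.symm)).ne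
      · exact h3
      · exact absurd (h2.trans e4.symm) (hk _ t _ v e1.1 h3 ht.2 e2.le hv (h1.trans e3.symm).symm).ne'
    refine ⟨this, ?_⟩
    rw [this] at h1
    exact L.inj e1 hv e2.le (h1.trans e3.symm)
  have hτm : StrictMonoOn τ J := by
    intro b hb b' hb' hbb
    obtain ⟨e1, e2, e3, e4⟩ := hτ b hb
    obtain ⟨f1, f2, f3, f4⟩ := hτ b' hb'
    by_contra hcon
    rcases (not_lt.1 hcon).eq_or_lt with h3 | h3
    · have := L.inj e1 e2.le (v2 := ν b') f2.le (by rw [e3, ← h3, f3])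
      rw [← h3] at e4
      rw [← this] at f4
      linarith
    · have := hk _ _ _ _ f1.1 h3 e1.2 f2.le e2.le (f3.trans e3.symm)
      linarith
  -- main backwards leaf
  have hback : ∀ b ∈ J, ∀ b' ∈ J, b < b' → ∃ w : ℝ → ℝ, Sol Φ w (τ b) (τ b') ∧
      ∀ t ∈ Icc (τ b) (τ b'), ∃ b'' ∈ J, t = τ b'' ∧ w t = ν b'' := by
    intro b hb b' hb' hbb
    obtain ⟨e1, e2, e3, e4⟩ := hτ b hb
    obtain ⟨f1, f2, f3, f4⟩ := hτ b' hb'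
    obtain ⟨w, w1, w2, w3⟩ := hleaf _ f1 _ f2
    refine ⟨w, w2.mono e1.1 le_rfl, ?_⟩
    intro t ht
    have ht' : t ∈ Icc 0 (τ b') := ⟨e1.1.trans ht.1, ht.2⟩
    have ht'' : t ∈ Icc 0 ε := ⟨ht'.1, ht'.2.trans f1.2⟩
    have g1 : a t (w t) = c := by rw [(w3 t ht').1, f3]
    have g2 := (w2 t ht').2
    have lo : b ≤ a' t (w t) := by
      rcases ht.1.eq_or_lt with h3 | h3
      · have := L.inj e1 e2.le g2.le (by rw [e3, h3, g1])
        rw [← this, ← h3, e4]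
      · have := hk _ t _ (w t) e1.1 h3 ht''.2 e2.le g2.le (e3.trans g1.symm)
        linarith
    have hi : a' t (w t) ≤ b' := by
      rcases ht.2.eq_or_lt with h3 | h3
      · rw [h3, w1, f4]
      · have := hk t _ (w t) _ ht''.1 h3 f1.2 g2.le f2.le (g1.trans f3.symm)
        linarith
    have hin := hJ2.out hb hb' ⟨lo, hi⟩
    exact ⟨_, hin, huniq _ hin t (w t) ht'' g2.le g1 rfl⟩
  have hnear : ∀ b ∈ J, ∃ b1 ∈ J, ∃ b2 ∈ J, b1 < b ∧ b < b2 := by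
    intro b hb
    obtain ⟨l, u, hxl, hlu⟩ := mem_nhds_iff_exists_Ioo_subset.1 (hJ.mem_nhds hb)
    exact ⟨(l + b)/2, hlu ⟨by linarith [hxl.1], by linarith [hxl.1, hxl.2]⟩, (u+b)/2,
      hlu ⟨by linarith [hxl.1, hxl.2], by linarith [hxl.2]⟩, by linarith [hxl.1], by linarith [hxl.2]⟩
  have hTc : (τ '' J).OrdConnected := by
    constructor
    rintro _ ⟨b, hb, rfl⟩ _ ⟨b', hb', rfl⟩ t ht
    rcases lt_trichotomy b b' with h3 | h3 | h3
    · obtain ⟨w, -, hw⟩ := hback b hb b' hb' h3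
      obtain ⟨b'', h4, h5, -⟩ := hw t ht
      exact ⟨b'', h4, h5.symm⟩
    · subst h3
      exact ⟨b, hb, le_antisymm ht.1 ht.2⟩
    · exact absurd (ht.1.trans ht.2) (not_le.2 (hτm hb' hb h3))
  have hTo : IsOpen (τ '' J) := by
    rw [isOpen_iff_mem_nhds]
    rintro _ ⟨b, hb, rfl⟩
    obtain ⟨b1, h1, b2, h2, h3, h4⟩ := hnear b hb
    exact mem_of_superset (Icc_mem_nhds (hτm h1 hb h3) (hτm hb h2 h4))
      (hTc.out (mem_image_of_mem _ h1) (mem_image_of_mem _ h2))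
  obtain ⟨α, β, hT⟩ := isOpen_eq_Ioo hTo hTc (m := 0) (M := ε) (by
    rintro _ ⟨b, hb, rfl⟩; exact (hτ b hb).1)
  have hw : ∃ w : ℝ → ℝ, ∀ b ∈ J, w (τ b) = ν b := by
    have hinj := hτm.injOn
    exact ⟨fun t => ν (Function.invFunOn τ J t), fun b hb => by
      simp only
      congr 1
      exact hinj.leftInvOn_invFunOn hb⟩
  obtain ⟨w, hw⟩ := hw
  refine ⟨α, β, w, hT.symm, hw, ?_⟩
  rw [← hT]
  rintro _ ⟨b, hb, rfl⟩
  obtain ⟨b1, h1, b2, h2, h3, h4⟩ := hnear b hb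
  obtain ⟨u, hu1, hu2⟩ := hback b1 h1 b2 h2 (h3.trans h4)
  have hag : ∀ t ∈ Icc (τ b1) (τ b2), w t = u t := by
    intro t ht
    obtain ⟨b'', k1, k2, k3⟩ := hu2 t ht
    rw [k3, k2, hw _ k1]
  have hm1 := hτm h1 hb h3
  have hm2 := hτm hb h2 h4
  have hd := hu1.deriv (τ b) ⟨hm1, hm2⟩
  rw [← hag _ ⟨hm1.le, hm2.le⟩] at hd
  apply hd.congr_of_eventuallyEq
  filter_upwards [Icc_mem_nhds hm1 hm2] with t ht using hag t ht

lemma extend_iso {F : ℝ → ℝ} {m M : ℝ} (hmM : m ≤ M) (hc : ContinuousOn F (Icc m M))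
    (hs : StrictMonoOn F (Icc m M)) : ∃ e : ℝ ≃o ℝ, ∀ x ∈ Icc m M, e x = F x := by
  set cl : ℝ → ℝ := fun x => max m (min x M) with hcl
  have hclm : ∀ x, cl x ∈ Icc m M := fun x => ⟨le_max_left _ _, max_le hmM (min_le_right _ _)⟩
  have hclc : Continuous cl := by fun_prop
  set G : ℝ → ℝ := fun x => F (cl x) + (x - cl x) with hG
  have hGc : Continuous G := by
    have : Continuous (fun x => F (cl x)) := by
      rw [← continuousOn_univ]
      exact hc.comp hclc.continuousOn (fun x _ => hclm x)
    exact this.add (continuous_id.sub hclc)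
  have hm0 : MonotoneOn F (Icc m M) := hs.monotoneOn
  have hclmono : Monotone cl := by
    intro x y hxy
    simp only [hcl]
    gcongr
  have hcl2 : ∀ x y, x ≤ y → x - cl x ≤ y - cl y := by
    intro x y hxy
    simp only [hcl]
    rcases le_total x M with h1 | h1 <;> rcases le_total y M with h2 | h2 <;>
    rcases le_total x m with h3 | h3 <;> rcases le_total y m with h4 | h4 <;>
    simp only [min_eq_left, min_eq_right, max_eq_left, max_eq_right, h1, h2, h3, h4, hmM] <;> linarith
  have hGs : StrictMono G := by
    intro x y hxy
    simp only [hG]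
    have h1 := hcl2 x y hxy.le
    rcases (hclmono hxy.le).eq_or_lt with h2 | h2
    · rw [h2] at *; linarith
    · have := hs (hclm x) (hclm y) h2
      linarith
  have hsurj : Function.Surjective G := by
    apply hGc.surjective
    · have : Tendsto (fun x : ℝ => F m + (x - M)) atTop atTop :=
        tendsto_atTop_add_const_left _ _ (tendsto_atTop_add_const_right _ _ tendsto_id)
      refine tendsto_atTop_mono (fun x => ?_) this
      have h1 := hm0 (left_mem_Icc.2 hmM) (hclm x) (hclm x).1
      have h2 := (hclm x).2
      simp only [hG]; linarith
    · have : Tendsto (fun x : ℝ => F M + (x - m)) atBot atBot :=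
        tendsto_atBot_add_const_left _ _ (tendsto_atBot_add_const_right _ _ tendsto_id)
      refine tendsto_atBot_mono (fun x => ?_) this
      have h1 := hm0 (hclm x) (right_mem_Icc.2 hmM) (hclm x).2
      have h2 := (hclm x).1
      simp only [hG]; linarith
  refine ⟨StrictMono.orderIsoOfSurjective G hGs hsurj, ?_⟩
  intro x hx
  have h1 : cl x = x := by simp [hcl, hx.1, hx.2]
  simp [hG, h1]

lemma abel (g : ℝ ≃o ℝ) (g0 : g 0 = 0) {r : ℝ} (hr : 0 < r)
    (hg : ∀ x, 0 < x → x ≤ r → x < g x) :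
    ∃ k : ℝ ≃o ℝ, k 0 = 0 ∧ ∀ x, 0 ≤ x → g x ≤ r → k (g x) = 2 * k x := by
  set L := g r - r with hL
  have hL0 : 0 < L := by have := hg r hr le_rfl; linarith
  set c : ℝ → ℝ := fun y => min (max (y - r) 0) L with hc
  have hcc : Continuous c := by fun_prop
  have hc0 : ∀ y, 0 ≤ c y := fun y => le_min (le_max_right _ _) hL0.le
  have hcL : ∀ y, c y ≤ L := fun y => min_le_right _ _
  have hcm : Monotone c := by
    intro x y hxy
    simp only [hc]
    gcongr
  have hgm : ∀ n : ℕ, StrictMono (g^[n]) := fun n => g.strictMono.iterate n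
  have hgc : ∀ n : ℕ, Continuous (g^[n]) := fun n => g.continuous.iterate n
  set F : ℝ → ℝ := fun x => ∑' n : ℕ, (1/2 : ℝ)^n * c (g^[n] x) with hF
  have hsumG : Summable fun n : ℕ => (1/2 : ℝ)^n * L :=
    (summable_geometric_of_lt_one (by norm_num) (by norm_num)).mul_right L
  have hsum : ∀ x, Summable fun n : ℕ => (1/2 : ℝ)^n * c (g^[n] x) := by
    intro x
    refine Summable.of_nonneg_of_le (fun n => ?_) (fun n => ?_) hsumG
    · have := hc0 (g^[n] x); positivity
    · have := hcL (g^[n] x); gcongr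
  have hFc : Continuous F := by
    refine continuous_tsum (u := fun n : ℕ => (1/2 : ℝ)^n * L) (fun n => ?_) hsumG ?_
    · exact continuous_const.mul (hcc.comp (hgc n))
    · intro n x
      rw [Real.norm_eq_abs, abs_of_nonneg (by have := hc0 (g^[n] x); positivity)]
      have := hcL (g^[n] x); gcongr
  have hexn : ∀ y, 0 < y → ∃ n : ℕ, r < g^[n] y := by
    intro y hy
    by_contra hcon
    push Not at hcon
    have hpos : ∀ n : ℕ, 0 < g^[n] y := by
      intro n
      have := hgm n hy
      have h0 : g^[n] 0 = 0 := Function.iterate_fixed g0 n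
      rwa [h0] at this
    have hmon : Monotone fun n : ℕ => g^[n] y := by
      apply monotone_nat_of_le_succ
      intro n
      rw [Function.iterate_succ_apply']
      exact (hg _ (hpos n) (hcon n)).le
    have hb : BddAbove (range fun n : ℕ => g^[n] y) := ⟨r, by rintro _ ⟨n, rfl⟩; exact hcon n⟩
    have ht := tendsto_atTop_ciSup hmon hb
    set l := ⨆ n : ℕ, g^[n] y
    have hl : 0 < l := lt_of_lt_of_le hy (le_ciSup hb 0)
    have h2 := (g.continuous.tendsto l).comp ht
    have h3 := ht.comp (tendsto_add_atTop_nat 1)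
    have h4 : g l = l := by
      refine tendsto_nhds_unique h2 (h3.congr fun n => ?_)
      simp only [Function.comp]
      rw [Function.iterate_succ_apply']
    have := hg l hl (ciSup_le hcon)
    linarith
  have hFs : StrictMonoOn F (Icc 0 r) := by
    intro x hx y hy hxy
    have hy0 : 0 < y := lt_of_le_of_lt hx.1 hxy
    classical
    have hex := hexn y hy0
    set n := Nat.find hex with hn
    have h1 : r < g^[n] y := Nat.find_spec hex
    have hn0 : n ≠ 0 := by
      intro h0
      rw [h0] at h1
      simp at h1
      linarith [hy.2]
    obtain ⟨m, hm⟩ := Nat.exists_eq_succ_of_ne_zero hn0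
    have h2 : g^[m] y ≤ r := not_lt.1 (Nat.find_min hex (by omega : m < Nat.find hex))
    have h3 : g^[n] y ≤ g r := by
      rw [hm, Function.iterate_succ_apply']
      exact g.monotone h2
    have h4 : c (g^[n] x) < c (g^[n] y) := by
      have h5 := hgm n hxy
      have h6 : c (g^[n] y) = g^[n] y - r := by
        simp only [hc]
        rw [max_eq_left (by linarith), min_eq_left (by linarith)]
      rw [h6]
      refine lt_of_le_of_lt (min_le_left _ _) ?_
      apply max_lt <;> linarith
    refine (hsum x).tsum_lt_tsum (i := n) (fun j => ?_) ?_ (hsum y)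
    · have := hcm ((hgm j).monotone hxy.le)
      gcongr
    · have : (0:ℝ) < (1/2)^n := by positivity
      exact mul_lt_mul_of_pos_left h4 this
  obtain ⟨k, hk⟩ := extend_iso hr.le hFc.continuousOn hFs
  refine ⟨k, ?_, ?_⟩
  · rw [hk 0 ⟨le_rfl, hr.le⟩]
    have : ∀ n : ℕ, (1/2 : ℝ)^n * c (g^[n] 0) = 0 := by
      intro n
      rw [Function.iterate_fixed g0 n]
      have : c 0 = 0 := by
        simp only [hc]
        rw [max_eq_right (by linarith), min_eq_left hL0.le]
      simp [this]
    simp only [hF, this, tsum_zero]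
  · intro x hx hxr
    have hgx : x ≤ g x := by
      rcases hx.eq_or_lt with h | h
      · rw [← h, g0]
      · by_contra hcon
        have h5 : r < x := by
          by_contra h6
          exact hcon (hg x h (not_lt.1 h6)).le
        have h6 := g.strictMono h5
        have h7 := hg r hr le_rfl
        linarith
    rw [hk x ⟨hx, hgx.trans hxr⟩, hk (g x) ⟨hx.trans hgx, hxr⟩]
    have h1 := (hsum x).tsum_eq_zero_add
    have h2 : c x = 0 := by
      simp only [hc]
      rw [max_eq_right (by linarith), min_eq_left hL0.le]
    have h3 : ∀ n : ℕ, (1/2 : ℝ)^(n+1) * c (g^[n+1] x) = (1/2) * ((1/2 : ℝ)^n * c (g^[n] (g x))) := by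
      intro n
      rw [Function.iterate_succ_apply]
      ring
    simp only [h3, tsum_mul_left] at h1
    simp only [hF]
    rw [h1]
    simp [h2]

def WA : Set (ℝ × ℝ) := {p | -2 * p.1 < p.2 ∧ p.2 < -p.1}
def WB : Set (ℝ × ℝ) := {p | p.1 < p.2}

/-- data on region A. -/
lemma glueA {εA T ε : ℝ} {a1 a2 : ℝ → ℝ → ℝ} (P : Pair εA a1 a2) (hε : 0 < ε) (hεT : ε ≤ T)
    (hT : T ≤ εA) (hT2 : a2 T 0 ≤ a1 εA 0)
    (hsm : ∀ t ∈ Icc 0 ε, ∀ v ∈ Icc 0 ε, a1 t v ≤ a1 T 0) :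
    ∃ (k u : ℝ ≃o ℝ), k 0 = 0 ∧ u 0 = 0 ∧ (∀ t ∈ Icc 0 ε, u t = a1 t 0) ∧
      (∀ t ∈ Icc 0 ε, k (a2 t 0) = 2 * k (a1 t 0)) ∧
      (∀ t ∈ Icc 0 ε, ∀ v ∈ Icc 0 ε, 0 < t → 0 < v →
        k (a1 t v) < k (a2 t v) ∧ k (a2 t v) < 2 * k (a1 t v)) ∧
      (∀ m n : ℝ, -2 * m ≤ n → n ≤ -m → u.symm (k.symm (-n/2)) ≤ ε →
        ∃ t ∈ Icc 0 ε, ∃ v ∈ Icc 0 ε, k (a2 t v) = m ∧ -2 * k (a1 t v) = n) := by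
  have hεA : 0 < εA := P.l1.hε
  have hiso : ∀ {a : ℝ → ℝ → ℝ}, Lev εA a → ∃ e : ℝ ≃o ℝ, ∀ x ∈ Icc 0 εA, e x = a x 0 := by
    intro a L
    refine extend_iso (F := fun t => a t 0) hεA.le ?_ ?_
    · exact (L.cont.comp (by fun_prop : Continuous fun t : ℝ => (t, (0:ℝ)))).continuousOn
    · intro x hx y hy hxy
      exact L.zero_mono hx.1 hxy hy.2
  obtain ⟨u, hu⟩ := hiso P.l1
  obtain ⟨u2, hu2⟩ := hiso P.l2
  have h0m : (0:ℝ) ∈ Icc 0 εA := ⟨le_rfl, hεA.le⟩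
  have u0 : u 0 = 0 := by rw [hu 0 h0m, P.l1.zero 0 le_rfl]
  have u20 : u2 0 = 0 := by rw [hu2 0 h0m, P.l2.zero 0 le_rfl]
  set g : ℝ ≃o ℝ := u.symm.trans u2 with hg
  have us0 : u.symm 0 = 0 := by rw [OrderIso.symm_apply_eq, u0]
  have g0 : g 0 = 0 := by simp [hg, us0, u20]
  have hgu : ∀ t ∈ Icc 0 εA, g (a1 t 0) = a2 t 0 := by
    intro t ht
    rw [← hu t ht, ← hu2 t ht]; simp [hg]
  have hr : 0 < a1 εA 0 := by
    have := P.l1.zero_mono le_rfl hεA le_rfl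
    rwa [P.l1.zero 0 le_rfl] at this
  have usm : ∀ x, 0 ≤ x → x ≤ a1 εA 0 → u.symm x ∈ Icc 0 εA := by
    intro x h1 h2
    constructor
    · rw [OrderIso.le_symm_apply, u0]; exact h1
    · rw [OrderIso.symm_apply_le, hu εA ⟨hεA.le, le_rfl⟩]; exact h2
  have hgx : ∀ x, 0 < x → x ≤ a1 εA 0 → x < g x := by
    intro x h1 h2
    obtain h3 := usm x h1.le h2
    have h4 : u (u.symm x) = x := u.apply_symm_apply x
    have h5 : 0 < u.symm x := by
      rw [OrderIso.lt_symm_apply, u0]; exact h1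
    have := P.lt_of_pos h5 h3.2 (le_refl 0)
    rw [← hgu _ h3, ← hu _ h3, h4] at this
    exact this
  obtain ⟨k, k0, hk⟩ := abel g g0 hr hgx
  have hT0 : 0 < T := lt_of_lt_of_le hε hεT
  have hmem : ∀ t ∈ Icc 0 ε, t ∈ Icc 0 εA := fun t ht => ⟨ht.1, by linarith [ht.2]⟩
  have hmonoz : ∀ {a : ℝ → ℝ → ℝ}, Lev εA a → ∀ t t0, 0 ≤ t → t ≤ t0 → t0 ≤ εA → a t 0 ≤ a t0 0 := by
    intro a L t t0 h1 h2 h3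
    rcases h2.eq_or_lt with h | h
    · rw [h]
    · exact (L.zero_mono h1 h h3).le
  have hkT : ∀ t, 0 ≤ t → t ≤ T → k (a2 t 0) = 2 * k (a1 t 0) := by
    intro t h1 h2
    have ht : t ∈ Icc 0 εA := ⟨h1, h2.trans hT⟩
    rw [← hgu t ht]
    apply hk _ (P.l1.nonneg ht le_rfl)
    rw [hgu t ht]
    exact (hmonoz P.l2 t T h1 h2 hT).trans hT2
  refine ⟨k, u, k0, u0, fun t ht => hu t (hmem t ht), fun t ht => hkT t ht.1 (ht.2.trans hεT), ?_, ?_⟩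
  · intro t ht v hv ht0 hv0
    refine ⟨k.strictMono (P.lt_of_pos ht0 (hmem t ht).2 hv.1), ?_⟩
    have h1 := hsm t ht v hv
    have h1' : a1 t v ≤ a1 εA 0 := h1.trans (hmonoz P.l1 T εA hT0.le hT le_rfl)
    set x := u.symm (a1 t v) with hx
    have hxm := usm _ (P.l1.nonneg (hmem t ht) hv.1) h1'
    have hux : a1 x 0 = a1 t v := by rw [← hu x hxm, hx, u.apply_symm_apply]
    have hxT : x ≤ T := by rw [hx, OrderIso.symm_apply_le, hu T ⟨hT0.le, hT⟩]; exact h1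
    have htx : t < x := by
      rw [hx, OrderIso.lt_symm_apply, hu t (hmem t ht)]
      exact P.l1.strict (hmem t ht) le_rfl hv0
    have h2 := P.key t x v 0 ht.1 htx hxm.2 hv.1 le_rfl hux.symm
    have h3 := k.strictMono h2
    rw [hkT x hxm.1 hxT, hux] at h3
    exact h3
  · intro m n h1 h2 h3
    set a0 := k.symm (-n/2) with ha0
    set b0 := k.symm m with hb0
    have hka : k a0 = -n/2 := k.apply_symm_apply _
    have hkb : k b0 = m := k.apply_symm_apply _
    have ha0n : 0 ≤ a0 := by rw [ha0, OrderIso.le_symm_apply, k0]; linarith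
    set x := u.symm a0 with hx
    have hx0 : 0 ≤ x := by rw [hx, OrderIso.le_symm_apply, u0]; exact ha0n
    have hxm : x ∈ Icc 0 ε := ⟨hx0, h3⟩
    have hux : a1 x 0 = a0 := by rw [← hu x (hmem x hxm), hx, u.apply_symm_apply]
    obtain ⟨V, V1, V2, V3⟩ := P.l1.path (hmem x hxm) (le_refl 0)
    have hc : ContinuousOn (fun t => a2 t (V t)) (Icc 0 x) :=
      P.l2.cont.comp_continuousOn (f := fun τ => (τ, V τ)) (continuousOn_id.prodMk V1)
    have hV0 : V 0 = a0 := by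
      have := V3 0 ⟨le_rfl, hx0⟩
      rw [P.l1.zero _ this.1, hux] at this
      exact this.2.1
    have e1 : a2 0 (V 0) ≤ b0 := by
      rw [hV0, P.l2.zero _ ha0n, ← k.le_iff_le, hka, hkb]; linarith
    have e2 : b0 ≤ a2 x (V x) := by
      rw [V2, ← k.le_iff_le, hkT x hx0 (h3.trans hεT), hux, hka, hkb]; linarith
    obtain ⟨t, ht, hte⟩ := intermediate_value_Icc hx0 hc ⟨e1, e2⟩
    obtain ⟨g1, g2, g3, -⟩ := V3 t ht
    refine ⟨t, ⟨ht.1, ht.2.trans h3⟩, V t, ⟨g1, ?_⟩, ?_, ?_⟩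
    · have := (abs_le.1 g3).2
      linarith [ht.1, ht.2]
    · simp only at hte
      rw [hte, hkb]
    · rw [g2, hux, hka]; ring

/-- data on region B. -/
lemma glueB {ε : ℝ} {a1 a2 : ℝ → ℝ → ℝ} (P : Pair ε a1 a2) :
    ∃ (ka kb : ℝ ≃o ℝ), ka 0 < kb 0 ∧
      (∀ x ∈ Icc (-ε) 0, ka x = a1 (ε + x) 0 ∧ kb x = a2 (ε + x) 0) ∧
      (∀ v ∈ Icc 0 ε, ka v = a1 ε v ∧ kb v = a2 ε v) ∧
      (∀ t ∈ Icc 0 ε, ∀ v ∈ Icc 0 ε, t < ε → 0 < v →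
        ka (kb.symm (a2 t v)) < a1 t v) ∧
      (∀ l2 l1 : ℝ, l2 ≤ l1 → -ε ≤ l1 → l1 ≤ ε/2 → ka l1 ≤ kb l2 →
        ∃ t ∈ Icc 0 ε, ∃ v ∈ Icc 0 ε, a2 t v = kb l2 ∧ a1 t v = ka l1) := by
  have hε : 0 < ε := P.l1.hε
  have hiso : ∀ {a : ℝ → ℝ → ℝ}, Lev ε a → ∃ e : ℝ ≃o ℝ,
      ∀ x ∈ Icc (-ε) (2*ε), e x = a (ε + min x 0) (max x 0) := by
    intro a L
    refine extend_iso (F := fun x => a (ε + min x 0) (max x 0)) (by linarith) ?_ ?_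
    · exact (L.cont.comp (by fun_prop : Continuous fun x : ℝ => (ε + min x 0, max x 0))).continuousOn
    · intro x hx y hy hxy
      have hneg : ∀ x y, -ε ≤ x → x < y → y ≤ 0 → a (ε + min x 0) (max x 0) < a (ε + min y 0) (max y 0) := by
        intro x y h1 h2 h3
        rw [min_eq_left h3, max_eq_right h3, min_eq_left (by linarith), max_eq_right (by linarith)]
        exact L.zero_mono (by linarith) (by linarith) (by linarith)
      have hpos : ∀ x y, 0 ≤ x → x < y → a (ε + min x 0) (max x 0) < a (ε + min y 0) (max y 0) := by
        intro x y h1 h2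
        rw [min_eq_right h1, max_eq_left h1, min_eq_right (by linarith), max_eq_left (by linarith)]
        exact L.strict ⟨by linarith, by linarith⟩ h1 h2
      rcases le_or_gt y 0 with h | h
      · exact hneg x y hx.1 hxy h
      · rcases le_or_gt 0 x with h' | h'
        · exact hpos x y h' hxy
        · exact (hneg x 0 hx.1 h' le_rfl).trans (hpos 0 y le_rfl h)
  obtain ⟨ka, hka⟩ := hiso P.l1
  obtain ⟨kb, hkb⟩ := hiso P.l2
  refine ⟨ka, kb, ?_, ?_, ?_, ?_, ?_⟩
  · rw [hka 0 ⟨by linarith, by linarith⟩, hkb 0 ⟨by linarith, by linarith⟩]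
    simp only [min_self, max_self, add_zero]
    exact P.lt_of_pos hε le_rfl le_rfl
  · intro x hx
    rw [hka x ⟨hx.1, by linarith [hx.2]⟩, hkb x ⟨hx.1, by linarith [hx.2]⟩, min_eq_left hx.2, max_eq_right hx.2]
    exact ⟨rfl, rfl⟩
  · intro x hx
    rw [hka x ⟨by linarith [hx.1], by linarith [hx.2]⟩, hkb x ⟨by linarith [hx.1], by linarith [hx.2]⟩,
      min_eq_right hx.1, max_eq_left hx.1]
    simp
  · intro t ht v hv hte hv0
    set l1 := ka.symm (a1 t v) with hl1
    have hk1 : ka l1 = a1 t v := ka.apply_symm_apply _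
    have h1 : -ε ≤ l1 := by
      rw [hl1, OrderIso.le_symm_apply, hka (-ε) ⟨le_rfl, by linarith⟩, min_eq_left (by linarith),
        max_eq_right (by linarith)]
      simp only [add_neg_cancel]
      rw [P.l1.zero 0 le_rfl]
      exact P.l1.nonneg ht hv.1
    have h2 : l1 ≤ 2 * ε := by
      rw [hl1, OrderIso.symm_apply_le, hka (2*ε) ⟨by linarith, le_rfl⟩, min_eq_right (by linarith),
        max_eq_left (by linarith)]
      obtain ⟨u, g1, g2, g3, -⟩ := P.l1.level t ε (2*ε) ht.1 ht.2 le_rfl (by linarith)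
      rw [add_zero, ← g2, P.l1.le_iff ht hv.1 g1]
      have := (abs_le.1 g3).1
      linarith [hv.2, ht.1]
    have hm : l1 ∈ Icc (-ε) (2*ε) := ⟨h1, h2⟩
    have h3 : a1 (ε + min l1 0) (max l1 0) = a1 t v := by rw [← hka l1 hm, hk1]
    have h4 : t < ε + min l1 0 := by
      rcases le_or_gt 0 l1 with h | h
      · rw [min_eq_right h]; linarith
      · rw [min_eq_left h.le] at h3 ⊢
        rw [max_eq_right h.le] at h3
        by_contra hcon
        push Not at hcon
        have g1 : a1 (ε + l1) 0 ≤ a1 t 0 := by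
          rcases hcon.eq_or_lt with h5 | h5
          · rw [h5]
          · exact (P.l1.zero_mono (by linarith) h5 ht.2).le
        have g2 := P.l1.strict ht le_rfl hv0
        linarith
    have h5 := P.key t _ v _ ht.1 h4 (by linarith [min_le_right l1 0]) hv.1 (le_max_right l1 0) h3.symm
    rw [← hkb l1 hm] at h5
    rw [← hk1]
    apply ka.strictMono
    rw [OrderIso.symm_apply_lt]
    exact h5
  · intro l2 l1 h21 h1 h1' hle
    have hm : l1 ∈ Icc (-ε) (2*ε) := ⟨h1, by linarith⟩
    set t1 := ε + min l1 0 with ht1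
    have ht1m : t1 ∈ Icc 0 ε := ⟨by have := le_min h1 (by linarith : -ε ≤ 0); linarith, by linarith [min_le_right l1 0]⟩
    obtain ⟨V, V1, V2, V3⟩ := P.l1.path ht1m (le_max_right l1 0)
    have hc : ContinuousOn (fun t => a2 t (V t)) (Icc 0 t1) :=
      P.l2.cont.comp_continuousOn (f := fun τ => (τ, V τ)) (continuousOn_id.prodMk V1)
    have e1 : a2 0 (V 0) ≤ kb l2 := by
      have := V3 0 ⟨le_rfl, ht1m.1⟩
      rw [P.l1.zero _ this.1] at this
      rw [P.l2.zero _ this.1, this.2.1, ← hka l1 hm]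
      exact hle
    have e2 : kb l2 ≤ a2 t1 (V t1) := by
      rw [V2, ← hkb l1 hm]
      exact kb.monotone h21
    obtain ⟨t, ht, hte⟩ := intermediate_value_Icc ht1m.1 hc ⟨e1, e2⟩
    obtain ⟨g1, g2, g3, -⟩ := V3 t ht
    refine ⟨t, ⟨ht.1, ht.2.trans ht1m.2⟩, V t, ⟨g1, ?_⟩, hte, ?_⟩
    · have := (abs_le.1 g3).2
      have h5 : max l1 0 ≤ ε/2 := max_le h1' (by linarith)
      linarith [ht.1, ht.2, ht1m.2]
    · rw [g2, ← hka l1 hm]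

def QQ (ε : ℝ) : Set (ℝ × ℝ) := Icc (-ε) ε ×ˢ Icc (-ε) ε

lemma glue {εA T ε : ℝ} {a1 a2 b1 b2 : ℝ → ℝ → ℝ} (P : Pair εA a1 a2) (PB : Pair ε b1 b2) (hεT : ε ≤ T)
    (hT : T ≤ εA) (hT2 : a2 T 0 ≤ a1 εA 0)
    (hsm : ∀ t ∈ Icc 0 ε, ∀ v ∈ Icc 0 ε, a1 t v ≤ a1 T 0) :
    ∃ (H : ℝ × ℝ → ℝ × ℝ) (k θ : ℝ ≃o ℝ) (o : ℝ), Continuous H ∧ InjOn H (QQ ε) ∧ H 0 = 0 ∧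
      H '' (QQ ε) ∈ nhds 0 ∧
      (∀ p ∈ QQ ε, 0 < p.1 → p.2 < 0 →
        H p = (k (a2 p.1 (-p.2)), -2 * k (a1 p.1 (-p.2))) ∧ H p ∈ WA) ∧
      (∀ p ∈ QQ ε, p.1 < 0 → 0 < p.2 →
        H p = (θ (b2 (ε + p.1) p.2) - o, b1 (ε + p.1) p.2 - o) ∧ H p ∈ WB) ∧
      (∀ p ∈ QQ ε, H p ∈ WA → 0 < p.1 ∧ p.2 < 0) ∧
      (∀ p ∈ QQ ε, H p ∈ WB → p.1 < 0 ∧ 0 < p.2) := by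
  have hε : 0 < ε := PB.l1.hε
  obtain ⟨k, u, k0, u0, hu, hk1, hk2, hk3⟩ := glueA P hε hεT hT hT2 hsm
  obtain ⟨ka, kb, hab, hx, hv, hB, hBs⟩ := glueB PB
  set o := ka 0 with ho
  set θ : ℝ ≃o ℝ := kb.symm.trans ka with hθ
  set M : ℝ × ℝ → ℝ := fun p => k (a2 (max p.1 0) (max (-p.2) 0)) with hM
  set N : ℝ × ℝ → ℝ := fun p => -2 * k (a1 (max p.1 0) (max (-p.2) 0)) with hN
  set M' : ℝ × ℝ → ℝ := fun p => θ (b2 (ε + min p.1 0) (max p.2 0)) - o with hM'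
  set N' : ℝ × ℝ → ℝ := fun p => b1 (ε + min p.1 0) (max p.2 0) - o with hN'
  have θv : ∀ l, θ (kb l) = ka l := by intro l; simp [hθ]
  -- facts A
  have fA1 : ∀ p ∈ QQ ε, 0 < p.1 → p.2 < 0 → -2 * M p < N p ∧ N p < - M p := by
    rintro ⟨x, q⟩ hp h1 h2
    simp only [QQ, mem_prod, mem_Icc] at hp h1 h2
    simp only [hM, hN]
    rw [max_eq_left h1.le, max_eq_left (by linarith)]
    have := hk2 x ⟨h1.le, hp.1.2⟩ (-q) ⟨by linarith, by linarith⟩ h1 (by linarith)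
    constructor <;> linarith
  have fA2 : ∀ p ∈ QQ ε, 0 < p.1 → 0 ≤ p.2 → N p = - M p ∧ 0 < M p := by
    rintro ⟨x, q⟩ hp h1 h2
    simp only [QQ, mem_prod, mem_Icc] at hp h1 h2
    simp only [hM, hN]
    rw [max_eq_left h1.le, max_eq_right (by linarith), hk1 x ⟨h1.le, hp.1.2⟩]
    have h3 := P.l1.zero_mono le_rfl h1 (by linarith)
    rw [P.l1.zero 0 le_rfl] at h3
    have h4 := k.strictMono h3
    rw [k0] at h4
    constructor <;> linarith
  have fA3 : ∀ p ∈ QQ ε, p.1 ≤ 0 → p.2 < 0 → N p = -2 * M p ∧ 0 < M p := by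
    rintro ⟨x, q⟩ hp h1 h2
    simp only [QQ, mem_prod, mem_Icc] at hp h1 h2
    simp only [hM, hN]
    rw [max_eq_right h1, max_eq_left (by linarith), P.l1.zero _ (by linarith), P.l2.zero _ (by linarith)]
    have h4 := k.strictMono (by linarith : 0 < -q)
    rw [k0] at h4
    exact ⟨rfl, h4⟩
  have fA4 : ∀ p ∈ QQ ε, p.1 ≤ 0 → 0 ≤ p.2 → N p = 0 ∧ M p = 0 := by
    rintro ⟨x, q⟩ hp h1 h2
    simp only [QQ, mem_prod, mem_Icc] at hp h1 h2
    simp only [hM, hN]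
    rw [max_eq_right h1, max_eq_right (by linarith), P.l1.zero _ le_rfl, P.l2.zero _ le_rfl, k0]
    simp
  -- facts B
  have fB1 : ∀ p ∈ QQ ε, p.1 < 0 → 0 < p.2 → M' p < N' p := by
    rintro ⟨x, q⟩ hp h1 h2
    simp only [QQ, mem_prod, mem_Icc] at hp h1 h2
    simp only [hM', hN']
    rw [min_eq_left h1.le, max_eq_left h2.le]
    have := hB (ε + x) ⟨by linarith, by linarith⟩ q ⟨h2.le, by linarith⟩ (by linarith) h2
    simp only [hθ, OrderIso.trans_apply]
    linarith
  have fB2 : ∀ p ∈ QQ ε, 0 ≤ p.1 → 0 ≤ p.2 → M' p = ka p.2 - o ∧ N' p = ka p.2 - o := by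
    rintro ⟨x, q⟩ hp h1 h2
    simp only [QQ, mem_prod, mem_Icc] at hp h1 h2
    simp only [hM', hN']
    have := hv q ⟨h2, hp.2.2⟩
    rw [min_eq_right h1, max_eq_left h2, add_zero, ← this.1, ← this.2, θv]
    exact ⟨rfl, rfl⟩
  have fB3 : ∀ p ∈ QQ ε, p.1 ≤ 0 → p.2 ≤ 0 → M' p = ka p.1 - o ∧ N' p = ka p.1 - o := by
    rintro ⟨x, q⟩ hp h1 h2
    simp only [QQ, mem_prod, mem_Icc] at hp h1 h2
    simp only [hM', hN']
    have := hx x ⟨hp.1.1, h1⟩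
    rw [min_eq_left h1, max_eq_right h2, ← this.1, ← this.2, θv]
    exact ⟨rfl, rfl⟩
  have fB4 : ∀ p ∈ QQ ε, 0 ≤ p.1 → p.2 ≤ 0 → M' p = 0 ∧ N' p = 0 := by
    rintro ⟨x, q⟩ hp h1 h2
    simp only [QQ, mem_prod, mem_Icc] at hp h1 h2
    simp only [hM', hN']
    have := hx 0 ⟨by linarith, le_rfl⟩
    rw [min_eq_right h1, max_eq_right h2, ← this.1, ← this.2, θv]
    simp [ho]
  have fB2' : ∀ p ∈ QQ ε, 0 ≤ p.1 → 0 < p.2 → M' p = N' p ∧ 0 < M' p := by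
    intro p hp h1 h2
    obtain ⟨e1, e2⟩ := fB2 p hp h1 h2.le
    have := ka.strictMono h2
    exact ⟨by rw [e1, e2], by rw [e1]; linarith⟩
  have fB3' : ∀ p ∈ QQ ε, p.1 < 0 → p.2 ≤ 0 → M' p = N' p ∧ M' p < 0 := by
    intro p hp h1 h2
    obtain ⟨e1, e2⟩ := fB3 p hp h1.le h2
    have := ka.strictMono h1
    exact ⟨by rw [e1, e2], by rw [e1]; linarith⟩
  have cell : ∀ p ∈ QQ ε,
      (0 < p.1 ∧ p.2 < 0 ∧ (-2 * M p < N p ∧ N p < - M p) ∧ M' p = 0 ∧ N' p = 0) ∨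
      (0 < p.1 ∧ 0 = p.2 ∧ (N p = - M p ∧ 0 < M p) ∧ M' p = 0 ∧ N' p = 0) ∨
      (0 < p.1 ∧ 0 < p.2 ∧ (N p = - M p ∧ 0 < M p) ∧ M' p = N' p ∧ 0 < M' p) ∨
      (0 = p.1 ∧ 0 < p.2 ∧ (N p = 0 ∧ M p = 0) ∧ M' p = N' p ∧ 0 < M' p) ∨
      (p.1 < 0 ∧ 0 < p.2 ∧ (N p = 0 ∧ M p = 0) ∧ M' p < N' p ∧ M' p < N' p) ∨
      (p.1 < 0 ∧ 0 = p.2 ∧ (N p = 0 ∧ M p = 0) ∧ M' p = N' p ∧ M' p < 0) ∨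
      (p.1 < 0 ∧ p.2 < 0 ∧ (N p = -2 * M p ∧ 0 < M p) ∧ M' p = N' p ∧ M' p < 0) ∨
      (0 = p.1 ∧ p.2 < 0 ∧ (N p = -2 * M p ∧ 0 < M p) ∧ M' p = 0 ∧ N' p = 0) ∨
      (0 = p.1 ∧ 0 = p.2 ∧ (N p = 0 ∧ M p = 0) ∧ M' p = 0 ∧ N' p = 0) := by
    intro p hp
    rcases lt_trichotomy 0 p.1 with h1 | h1 | h1 <;> rcases lt_trichotomy 0 p.2 with h2 | h2 | h2
    · exact .inr (.inr (.inl ⟨h1, h2, fA2 p hp h1 h2.le, fB2' p hp h1.le h2⟩))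
    · exact .inr (.inl ⟨h1, h2, fA2 p hp h1 h2.le, fB4 p hp h1.le h2.ge⟩)
    · exact .inl ⟨h1, h2, fA1 p hp h1 h2, fB4 p hp h1.le h2.le⟩
    · exact .inr (.inr (.inr (.inl ⟨h1, h2, fA4 p hp h1.ge h2.le, fB2' p hp h1.le h2⟩)))
    · exact .inr (.inr (.inr (.inr (.inr (.inr (.inr (.inr ⟨h1, h2, fA4 p hp h1.ge h2.le, fB4 p hp h1.le h2.ge⟩)))))))
    · exact .inr (.inr (.inr (.inr (.inr (.inr (.inr (.inl ⟨h1, h2, fA3 p hp h1.ge h2, fB4 p hp h1.le h2.le⟩)))))))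
    · exact .inr (.inr (.inr (.inr (.inl ⟨h1, h2, fA4 p hp h1.le h2.le, fB1 p hp h1 h2, fB1 p hp h1 h2⟩))))
    · exact .inr (.inr (.inr (.inr (.inr (.inl ⟨h1, h2, fA4 p hp h1.le h2.le, fB3' p hp h1 h2.ge⟩)))))
    · exact .inr (.inr (.inr (.inr (.inr (.inr (.inl ⟨h1, h2, fA3 p hp h1.le h2, fB3' p hp h1 h2.le⟩))))))
  have hka_c := ka.continuous
  have hkas_c := ka.symm.continuous
  have hkb_c := kb.continuous
  have hk_c := k.continuous
  have hks_c := k.symm.continuous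
  have hus_c := u.symm.continuous
  have hθ_c := θ.continuous
  have h0Q : (0 : ℝ × ℝ) ∈ QQ ε := by
    refine ⟨⟨?_, ?_⟩, ⟨?_, ?_⟩⟩ <;> simp [hε.le]
  refine ⟨fun p => (M p + M' p, N p + N' p), k, θ, o, ?_, ?_, ?_, ?_, ?_, ?_, ?_, ?_⟩
  · have c1 : Continuous M := hk_c.comp (P.l2.cont.comp (by fun_prop : Continuous fun p : ℝ × ℝ => (max p.1 0, max (-p.2) 0)))
    have c2 : Continuous N := continuous_const.mul (hk_c.comp (P.l1.cont.comp (by fun_prop : Continuous fun p : ℝ × ℝ => (max p.1 0, max (-p.2) 0))))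
    have c3 : Continuous M' := (hθ_c.comp (PB.l2.cont.comp (by fun_prop : Continuous fun p : ℝ × ℝ => (ε + min p.1 0, max p.2 0)))).sub continuous_const
    have c4 : Continuous N' := (PB.l1.cont.comp (by fun_prop : Continuous fun p : ℝ × ℝ => (ε + min p.1 0, max p.2 0))).sub continuous_const
    exact (c1.add c3).prodMk (c2.add c4)
  · intro p hp p' hp' he
    simp only [Prod.mk.injEq] at he
    obtain ⟨he1, he2⟩ := he
    have hcl : M p = M p' ∧ N p = N p' ∧ M' p = M' p' ∧ N' p = N' p' := by
      have c1 := cell p hp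
      have c2 := cell p' hp'
      generalize M p = m1 at *
      generalize M p' = m2 at *
      generalize N p = n1 at *
      generalize N p' = n2 at *
      generalize M' p = m1' at *
      generalize M' p' = m2' at *
      generalize N' p = n1' at *
      generalize N' p' = n2' at *
      clear * - c1 c2 he1 he2
      rcases c1 with ⟨-, -, ⟨i1, i2⟩, i3, i4⟩ | ⟨-, -, ⟨i1, i2⟩, i3, i4⟩ | ⟨-, -, ⟨i1, i2⟩, i3, i4⟩ |
        ⟨-, -, ⟨i1, i2⟩, i3, i4⟩ | ⟨-, -, ⟨i1, i2⟩, i3, i4⟩ | ⟨-, -, ⟨i1, i2⟩, i3, i4⟩ |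
        ⟨-, -, ⟨i1, i2⟩, i3, i4⟩ | ⟨-, -, ⟨i1, i2⟩, i3, i4⟩ | ⟨-, -, ⟨i1, i2⟩, i3, i4⟩ <;>
      rcases c2 with ⟨-, -, ⟨j1, j2⟩, j3, j4⟩ | ⟨-, -, ⟨j1, j2⟩, j3, j4⟩ | ⟨-, -, ⟨j1, j2⟩, j3, j4⟩ |
        ⟨-, -, ⟨j1, j2⟩, j3, j4⟩ | ⟨-, -, ⟨j1, j2⟩, j3, j4⟩ | ⟨-, -, ⟨j1, j2⟩, j3, j4⟩ |
        ⟨-, -, ⟨j1, j2⟩, j3, j4⟩ | ⟨-, -, ⟨j1, j2⟩, j3, j4⟩ | ⟨-, -, ⟨j1, j2⟩, j3, j4⟩ <;>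
      first
      | (exfalso; linarith)
      | (refine ⟨?_, ?_, ?_, ?_⟩ <;> linarith)
    obtain ⟨g1, g2, g3, g4⟩ := hcl
    simp only [hM, hN, hM', hN'] at g1 g2 g3 g4
    have g1' := k.injective g1
    have g2' := k.injective (by linarith : k (a1 (max p.1 0) (max (-p.2) 0)) = k (a1 (max p'.1 0) (max (-p'.2) 0)))
    have g3' := θ.injective (by linarith : θ (b2 (ε + min p.1 0) (max p.2 0)) = θ (b2 (ε + min p'.1 0) (max p'.2 0)))
    have g4' : b1 (ε + min p.1 0) (max p.2 0) = b1 (ε + min p'.1 0) (max p'.2 0) := by linarith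
    have mA : ∀ p ∈ QQ ε, max p.1 0 ∈ Icc 0 εA := fun p hp => ⟨le_max_right _ _, max_le (hp.1.2.trans (hεT.trans hT)) P.l1.hε.le⟩
    have mB : ∀ p ∈ QQ ε, ε + min p.1 0 ∈ Icc 0 ε := fun p hp => ⟨by
      have := le_min hp.1.1 (by linarith : -ε ≤ 0); linarith, by linarith [min_le_right p.1 0]⟩
    obtain ⟨q1, q2⟩ := P.inj (mA p hp) (mA p' hp') (le_max_right _ _) (le_max_right _ _) g2' g1'
    obtain ⟨q3, q4⟩ := PB.inj (mB p hp) (mB p' hp') (le_max_right _ _) (le_max_right _ _) g4' g3'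
    have r1 := max_add_min p.1 0
    have r2 := max_add_min p'.1 0
    have r3 := max_add_min p.2 0
    have r4 := max_add_min p'.2 0
    have r5 : max (-p.2) 0 = - min p.2 0 := by rw [← neg_zero, max_neg_neg]; simp
    have r6 : max (-p'.2) 0 = - min p'.2 0 := by rw [← neg_zero, max_neg_neg]; simp
    ext <;> linarith
  · have h1 := fA4 0 h0Q le_rfl le_rfl
    have h2 := fB4 0 h0Q le_rfl le_rfl
    simp [h1, h2]
  · have hR : ∀ {F G : ℝ → ℝ}, Continuous F → Continuous G → F 0 < G 0 → ∀ᶠ p : ℝ × ℝ in nhds 0, F (|p.1| + |p.2|) < G (|p.1| + |p.2|) := by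
      intro F G hF hG hFG
      have c0 : Continuous (fun p : ℝ × ℝ => |p.1| + |p.2|) := by fun_prop
      refine (hF.comp c0).continuousAt.eventually_lt (hG.comp c0).continuousAt ?_
      simpa using hFG
    have us0 : u.symm 0 = 0 := by rw [OrderIso.symm_apply_eq, u0]
    have ks0 : k.symm 0 = 0 := by rw [OrderIso.symm_apply_eq, k0]
    have kas0 : ka.symm o = 0 := by rw [OrderIso.symm_apply_eq]
    have E1 := hR (F := fun R => u.symm (k.symm R)) (G := fun _ => ε) (hus_c.comp hks_c) continuous_const (by simp only [us0, ks0]; exact hε)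
    have E2 := hR (F := fun R => ka.symm (o + R)) (G := fun _ => ε/2) (hkas_c.comp (by fun_prop)) continuous_const (by simp only [add_zero, kas0]; linarith)
    have E3 := hR (F := fun _ => -ε) (G := fun R => ka.symm (o - R)) continuous_const (hkas_c.comp (by fun_prop)) (by simp only [sub_zero, kas0]; linarith)
    have E4 := hR (F := fun R => k.symm R) (G := fun _ => ε) hks_c continuous_const (by simp only [ks0]; linarith)
    have E5 := hR (F := fun R => o + R) (G := fun R => kb (ka.symm (o - R))) (by fun_prop) (hkb_c.comp (hkas_c.comp (by fun_prop))) (by simp only [sub_zero, add_zero, kas0]; exact hab)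
    filter_upwards [E1, E2, E3, E4, E5] with ⟨m, n⟩ e1 e2 e3 e4 e5
    simp only at e1 e2 e3 e4 e5
    set R := |m| + |n| with hRR
    have m1 := le_abs_self m
    have m2 := neg_abs_le m
    have n1 := le_abs_self n
    have n2 := neg_abs_le n
    have m3 := abs_nonneg m
    have n3 := abs_nonneg n
    rcases le_total m n with hmn | hmn
    · -- B
      set l1 := ka.symm (o + n) with hl1
      set l2 := ka.symm (o + m) with hl2
      have k1 : ka l1 = o + n := ka.apply_symm_apply _
      have k2 : ka l2 = o + m := ka.apply_symm_apply _
      have s1 : l2 ≤ l1 := ka.symm.monotone (by linarith)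
      have s2 : -ε ≤ l1 := e3.le.trans (ka.symm.monotone (by linarith))
      have s3 : l1 ≤ ε/2 := (ka.symm.monotone (by linarith)).trans e2.le
      have s4 : ka l1 ≤ kb l2 := by
        rw [k1]
        have := kb.monotone (ka.symm.monotone (by linarith : o - R ≤ o + m))
        linarith
      obtain ⟨t, ht, v, hv', r1, r2⟩ := hBs l2 l1 s1 s2 s3 s4
      have hp : (t - ε, v) ∈ QQ ε := ⟨⟨by linarith [ht.1], by linarith [ht.2]⟩, ⟨by linarith [hv'.1], hv'.2⟩⟩
      have hA := fA4 _ hp (by simpa using ht.2) hv'.1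
      refine ⟨(t - ε, v), hp, ?_⟩
      simp only [hA, zero_add]
      simp only [hM', hN']
      rw [min_eq_left (by linarith [ht.2]), max_eq_left hv'.1, add_sub_cancel, r1, r2, θv, k1, k2]
      simp
    · rcases le_total (-m) n with hmn2 | hmn2
      · -- C1
        set q := ka.symm (o + (m + n)/2) with hq
        set x := u.symm (k.symm ((m - n)/4)) with hxx
        have q1 : ka q = o + (m+n)/2 := ka.apply_symm_apply _
        have q0 : 0 ≤ q := by rw [hq, OrderIso.le_symm_apply]; linarith
        have q2 : q ≤ ε := by
          have : q ≤ ka.symm (o + R) := ka.symm.monotone (by linarith)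
          linarith
        have x0 : 0 ≤ x := by rw [hxx, OrderIso.le_symm_apply, u0, OrderIso.le_symm_apply, k0]; linarith
        have x2 : x ≤ ε := le_trans (u.symm.monotone (k.symm.monotone (by linarith))) e1.le
        have x1 : k (u x) = (m-n)/4 := by rw [hxx, u.apply_symm_apply, k.apply_symm_apply]
        have hp : (x, q) ∈ QQ ε := ⟨⟨by linarith, x2⟩, ⟨by linarith, q2⟩⟩
        have hB' := fB2 _ hp x0 q0
        refine ⟨(x, q), hp, ?_⟩
        simp only [hB']
        simp only [hM, hN]
        rw [max_eq_left x0, max_eq_right (by linarith), hk1 x ⟨x0, x2⟩, ← hu x ⟨x0, x2⟩, x1, q1]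
        ext <;> simp only <;> linarith
      · rcases le_total n (-2 * m) with hmn3 | hmn3
        · -- C2
          set x := ka.symm (o + (2 * m + n)/3) with hxx
          set q := k.symm ((m - n)/3) with hq
          have x1 : ka x = o + (2*m+n)/3 := ka.apply_symm_apply _
          have q1 : k q = (m-n)/3 := k.apply_symm_apply _
          have x0 : x ≤ 0 := by rw [hxx, OrderIso.symm_apply_le]; linarith
          have x2 : -ε ≤ x := e3.le.trans (ka.symm.monotone (by linarith))
          have q0 : 0 ≤ q := by rw [hq, OrderIso.le_symm_apply, k0]; linarith
          have q2 : q ≤ ε := le_trans (k.symm.monotone (by linarith)) e4.le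
          have hp : (x, -q) ∈ QQ ε := ⟨⟨x2, by linarith⟩, ⟨by linarith, by linarith⟩⟩
          have hB' := fB3 _ hp x0 (by linarith : -q ≤ 0)
          refine ⟨(x, -q), hp, ?_⟩
          simp only [hB']
          simp only [hM, hN]
          rw [max_eq_right x0, max_eq_left (by linarith), neg_neg, P.l1.zero q q0, P.l2.zero q q0, q1, x1]
          ext <;> simp only <;> linarith
        · -- A
          obtain ⟨t, ht, v, hv', r1, r2⟩ := hk3 m n hmn3 (by linarith) (le_trans (u.symm.monotone (k.symm.monotone (by linarith))) e1.le)
          have hp : (t, -v) ∈ QQ ε := ⟨⟨by linarith [ht.1], ht.2⟩, ⟨by linarith [hv'.2], by linarith [hv'.1]⟩⟩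
          have hB' := fB4 _ hp ht.1 (by linarith [hv'.1] : -v ≤ 0)
          refine ⟨(t, -v), hp, ?_⟩
          simp only [hB', add_zero]
          simp only [hM, hN]
          rw [max_eq_left ht.1, max_eq_left (by linarith [hv'.1]), neg_neg, r1, r2]
  · intro p hp h1 h2
    have hB' := fB4 p hp h1.le h2.le
    have hA := fA1 p hp h1 h2
    simp only [hB', add_zero, WA, mem_ofPred_eq]
    refine ⟨?_, hA⟩
    simp only [hM, hN]
    rw [max_eq_left h1.le, max_eq_left (by linarith)]
  · intro p hp h1 h2
    have hA := fA4 p hp h1.le h2.le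
    have hB' := fB1 p hp h1 h2
    simp only [hA, zero_add, WB, mem_ofPred_eq]
    refine ⟨?_, hB'⟩
    simp only [hM', hN']
    rw [min_eq_left h1.le, max_eq_left h2.le]
  · intro p hp h
    simp only [WA, mem_ofPred_eq] at h
    rcases cell p hp with c | c | c | c | c | c | c | c | c <;>
    first
    | exact ⟨c.1, c.2.1⟩
    | (exfalso; obtain ⟨-, -, ⟨i1, i2⟩, i3, i4⟩ := c; linarith)
  · intro p hp h
    simp only [WB, mem_ofPred_eq] at h
    rcases cell p hp with c | c | c | c | c | c | c | c | c <;>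
    first
    | exact ⟨c.1, c.2.1⟩
    | (exfalso; obtain ⟨-, -, ⟨i1, i2⟩, i3, i4⟩ := c; linarith)

structure CoreG (G : ℝ → ℝ → ℝ → ℝ) (l κ e η r : ℝ) : Prop where
  hl : 0 < l
  he : 0 < e
  hη : 0 < η
  hηl : η ≤ l / 4
  hηe : η ≤ e / 4
  hr : 0 < r
  zero : G 0 0 0 = 0
  est : ∀ x q ρ x' q' ρ', |x| ≤ r → |q| ≤ r → |ρ| ≤ r → |x'| ≤ r → |q'| ≤ r → |ρ'| ≤ r →
    |G x q ρ - G x' q' ρ' - (l * (x - x') + κ * (q - q') + e * (ρ - ρ'))| ≤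
      η * (|x - x'| + |q - q'| + |ρ - ρ'|)

def Box (r : ℝ) : Set (ℝ × ℝ × ℝ) := {p | |p.1| ≤ r ∧ |p.2.1| ≤ r ∧ |p.2.2| ≤ r}

lemma CoreG.contOn {G : ℝ → ℝ → ℝ → ℝ} {l κ e η r : ℝ} (h : CoreG G l κ e η r) :
    ContinuousOn (fun p : ℝ × ℝ × ℝ => G p.1 p.2.1 p.2.2) (Box r) := by
  intro p0 hp0
  obtain ⟨x', q', ρ'⟩ := p0
  have key : ∀ p ∈ Box r, |G p.1 p.2.1 p.2.2 - G x' q' ρ'| ≤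
      (|l * (p.1 - x') + κ * (p.2.1 - q') + e * (p.2.2 - ρ')| + η * (|p.1 - x'| + |p.2.1 - q'| + |p.2.2 - ρ'|)) := by
    intro p hp
    have := h.est p.1 p.2.1 p.2.2 x' q' ρ' hp.1 hp.2.1 hp.2.2 hp0.1 hp0.2.1 hp0.2.2
    have h2 := abs_add_le (G p.1 p.2.1 p.2.2 - G x' q' ρ' - (l * (p.1 - x') + κ * (p.2.1 - q') + e * (p.2.2 - ρ')))
      (l * (p.1 - x') + κ * (p.2.1 - q') + e * (p.2.2 - ρ'))
    rw [sub_add_cancel] at h2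
    linarith
  unfold ContinuousWithinAt
  rw [tendsto_iff_dist_tendsto_zero]
  have hlim : Tendsto (fun p : ℝ × ℝ × ℝ => |l * (p.1 - x') + κ * (p.2.1 - q') + e * (p.2.2 - ρ')| + η * (|p.1 - x'| + |p.2.1 - q'| + |p.2.2 - ρ'|))
      (nhdsWithin (x', q', ρ') (Box r)) (nhds 0) := by
    have : Continuous (fun p : ℝ × ℝ × ℝ => |l * (p.1 - x') + κ * (p.2.1 - q') + e * (p.2.2 - ρ')| + η * (|p.1 - x'| + |p.2.1 - q'| + |p.2.2 - ρ'|)) := by fun_prop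
    have h3 := (this.tendsto (x', q', ρ')).mono_left (nhdsWithin_le_nhds (s := Box r))
    simpa using h3
  refine squeeze_zero' (Eventually.of_forall fun p => dist_nonneg) ?_ hlim
  filter_upwards [self_mem_nhdsWithin] with p hp
  rw [Real.dist_eq]
  exact key p hp

def Phi (G : ℝ → ℝ → ℝ → ℝ) (ς x0 m σ : ℝ) (t v : ℝ) : ℝ :=
  ς * G (t + x0) (ς * min v m) (ς * σ * √((-ς * (t + x0)) * min v m))

lemma sgn_abs {ς : ℝ} (h : ς = 1 ∨ ς = -1) : |ς| = 1 := by rcases h with rfl | rfl <;> simp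

lemma sqrt_mul_bd {s v ε : ℝ} (hs : 0 ≤ s) (hs2 : s ≤ ε) (hv2 : v ≤ ε) (hε : 0 ≤ ε) :
    √(s * v) ≤ ε := by
  rw [Real.sqrt_le_left hε]
  nlinarith

lemma CoreG.phi_est {G : ℝ → ℝ → ℝ → ℝ} {l κ e η r : ℝ} (h : CoreG G l κ e η r) {ς x0 : ℝ}
    (hς : ς = 1 ∨ ς = -1) {s v ρ s' v' ρ' : ℝ} (h1 : |s| ≤ r) (h2 : |v| ≤ r) (h3 : |ρ| ≤ r)
    (h1' : |s'| ≤ r) (h2' : |v'| ≤ r) (h3' : |ρ'| ≤ r) :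
    |ς * G (-ς * s) (ς * v) (ς * ρ) - ς * G (-ς * s') (ς * v') (ς * ρ') -
      (-l * (s - s') + κ * (v - v') + e * (ρ - ρ'))| ≤ η * (|s - s'| + |v - v'| + |ρ - ρ'|) := by
  have hm : ∀ a b : ℝ, |ς * a - ς * b| = |a - b| := fun a b => by
    rw [← mul_sub, abs_mul, sgn_abs hς, one_mul]
  have hm2 : ∀ a b : ℝ, |-ς * a - -ς * b| = |a - b| := fun a b => by
    rw [← mul_sub, abs_mul, abs_neg, sgn_abs hς, one_mul]
  have hn : ∀ a : ℝ, |ς * a| = |a| := fun a => by rw [abs_mul, sgn_abs hς, one_mul]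
  have hn2 : ∀ a : ℝ, |-ς * a| = |a| := fun a => by rw [abs_mul, abs_neg, sgn_abs hς, one_mul]
  have := h.est (-ς * s) (ς * v) (ς * ρ) (-ς * s') (ς * v') (ς * ρ') (by rwa [hn2]) (by rwa [hn])
    (by rwa [hn]) (by rwa [hn2]) (by rwa [hn]) (by rwa [hn])
  rw [hm, hm, hm2] at this
  rw [← hn] at this
  refine le_of_eq_of_le ?_ this
  congr 1
  rcases hς with rfl | rfl <;> ring

lemma CoreG.strip {G : ℝ → ℝ → ℝ → ℝ} {l κ e η r : ℝ} (h : CoreG G l κ e η r) {ς x0 σ ε : ℝ}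
    (hς : ς = 1 ∨ ς = -1) (hσ : σ = 1 ∨ σ = -1) (hε : 0 < ε) (hεr : ε ≤ r)
    (hε2 : ε * (l + |κ| + e + 3 * η) ≤ 1 / 2)
    (hs0 : ∀ t ∈ Icc 0 ε, 0 ≤ -ς * (t + x0)) (hs1 : ∀ t ∈ Icc 0 ε, -ς * (t + x0) ≤ ε)
    (hS : ∀ t t0, 0 ≤ t → t ≤ t0 → t0 ≤ ε → (-ς * (t + x0)) * (t0 - t) / 2 ≤
      -ς * (t0 + x0) ^ 2 / 2 - -ς * (t + x0) ^ 2 / 2) :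
    Strip ε (l / 2) (|κ| + 2 * η + e + (e + η) ^ 2 / l) (fun t => -ς * (t + x0))
      (fun t => -ς * (t + x0) ^ 2 / 2) (Phi G ς x0 ε σ) := by
  have hl := h.hl
  have he := h.he
  have hη := h.hη
  have hr := h.hr
  have hκ := abs_nonneg κ
  have hςς : ς * ς = 1 := by rcases hς with rfl | rfl <;> norm_num
  have hPhi : ∀ t v, Phi G ς x0 ε σ t v = ς * G (-ς * (-ς * (t + x0))) (ς * min v ε)
      (ς * (σ * √((-ς * (t + x0)) * min v ε))) := by
    intro t v
    unfold Phi
    rw [show -ς * (-ς * (t + x0)) = ς * ς * (t + x0) by ring, hςς, one_mul, mul_assoc ς σ]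
  have hσm : ∀ a : ℝ, |σ * a| = |a| := fun a => by rw [abs_mul, sgn_abs hσ, one_mul]
  have hmv : ∀ v, 0 < v → 0 < min v ε := fun v hv => lt_min hv hε
  have habs : ∀ a, 0 ≤ a → a ≤ ε → |a| ≤ r := fun a h1 h2 => by rw [abs_of_nonneg h1]; linarith
  have hrho : ∀ t ∈ Icc 0 ε, ∀ v, 0 < v → |σ * √((-ς * (t + x0)) * min v ε)| ≤ ε := by
    intro t ht v hv
    rw [hσm, abs_of_nonneg (Real.sqrt_nonneg _)]
    exact sqrt_mul_bd (hs0 t ht) (hs1 t ht) (min_le_right _ _) hε.le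
  have hz : ς * G (-ς * 0) (ς * 0) (ς * 0) = 0 := by simp [h.zero]
  have est0 : ∀ t ∈ Icc 0 ε, ∀ v, 0 < v → |Phi G ς x0 ε σ t v -
      (-l * (-ς * (t + x0)) + κ * min v ε + e * (σ * √((-ς * (t + x0)) * min v ε)))| ≤
      η * (-ς * (t + x0) + min v ε + √((-ς * (t + x0)) * min v ε)) := by
    intro t ht v hv
    have := h.phi_est (x0 := x0) hς (habs _ (hs0 t ht) (hs1 t ht)) (habs _ (hmv v hv).le (min_le_right _ _))
      ((hrho t ht v hv).trans hεr) (s' := 0) (v' := 0) (ρ' := 0) (by simpa using hr.le) (by simpa using hr.le)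
      (by simpa using hr.le)
    rw [hz, ← hPhi] at this
    simp only [sub_zero] at this
    rwa [hσm, abs_of_nonneg (hs0 t ht), abs_of_nonneg (hmv v hv).le, abs_of_nonneg (Real.sqrt_nonneg _)] at this
  refine ⟨hε, by linarith, by positivity, hs0, hs1, ?_, hS, ?_, ?_, ?_, ?_⟩
  · intro t
    have := (((hasDerivAt_id t).add_const x0).pow 2).const_mul (-ς / 2)
    have e1 : (fun t => -ς * (t + x0) ^ 2 / 2) = fun y => -ς / 2 * ((fun x => id x + x0) ^ 2) y := by
      ext y
      simp only [Pi.pow_apply, id]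
      ring
    rw [e1]
    refine this.congr_deriv ?_
    simp only [id]
    push_cast
    ring
  · intro v hv
    have : ContinuousOn (fun t => (t + x0, ς * min v ε, ς * σ * √((-ς * (t + x0)) * min v ε))) (Icc 0 ε) := by
      apply Continuous.continuousOn
      fun_prop
    have h2 := h.contOn.comp this ?_
    · exact continuousOn_const.mul h2
    · intro t ht
      refine ⟨?_, ?_, ?_⟩
      · have := habs _ (hs0 t ht) (hs1 t ht)
        rwa [abs_mul, abs_neg, sgn_abs hς, one_mul] at this
      · simp only
        rw [abs_mul, sgn_abs hς, one_mul]
        exact habs _ (hmv v hv).le (min_le_right _ _)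
      · simp only
        rw [mul_assoc, abs_mul, sgn_abs hς, one_mul]
        exact (hrho t ht v hv).trans hεr
  · intro t ht v hv
    have h1 := est0 t ht v hv
    have h2 := hs0 t ht
    have h3 := hs1 t ht
    have h4 := (hmv v hv).le
    have h5 : min v ε ≤ ε := min_le_right _ _
    have h6 := sqrt_mul_bd h2 h3 h5 hε.le
    have h7 := Real.sqrt_nonneg (-ς * (t + x0) * min v ε)
    set s := -ς * (t + x0)
    set y := min v ε
    set ρ := √(s * y)
    have h8 : |(-l * s + κ * y + e * (σ * ρ))| ≤ l * s + |κ| * y + e * ρ := by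
      refine (abs_add_three _ _ _).trans ?_
      rw [abs_mul (-l), abs_mul κ, abs_mul e, hσm, abs_neg, abs_of_pos hl, abs_of_pos he, abs_of_nonneg h2, abs_of_nonneg h4, abs_of_nonneg h7]
    have h9 := abs_add_le (Phi G ς x0 ε σ t v - (-l * s + κ * y + e * (σ * ρ))) (-l * s + κ * y + e * (σ * ρ))
    rw [sub_add_cancel] at h9
    have g1 : l * s ≤ l * ε := by gcongr
    have g2 : |κ| * y ≤ |κ| * ε := by gcongr
    have g3 : e * ρ ≤ e * ε := by gcongr
    have g4 : η * (s + y + ρ) ≤ η * (ε + ε + ε) := by gcongr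
    linarith
  · intro t ht v hv
    have h1 := (abs_le.1 (est0 t ht v hv)).2
    have h2 := hs0 t ht
    have h4 := (hmv v hv).le
    have h5 : min v ε ≤ v := min_le_left _ _
    have h7 := Real.sqrt_nonneg (-ς * (t + x0) * min v ε)
    have h8 := Real.sq_sqrt (mul_nonneg h2 h4)
    set s := -ς * (t + x0)
    set y := min v ε
    set ρ := √(s * y)
    have g1 : e * (σ * ρ) ≤ e * ρ := by
      apply mul_le_mul_of_nonneg_left _ he.le
      rcases hσ with rfl | rfl <;> linarith
    have g2 : κ * y ≤ |κ| * y := mul_le_mul_of_nonneg_right (le_abs_self κ) h4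
    have g3 : (e + η) * ρ ≤ (l/4) * s + (e + η)^2 / l * y := by
      have hq : ((e + η) * ρ)^2 = 4 * ((l/4) * s) * ((e + η)^2 / l * y) := by
        rw [mul_pow, h8]; field_simp
      have hp : 0 ≤ (l/4) * s + (e + η)^2 / l * y := by positivity
      apply abs_le_of_sq_le_sq' _ hp |>.2
      rw [hq]
      nlinarith [sq_nonneg ((l/4) * s - (e + η)^2 / l * y)]
    have g4 : (|κ| + η + (e+η)^2/l) * y ≤ (|κ| + 2 * η + e + (e+η)^2/l) * v := by
      have : 0 ≤ (e+η)^2/l := by positivity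
      apply mul_le_mul _ h5 h4 (by positivity)
      linarith
    have g5 : η * s ≤ l/4 * s := mul_le_mul_of_nonneg_right h.hηl h2
    nlinarith
  · intro t ht v1 v2 hv1 hv2
    have h1 := h.phi_est (x0 := x0) hς (habs _ (hs0 t ht) (hs1 t ht)) (habs _ (hmv v1 hv1).le (min_le_right _ _))
      ((hrho t ht v1 hv1).trans hεr) (habs _ (hs0 t ht) (hs1 t ht)) (habs _ (hmv v2 hv2).le (min_le_right _ _))
      ((hrho t ht v2 hv2).trans hεr)
    rw [← hPhi, ← hPhi] at h1
    have h2 := hs0 t ht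
    have h3 := hs1 t ht
    have hy1 := hmv v1 hv1
    have hy2 := hmv v2 hv2
    have h5 : |min v1 ε - min v2 ε| ≤ |v1 - v2| := by
      refine (abs_min_sub_min_le_max v1 ε v2 ε).trans ?_
      simp
    have hfrac : √((-ς * (t + x0)) / min v1 ε) ≤ 1 + √((-ς * (t + x0)) / v1) := by
      rcases le_total v1 ε with hv | hv
      · rw [min_eq_left hv]; linarith
      · rw [min_eq_right hv]
        have : √((-ς * (t + x0)) / ε) ≤ 1 := by
          rw [Real.sqrt_le_left zero_le_one, one_pow, div_le_one hε]; exact h3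
        have := Real.sqrt_nonneg ((-ς * (t + x0)) / v1)
        linarith
    have hsq0 := Real.sqrt_nonneg ((-ς * (t + x0)) / v1)
    set s := -ς * (t + x0)
    set y1 := min v1 ε
    set y2 := min v2 ε
    have hrd : |σ * √(s * y1) - σ * √(s * y2)| ≤ √(s / y1) * |y1 - y2| := by
      rw [← mul_sub, hσm, Real.sqrt_mul h2, Real.sqrt_mul h2, ← mul_sub, abs_mul, abs_of_nonneg (Real.sqrt_nonneg s),
        Real.sqrt_div h2]
      have e1 : 0 < √y1 := Real.sqrt_pos.2 hy1
      have e2 : 0 < √y2 := Real.sqrt_pos.2 hy2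
      have e3 : y1 - y2 = (√y1 - √y2) * (√y1 + √y2) := by
        have := Real.sq_sqrt hy1.le
        have := Real.sq_sqrt hy2.le
        nlinarith
      rw [e3, abs_mul, abs_of_pos (by linarith : 0 < √y1 + √y2), div_mul_eq_mul_div, le_div_iff₀ e1]
      have := mul_nonneg (Real.sqrt_nonneg s) (abs_nonneg (√y1 - √y2))
      nlinarith [mul_nonneg this e2.le]
    have h9 := abs_add_le (Phi G ς x0 ε σ t v1 - Phi G ς x0 ε σ t v2 - (-l * (s - s) + κ * (y1 - y2) + e * (σ * √(s * y1) - σ * √(s * y2))))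
      (-l * (s - s) + κ * (y1 - y2) + e * (σ * √(s * y1) - σ * √(s * y2)))
    rw [sub_add_cancel] at h9
    have h10 : |-l * (s - s) + κ * (y1 - y2) + e * (σ * √(s * y1) - σ * √(s * y2))| ≤
        |κ| * |y1 - y2| + e * |σ * √(s * y1) - σ * √(s * y2)| := by
      refine (abs_add_three _ _ _).trans ?_
      rw [abs_mul κ, abs_mul e, abs_of_pos he]
      simp
    simp only [sub_self, abs_zero, zero_add] at h1
    rw [sub_self] at h9 h10
    set D := |σ * √(s * y1) - σ * √(s * y2)|
    set d := |y1 - y2|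
    have hd : 0 ≤ d := abs_nonneg _
    have hD2 : D ≤ (1 + √(s / v1)) * d := hrd.trans (mul_le_mul_of_nonneg_right hfrac hd)
    have hA : (e + η) * D ≤ (e + η) * ((1 + √(s / v1)) * d) := by gcongr
    have hB : (|κ| + η) * d ≤ (|κ| + η) * ((1 + √(s / v1)) * d) := by
      apply mul_le_mul_of_nonneg_left _ (by positivity)
      nlinarith
    have hC : (|κ| + 2 * η + e) * ((1 + √(s / v1)) * d) ≤ (|κ| + 2 * η + e + (e+η)^2/l) * ((1 + √(s / v1)) * |v1 - v2|) := by
      have : 0 ≤ (e+η)^2/l := by positivity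
      exact mul_le_mul (by linarith) (mul_le_mul_of_nonneg_left h5 (by positivity)) (by positivity) (by positivity)
    have hfin : |Phi G ς x0 ε σ t v1 - Phi G ς x0 ε σ t v2| ≤ (|κ| + η) * d + (e + η) * D := by
      simp only [mul_zero, zero_add] at h1 h9 h10
      linarith
    rw [mul_assoc]
    linarith

lemma CoreG.phi_lt {G : ℝ → ℝ → ℝ → ℝ} {l κ e η r : ℝ} (h : CoreG G l κ e η r) {ς x0 ε : ℝ}
    (hς : ς = 1 ∨ ς = -1) (hε : 0 < ε) (hεr : ε ≤ r) {t v : ℝ} (hs0 : 0 < -ς * (t + x0))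
    (hs1 : -ς * (t + x0) ≤ ε) (hv : 0 < v) : Phi G ς x0 ε (-1) t v < Phi G ς x0 ε 1 t v := by
  have hςς : ς * ς = 1 := by rcases hς with rfl | rfl <;> norm_num
  have hPhi : ∀ σ, Phi G ς x0 ε σ t v = ς * G (-ς * (-ς * (t + x0))) (ς * min v ε)
      (ς * (σ * √((-ς * (t + x0)) * min v ε))) := by
    intro σ
    unfold Phi
    rw [show -ς * (-ς * (t + x0)) = ς * ς * (t + x0) by ring, hςς, one_mul, mul_assoc ς σ]
  have hm : 0 < min v ε := lt_min hv hε
  have hsq := sqrt_mul_bd hs0.le hs1 (min_le_right v ε) hε.le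
  have hsp : 0 < √((-ς * (t + x0)) * min v ε) := Real.sqrt_pos.2 (by positivity)
  have a1 : |-ς * (t + x0)| ≤ r := by rw [abs_of_pos hs0]; linarith
  have a2 : |min v ε| ≤ r := by rw [abs_of_pos hm]; linarith [min_le_right v ε]
  have a3 : |1 * √((-ς * (t + x0)) * min v ε)| ≤ r := by rw [one_mul, abs_of_pos hsp]; linarith
  have a4 : |-1 * √((-ς * (t + x0)) * min v ε)| ≤ r := by rw [neg_one_mul, abs_neg, abs_of_pos hsp]; linarith
  have := h.phi_est (x0 := x0) hς a1 a2 a3 a1 a2 a4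
  rw [← hPhi, ← hPhi] at this
  have h1 := (abs_le.1 this).1
  have hη := h.hη
  have h2 := h.hηe
  have h3 := h.he
  simp only [sub_self, mul_zero, abs_zero, zero_add] at h1
  set ρ := √((-ς * (t + x0)) * min v ε)
  rw [show (1 * ρ - -1 * ρ) = 2 * ρ by ring, abs_of_pos (by linarith : 0 < 2 * ρ)] at h1
  nlinarith

def IC (D : ℝ × ℝ → ℝ × ℝ → Prop) (γ : ℝ → ℝ × ℝ) (I : Set ℝ) : Prop :=
  (∃ a b : ℝ, I = Set.Ioo a b) ∧
  ∃ dγ : ℝ → ℝ × ℝ, ContinuousOn dγ I ∧ ∀ t ∈ I, HasDerivAt γ (dγ t) t ∧ D (γ t) (dγ t)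

def DirG (G : ℝ → ℝ → ℝ → ℝ) (p v : ℝ × ℝ) : Prop :=
  v.1 ≠ 0 ∧ ∃ ρ, ρ ^ 2 = -(p.1 * p.2) ∧ v.2 = v.1 * G p.1 p.2 ρ

def SegIn (S : Set (ℝ × ℝ)) : Prop :=
  (S ⊆ WA ∨ S ⊆ WB) ∧ ∃ (c : ℝ) (J : Set ℝ), IsOpen J ∧ J.OrdConnected ∧
    (S = {c} ×ˢ J ∨ S = J ×ˢ {c})

def NF (D : ℝ × ℝ → ℝ × ℝ → Prop) : Prop :=
  ∀ N ∈ nhds (0 : ℝ × ℝ), ∃ (Q : Set (ℝ × ℝ)) (H : ℝ × ℝ → ℝ × ℝ), Q ⊆ N ∧ IsCompact Q ∧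
    Q ∈ nhds (0 : ℝ × ℝ) ∧ ContinuousOn H Q ∧ InjOn H Q ∧ H 0 = 0 ∧ H '' Q ∈ nhds (0 : ℝ × ℝ) ∧
    (∀ γ I, IC D γ I → MapsTo γ I Q → SegIn (H '' (γ '' I))) ∧
    (∀ S, SegIn S → S ⊆ H '' Q → ∃ γ I, IC D γ I ∧ MapsTo γ I Q ∧ H '' (γ '' I) = S)

lemma graph {γ : ℝ → ℝ × ℝ} {a b : ℝ} {dγ : ℝ → ℝ × ℝ} (hc : ContinuousOn dγ (Ioo a b))
    (hd : ∀ t ∈ Ioo a b, HasDerivAt γ (dγ t) t ∧ (dγ t).1 ≠ 0) :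
    ∃ (J : Set ℝ) (φ dφ : ℝ → ℝ), IsOpen J ∧ J.OrdConnected ∧
      γ '' (Ioo a b) = (fun x => (x, φ x)) '' J ∧ ContinuousOn dφ J ∧
      ∀ x ∈ J, HasDerivAt φ (dφ x) x ∧ ∃ t ∈ Ioo a b, γ t = (x, φ x) ∧ dφ x = (dγ t).2 / (dγ t).1 := by
  have hX : ∀ t ∈ Ioo a b, HasDerivAt (fun t => (γ t).1) (dγ t).1 t := fun t ht => (hd t ht).1.fst
  have hY : ∀ t ∈ Ioo a b, HasDerivAt (fun t => (γ t).2) (dγ t).2 t := fun t ht => (hd t ht).1.snd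
  set X : ℝ → ℝ := fun t => (γ t).1 with hXdef
  have hXc : ContinuousOn X (Ioo a b) := fun t ht => (hX t ht).continuousAt.continuousWithinAt
  have hinj : InjOn X (Ioo a b) := by
    have key : ∀ s ∈ Ioo a b, ∀ t ∈ Ioo a b, s < t → X s ≠ X t := by
      intro s hs t ht hst heq
      have hsub : Icc s t ⊆ Ioo a b := fun u hu => ⟨hs.1.trans_le hu.1, hu.2.trans_lt ht.2⟩
      obtain ⟨c, hc1, hc2⟩ := exists_hasDerivAt_eq_zero hst (hXc.mono hsub) heq
        (fun u hu => hX u (hsub (Ioo_subset_Icc_self hu)))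
      exact (hd c (hsub (Ioo_subset_Icc_self hc1))).2 hc2
    intro s hs t ht heq
    rcases lt_trichotomy s t with h | h | h
    · exact absurd heq (key s hs t ht h)
    · exact h
    · exact absurd heq.symm (key t ht s hs h)
  have hmap : ∀ t ∈ Ioo a b, map X (nhds t) = nhds (X t) := by
    intro t ht
    have hs : HasStrictDerivAt X (dγ t).1 t := by
      apply hasStrictDerivAt_of_hasDerivAt_of_continuousAt (f' := fun t => (dγ t).1)
      · filter_upwards [isOpen_Ioo.mem_nhds ht] with u hu using hX u hu
      · exact continuous_fst.continuousAt.comp (hc.continuousAt (isOpen_Ioo.mem_nhds ht))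
    exact hs.map_nhds_eq (hd t ht).2
  set g := Function.invFunOn X (Ioo a b)
  have hg : ∀ t ∈ Ioo a b, g (X t) = t := fun t ht => hinj.leftInvOn_invFunOn ht
  have hgc : ∀ t ∈ Ioo a b, ContinuousAt g (X t) := by
    intro t ht
    unfold ContinuousAt
    rw [hg t ht, ← hmap t ht, tendsto_map'_iff]
    refine tendsto_id.congr' ?_
    filter_upwards [isOpen_Ioo.mem_nhds ht] with u hu
    exact (hg u hu).symm
  have hJ : IsOpen (X '' Ioo a b) := by
    rw [isOpen_iff_mem_nhds]
    rintro _ ⟨t, ht, rfl⟩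
    rw [← hmap t ht]
    exact image_mem_map (isOpen_Ioo.mem_nhds ht)
  have hgd : ∀ t ∈ Ioo a b, HasDerivAt g ((dγ t).1)⁻¹ (X t) := by
    intro t ht
    apply HasDerivAt.of_local_left_inverse (hgc t ht) (by rw [hg t ht]; exact hX t ht) (hd t ht).2
    filter_upwards [hJ.mem_nhds (mem_image_of_mem X ht)] with y hy
    obtain ⟨u, hu, rfl⟩ := hy
    rw [hg u hu]
  refine ⟨X '' Ioo a b, fun x => (γ (g x)).2, fun x => (dγ (g x)).2 / (dγ (g x)).1, hJ,
    (isPreconnected_Ioo.image X hXc).ordConnected, ?_, ?_, ?_⟩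
  · rw [image_image]
    apply image_congr
    intro t ht
    simp only [hg t ht]
    rfl
  · have h1 : ContinuousOn (fun x => dγ (g x)) (X '' Ioo a b) := by
      apply hc.comp
      · rintro _ ⟨t, ht, rfl⟩
        exact (hgc t ht).continuousWithinAt
      · rintro _ ⟨t, ht, rfl⟩
        rw [hg t ht]; exact ht
    apply (continuous_snd.comp_continuousOn h1).div (continuous_fst.comp_continuousOn h1)
    rintro _ ⟨t, ht, rfl⟩
    rw [Function.comp, hg t ht]
    exact (hd t ht).2
  · rintro _ ⟨t, ht, rfl⟩
    refine ⟨?_, t, ht, ?_, ?_⟩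
    · have h1 := HasDerivAt.comp (X t) (h₂ := fun t => (γ t).2) (h := g) (by rw [hg t ht]; exact hY t ht) (hgd t ht)
      simp only [hg t ht]
      exact h1
    · simp only [hg t ht]
      rfl
    · simp only [hg t ht]

lemma const_sign {J : Set ℝ} (hJ : J.OrdConnected) {d : ℝ → ℝ} (hd : ContinuousOn d J)
    (h0 : ∀ x ∈ J, d x ≠ 0) : (∀ x ∈ J, 0 < d x) ∨ (∀ x ∈ J, d x < 0) := by
  by_contra hcon
  push Not at hcon
  obtain ⟨⟨x, hx, hx1⟩, ⟨y, hy, hy1⟩⟩ := hcon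
  have h1 := (hJ.isPreconnected.image d hd).ordConnected.out (mem_image_of_mem d hx) (mem_image_of_mem d hy)
  obtain ⟨z, hz, hz1⟩ := h1 ⟨hx1, hy1⟩
  exact h0 z hz hz1

structure GraphSol (G : ℝ → ℝ → ℝ → ℝ) (r : ℝ) (J : Set ℝ) (φ dφ : ℝ → ℝ) : Prop where
  op : IsOpen J
  oc : J.OrdConnected
  bx : ∀ x ∈ J, |x| ≤ r
  bq : ∀ x ∈ J, |φ x| ≤ r
  dc : ContinuousOn dφ J
  der : ∀ x ∈ J, HasDerivAt φ (dφ x) x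
  eq : ∀ x ∈ J, ∃ ρ, ρ ^ 2 = -(x * φ x) ∧ dφ x = G x (φ x) ρ

lemma abs_rho {x q r ρ : ℝ} (hr : 0 < r) (h1 : |x| ≤ r) (h2 : |q| ≤ r) (h : ρ ^ 2 = -(x * q)) : |ρ| ≤ r := by
  apply abs_le_of_sq_le_sq _ hr.le
  rw [h]
  have : |x * q| ≤ r * r := by rw [abs_mul]; exact mul_le_mul h1 h2 (abs_nonneg _) hr.le
  have := neg_abs_le (x * q)
  nlinarith

lemma CoreG.est0 {G : ℝ → ℝ → ℝ → ℝ} {l κ e η r : ℝ} (h : CoreG G l κ e η r) {x q ρ : ℝ}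
    (h1 : |x| ≤ r) (h2 : |q| ≤ r) (h3 : |ρ| ≤ r) :
    |G x q ρ - (l * x + κ * q + e * ρ)| ≤ η * (|x| + |q| + |ρ|) := by
  have hr : |(0 : ℝ)| ≤ r := by rw [abs_zero]; exact h.hr.le
  have := h.est x q ρ 0 0 0 h1 h2 h3 hr hr hr
  simpa only [h.zero, sub_zero] using this

lemma GraphSol.le {G : ℝ → ℝ → ℝ → ℝ} {r : ℝ} {J : Set ℝ} {φ dφ : ℝ → ℝ} (g : GraphSol G r J φ dφ)
    {x : ℝ} (hx : x ∈ J) : x * φ x ≤ 0 := by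
  obtain ⟨ρ, h1, -⟩ := g.eq x hx
  nlinarith [sq_nonneg ρ]

lemma GraphSol.ne {G : ℝ → ℝ → ℝ → ℝ} {l κ e η r : ℝ} (h : CoreG G l κ e η r) {J : Set ℝ} {φ dφ : ℝ → ℝ}
    (g : GraphSol G r J φ dφ) {x : ℝ} (hx : x ∈ J) : x * φ x ≠ 0 := by
  intro h0
  have hl := h.hl
  have he := h.he
  have hη := h.hη
  have hηl := h.hηl
  have hnJ := g.op.mem_nhds hx
  have hφ0 : φ x = 0 := by
    rcases mul_eq_zero.1 h0 with h1 | h1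
    · have hmax : IsLocalMax (fun y => y * φ y) x := by
        filter_upwards [hnJ] with y hy
        rw [h0]; exact g.le hy
      have hdd := (hasDerivAt_id x).mul (g.der x hx)
      have := hmax.hasDerivAt_eq_zero hdd
      simpa [h1] using this
    · exact h1
  have hxx : x = 0 := by
    by_contra hne
    obtain ⟨ρ, h1, h2⟩ := g.eq x hx
    rw [h0, neg_zero] at h1
    have hρ : ρ = 0 := by simpa using h1
    have h3 := h.est0 (g.bx x hx) (g.bq x hx) (abs_rho h.hr (g.bx x hx) (g.bq x hx) (by rw [hρ, h0]; simp) : |ρ| ≤ r)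
    rw [← h2, hφ0, hρ] at h3
    have hd0 : dφ x = 0 := by
      rcases lt_or_gt_of_ne hne with hlt | hlt
      · have hm : IsLocalMin φ x := by
          filter_upwards [hnJ, gt_mem_nhds hlt] with y hy hy2
          have := g.le hy
          rw [hφ0]
          by_contra hcon
          push Not at hcon
          nlinarith [mul_pos_of_neg_of_neg hy2 hcon]
        exact hm.hasDerivAt_eq_zero (g.der x hx)
      · have hm : IsLocalMax φ x := by
          filter_upwards [hnJ, lt_mem_nhds hlt] with y hy hy2
          have := g.le hy
          rw [hφ0]
          by_contra hcon
          push Not at hcon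
          nlinarith [mul_pos hy2 hcon]
        exact hm.hasDerivAt_eq_zero (g.der x hx)
    rw [hd0] at h3
    simp only [mul_zero, add_zero, zero_sub, abs_neg, abs_zero, abs_mul, abs_of_pos hl] at h3
    have := abs_pos.2 hne
    nlinarith
  subst hxx
  obtain ⟨d, hd, hdJ⟩ := Metric.isOpen_iff.1 g.op 0 hx
  set K := |κ| + η + (e + η) ^ 2 / l with hK
  have hsub : Icc 0 (d/2) ⊆ J := by
    intro y hy
    apply hdJ
    rw [Metric.mem_ball, dist_zero_right, Real.norm_eq_abs, abs_of_nonneg hy.1]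
    linarith [hy.2]
  have hder : ∀ y ∈ J, HasDerivAt (fun y => φ y * Real.exp (-K * y)) (dφ y * Real.exp (-K * y) + φ y * (Real.exp (-K * y) * -K)) y := by
    intro y hy
    have h1 : HasDerivAt (fun y => Real.exp (-K * y)) (Real.exp (-K * y) * -K) y := by
      have := ((hasDerivAt_id y).const_mul (-K)).exp
      simpa using this
    exact (g.der y hy).mul h1
  have hmono : StrictMonoOn (fun y => φ y * Real.exp (-K * y)) (Icc 0 (d/2)) := by
    apply strictMonoOn_of_deriv_pos (convex_Icc _ _)
    · exact fun y hy => (hder y (hsub hy)).continuousAt.continuousWithinAt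
    · intro y hy
      rw [interior_Icc] at hy
      have hyJ := hsub (Ioo_subset_Icc_self hy)
      rw [(hder y hyJ).deriv]
      obtain ⟨ρ, h1, h2⟩ := g.eq y hyJ
      have hy0 := hy.1
      have hq : φ y ≤ 0 := by
        have := g.le hyJ
        by_contra hcon
        push Not at hcon
        nlinarith [mul_pos hy0 hcon]
      have h3 := (abs_le.1 (h.est0 (g.bx y hyJ) (g.bq y hyJ) (abs_rho h.hr (g.bx y hyJ) (g.bq y hyJ) h1 : |ρ| ≤ r))).1
      rw [← h2, abs_of_pos hy0, abs_of_nonpos hq] at h3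
      have h4 : (e + η) * |ρ| ≤ (l/4) * y + (e + η)^2 / l * (-φ y) := by
        have hq : ((e + η) * |ρ|)^2 = 4 * ((l/4) * y) * ((e + η)^2 / l * (-φ y)) := by
          rw [mul_pow, sq_abs, h1]; field_simp
        have hp : 0 ≤ (l/4) * y + (e + η)^2 / l * (-φ y) := by
          have : 0 ≤ (e + η)^2 / l * (-φ y) := mul_nonneg (by positivity) (by linarith)
          have : 0 ≤ (l/4) * y := by positivity
          linarith
        apply abs_le_of_sq_le_sq' _ hp |>.2
        rw [hq]
        nlinarith [sq_nonneg ((l/4) * y - (e + η)^2 / l * (-φ y))]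
      have h5 : e * ρ ≥ - (e * |ρ|) := by
        have := neg_abs_le ρ
        nlinarith
      have h6 : κ * φ y ≥ |κ| * φ y := mul_le_mul_of_nonpos_right (le_abs_self κ) hq
      have h7 : η * y ≤ l / 4 * y := mul_le_mul_of_nonneg_right hηl hy0.le
      have h8 : 0 < dφ y - K * φ y := by
        rw [hK]
        have : 0 < l * y := by positivity
        nlinarith
      have h9 := mul_pos h8 (Real.exp_pos (-K * y))
      linarith
  have h1 := hmono (left_mem_Icc.2 (by linarith)) (right_mem_Icc.2 (by linarith : (0:ℝ) ≤ d/2)) (by linarith)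
  simp only [hφ0, zero_mul] at h1
  have h2 := g.le (hsub (right_mem_Icc.2 (by linarith : (0:ℝ) ≤ d/2)))
  have h3 : 0 < φ (d/2) := by
    by_contra hcon
    push Not at hcon
    nlinarith [Real.exp_pos (-K * (d/2))]
  nlinarith [mul_pos hd h3]

lemma GraphSol.side {G : ℝ → ℝ → ℝ → ℝ} {l κ e η r : ℝ} (h : CoreG G l κ e η r) {J : Set ℝ} {φ dφ : ℝ → ℝ}
    (g : GraphSol G r J φ dφ) : ∃ ς : ℝ, (ς = 1 ∨ ς = -1) ∧ ∀ x ∈ J, 0 < -ς * x ∧ 0 < ς * φ x := by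
  have h0 : ∀ x ∈ J, x ≠ 0 := fun x hx h0 => g.ne h hx (by rw [h0, zero_mul])
  rcases const_sign g.oc continuousOn_id h0 with h1 | h1
  · refine ⟨-1, Or.inr rfl, fun x hx => ⟨by have := h1 x hx; simp only [id] at this; linarith, ?_⟩⟩
    have h2 := lt_of_le_of_ne (g.le hx) (g.ne h hx)
    have h3 : 0 < x := h1 x hx
    have := neg_of_mul_neg_right h2 h3.le
    linarith
  · refine ⟨1, Or.inl rfl, fun x hx => ⟨by have := h1 x hx; simp only [id] at this; linarith, ?_⟩⟩
    have h2 := lt_of_le_of_ne (g.le hx) (g.ne h hx)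
    have h3 : x < 0 := h1 x hx
    have := pos_of_mul_neg_right h2 h3.le
    linarith

lemma GraphSol.sign {G : ℝ → ℝ → ℝ → ℝ} {l κ e η r : ℝ} (h : CoreG G l κ e η r) {J : Set ℝ} {φ dφ : ℝ → ℝ}
    (g : GraphSol G r J φ dφ) : ∃ σ : ℝ, (σ = 1 ∨ σ = -1) ∧ ∀ x ∈ J, dφ x = G x (φ x) (σ * √(-(x * φ x))) := by
  have hr : |(0 : ℝ)| ≤ r := by rw [abs_zero]; exact h.hr.le
  have he := h.he
  have hηe := h.hηe
  have hφc : ContinuousOn φ J := fun x hx => (g.der x hx).continuousAt.continuousWithinAt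
  have hc : ContinuousOn (fun x => dφ x - G x (φ x) 0) J := by
    apply g.dc.sub
    have := h.contOn.comp (f := fun x => (x, φ x, (0:ℝ))) (s := J)
      (continuousOn_id.prodMk (hφc.prodMk continuousOn_const)) (fun x hx => ⟨g.bx x hx, g.bq x hx, hr⟩)
    exact this
  have key : ∀ x ∈ J, ∀ ρ, ρ ^ 2 = -(x * φ x) → dφ x = G x (φ x) ρ →
      |(dφ x - G x (φ x) 0) - e * ρ| ≤ η * |ρ| ∧ ρ ≠ 0 := by
    intro x hx ρ h1 h2
    have h3 := h.est x (φ x) ρ x (φ x) 0 (g.bx x hx) (g.bq x hx) (abs_rho h.hr (g.bx x hx) (g.bq x hx) h1)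
      (g.bx x hx) (g.bq x hx) hr
    rw [← h2] at h3
    simp only [sub_self, mul_zero, sub_zero, zero_add, abs_zero] at h3
    refine ⟨h3, ?_⟩
    rintro rfl
    apply g.ne h hx
    linarith
  have h0 : ∀ x ∈ J, dφ x - G x (φ x) 0 ≠ 0 := by
    intro x hx hz
    obtain ⟨ρ, h1, h2⟩ := g.eq x hx
    obtain ⟨h3, h4⟩ := key x hx ρ h1 h2
    rw [hz, zero_sub, abs_neg, abs_mul, abs_of_pos he] at h3
    have := abs_pos.2 h4
    nlinarith
  rcases const_sign g.oc hc h0 with h1 | h1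
  · refine ⟨1, Or.inl rfl, fun x hx => ?_⟩
    obtain ⟨ρ, h2, h3⟩ := g.eq x hx
    obtain ⟨h4, h5⟩ := key x hx ρ h2 h3
    have hp : 0 < ρ := by
      by_contra hcon
      push Not at hcon
      rw [abs_of_nonpos hcon] at h4
      have := (abs_le.1 h4).2
      have := h1 x hx
      nlinarith
    rw [← h2, Real.sqrt_sq hp.le, one_mul]; exact h3
  · refine ⟨-1, Or.inr rfl, fun x hx => ?_⟩
    obtain ⟨ρ, h2, h3⟩ := g.eq x hx
    obtain ⟨h4, h5⟩ := key x hx ρ h2 h3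
    have hp : ρ < 0 := by
      by_contra hcon
      push Not at hcon
      rw [abs_of_nonneg hcon] at h4
      have := (abs_le.1 h4).1
      have := h1 x hx
      nlinarith
    rw [← h2, Real.sqrt_sq_eq_abs, abs_of_neg hp]
    simpa using h3

structure Reg (G : ℝ → ℝ → ℝ → ℝ) (ς x0 m : ℝ) (s : ℝ → ℝ) (a1 a2 : ℝ → ℝ → ℝ) : Prop where
  hς : ς = 1 ∨ ς = -1
  h1 : FI m s (Phi G ς x0 m 1) a1
  h2 : FI m s (Phi G ς x0 m (-1)) a2
  P : Pair m a1 a2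

lemma Reg.k1 {G : ℝ → ℝ → ℝ → ℝ} {ς x0 m : ℝ} {s : ℝ → ℝ} {a1 a2 : ℝ → ℝ → ℝ}
    (R : Reg G ς x0 m s a1 a2) : KeyFor m a1 a2 := R.P.key

lemma Reg.k2 {G : ℝ → ℝ → ℝ → ℝ} {ς x0 m : ℝ} {s : ℝ → ℝ} {a1 a2 : ℝ → ℝ → ℝ}
    (R : Reg G ς x0 m s a1 a2) : KeyFor m a2 (fun t v => - a1 t v) := by
  intro t t0 v v0 h1 h2 h3 h4 h5 h6
  have := R.P.key2 h1 h2 h3 h4 h5 h6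
  simp only; linarith

lemma homeo_img (μ : ℝ ≃ₜ ℝ) {J : Set ℝ} (h1 : IsOpen J) (h2 : J.OrdConnected) :
    IsOpen (μ '' J) ∧ (μ '' J).OrdConnected :=
  ⟨μ.isOpenMap J h1, (h2.isPreconnected.image μ μ.continuous.continuousOn).ordConnected⟩

lemma reg_fwd {G : ℝ → ℝ → ℝ → ℝ} {ς x0 m r : ℝ} {s : ℝ → ℝ} {a1 a2 : ℝ → ℝ → ℝ}
    (R : Reg G ς x0 m s a1 a2) {J : Set ℝ} {φ dφ : ℝ → ℝ} (g : GraphSol G r J φ dφ)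
    {σ : ℝ} (hσ : σ = 1 ∨ σ = -1) (hσe : ∀ x ∈ J, dφ x = G x (φ x) (σ * √(-(x * φ x))))
    (hs : ∀ x ∈ J, 0 < -ς * x ∧ 0 < ς * φ x) (hx : ∀ x ∈ J, x - x0 ∈ Icc 0 m)
    (hq : ∀ x ∈ J, ς * φ x ≤ m) {H : ℝ × ℝ → ℝ × ℝ} {μ ν : ℝ ≃ₜ ℝ}
    (hH : ∀ x ∈ J, H (x, φ x) = (μ (a2 (x - x0) (ς * φ x)), ν (a1 (x - x0) (ς * φ x)))) :
    ∃ (c : ℝ) (J' : Set ℝ), IsOpen J' ∧ J'.OrdConnected ∧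
      (H '' ((fun x => (x, φ x)) '' J) = {c} ×ˢ J' ∨ H '' ((fun x => (x, φ x)) '' J) = J' ×ˢ {c}) := by
  have hςς : ς * ς = 1 := by rcases R.hς with h | h <;> rw [h] <;> norm_num
  set I : Set ℝ := (fun t => t + x0) ⁻¹' J with hI
  have hIo : IsOpen I := g.op.preimage (by fun_prop)
  have hIc : I.OrdConnected := by
    have hmono : Monotone (fun t : ℝ => t + x0) := fun a b hab => by simp only; linarith
    exact g.oc.preimage_mono hmono
  have hI3 : I ⊆ Icc 0 m := fun t ht => by
    have := hx _ ht
    simpa using this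
  have hw : ∀ t ∈ I, HasDerivAt (fun t => ς * φ (t + x0)) (Phi G ς x0 m (ς * σ) t (ς * φ (t + x0))) t ∧ 0 < ς * φ (t + x0) := by
    intro t ht
    refine ⟨?_, (hs _ ht).2⟩
    have h1 := ((g.der _ ht).comp_add_const t x0).const_mul ς
    refine h1.congr_deriv ?_
    unfold Phi
    rw [min_eq_left (hq _ ht), hσe _ ht]
    rw [← mul_assoc ς ς, hςς, one_mul, ← mul_assoc ς ς, hςς, one_mul,
      show -ς * (t + x0) * (ς * φ (t + x0)) = -(ς * ς * ((t + x0) * φ (t + x0))) by ring, hςς, one_mul]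
  have hτ : ς * σ = 1 ∨ ς * σ = -1 := by
    rcases R.hς with h | h <;> rcases hσ with h' | h' <;> rw [h, h'] <;> norm_num
  have hback : ∀ x ∈ J, x - x0 ∈ I := fun x hx => by
    simp only [hI, mem_preimage, sub_add_cancel]; exact hx
  rcases hτ with hτ | hτ
  · rw [hτ] at hw
    obtain ⟨c, J', hJ1, hJ2, hc, hJ3⟩ := leaf_fwd R.h1 R.k1 R.h2.cont hIo hIc hI3 hw
    refine ⟨ν c, μ '' J', (homeo_img μ hJ1 hJ2).1, (homeo_img μ hJ1 hJ2).2, Or.inr ?_⟩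
    ext p
    constructor
    · rintro ⟨_, ⟨x, hxJ, rfl⟩, rfl⟩
      have h3 := hc _ (hback x hxJ)
      simp only [sub_add_cancel] at h3
      simp only [hH x hxJ, h3]
      refine ⟨mem_image_of_mem μ ?_, rfl⟩
      rw [← hJ3]
      exact ⟨x - x0, hback x hxJ, by simp only [sub_add_cancel]⟩
    · rintro ⟨⟨b, hb, hb2⟩, h2⟩
      rw [← hJ3] at hb
      obtain ⟨t, ht, rfl⟩ := hb
      refine ⟨_, ⟨t + x0, ht, rfl⟩, ?_⟩
      simp only [hH _ ht, add_sub_cancel_right, hc t ht]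
      exact Prod.ext hb2 h2.symm
  · rw [hτ] at hw
    have hcont : Continuous (fun p : ℝ × ℝ => - a1 p.1 p.2) := R.h1.cont.neg
    obtain ⟨c, J', hJ1, hJ2, hc, hJ3⟩ := leaf_fwd R.h2 R.k2 hcont hIo hIc hI3 hw
    set ν' := (Homeomorph.neg ℝ).trans ν with hν'
    have hν : ∀ x, ν' (-x) = ν x := fun x => by simp [hν']
    refine ⟨μ c, ν' '' J', (homeo_img ν' hJ1 hJ2).1, (homeo_img ν' hJ1 hJ2).2, Or.inl ?_⟩
    ext p
    constructor
    · rintro ⟨_, ⟨x, hxJ, rfl⟩, rfl⟩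
      have h3 := hc _ (hback x hxJ)
      simp only [sub_add_cancel] at h3
      simp only [hH x hxJ, h3]
      refine ⟨rfl, ?_⟩
      simp only
      rw [← hν]
      apply mem_image_of_mem ν'
      rw [← hJ3]
      exact ⟨x - x0, hback x hxJ, by simp only [sub_add_cancel]⟩
    · rintro ⟨h2, ⟨b, hb, hb2⟩⟩
      rw [← hJ3] at hb
      obtain ⟨t, ht, rfl⟩ := hb
      refine ⟨_, ⟨t + x0, ht, rfl⟩, ?_⟩
      simp only [hH _ ht, add_sub_cancel_right, hc t ht]
      rw [hν] at hb2
      exact Prod.ext h2.symm hb2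

lemma curve_of_w {G : ℝ → ℝ → ℝ → ℝ} {l κ e η r : ℝ} (h : CoreG G l κ e η r) {ς x0 m σ : ℝ}
    (hς : ς = 1 ∨ ς = -1) (hσ : σ = 1 ∨ σ = -1) (hm : m ≤ r) {α β : ℝ} {w : ℝ → ℝ}
    (hw : ∀ t ∈ Ioo α β, HasDerivAt w (Phi G ς x0 m σ t (w t)) t ∧ 0 < w t ∧ w t ≤ m ∧ 0 ≤ -ς * (t + x0) ∧ -ς * (t + x0) ≤ m) :
    IC (DirG G) (fun t => (t + x0, ς * w t)) (Ioo α β) := by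
  have hςς : ς * ς = 1 := by rcases hς with h | h <;> rw [h] <;> norm_num
  have hσσ : σ * σ = 1 := by rcases hσ with h | h <;> rw [h] <;> norm_num
  have hwc : ContinuousOn w (Ioo α β) := fun t ht => (hw t ht).1.continuousAt.continuousWithinAt
  have hval : ∀ t ∈ Ioo α β, ς * Phi G ς x0 m σ t (w t) = G (t + x0) (ς * w t) (ς * σ * √((-ς * (t + x0)) * w t)) := by
    intro t ht
    unfold Phi
    rw [min_eq_left (hw t ht).2.2.1, ← mul_assoc, hςς, one_mul]
  refine ⟨⟨α, β, rfl⟩, fun t => (1, ς * Phi G ς x0 m σ t (w t)), ?_, ?_⟩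
  · apply continuousOn_const.prodMk
    refine ContinuousOn.congr ?_ hval
    have h1 : ContinuousOn (fun t => (t + x0, ς * w t, ς * σ * √((-ς * (t + x0)) * w t))) (Ioo α β) := by
      fun_prop
    refine h.contOn.comp h1 ?_
    intro t ht
    obtain ⟨-, h2, h3, h4, h5⟩ := hw t ht
    refine ⟨?_, ?_, ?_⟩
    · have : |-ς * (t + x0)| ≤ r := by rw [abs_of_nonneg h4]; linarith
      rwa [abs_mul, abs_neg, sgn_abs hς, one_mul] at this
    · simp only
      rw [abs_mul, sgn_abs hς, one_mul, abs_of_pos h2]; linarith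
    · simp only
      rw [abs_mul, abs_mul, sgn_abs hς, sgn_abs hσ, one_mul, one_mul, abs_of_nonneg (Real.sqrt_nonneg _)]
      exact (sqrt_mul_bd h4 h5 h3 (by linarith)).trans hm
  · intro t ht
    obtain ⟨h1, h2, h3, h4, h5⟩ := hw t ht
    refine ⟨((hasDerivAt_id t).add_const x0).prodMk (h1.const_mul ς), one_ne_zero, ς * σ * √((-ς * (t + x0)) * w t), ?_, ?_⟩
    · rw [mul_pow, Real.sq_sqrt (mul_nonneg h4 h2.le), mul_pow, pow_two, pow_two, hςς, hσσ]
      ring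
    · simp only [one_mul]
      exact hval t ht

lemma reg_bwd {G : ℝ → ℝ → ℝ → ℝ} {l κ e η r : ℝ} (h : CoreG G l κ e η r) {ς x0 m : ℝ} {s : ℝ → ℝ} {a1 a2 : ℝ → ℝ → ℝ}
    (R : Reg G ς x0 m s a1 a2) (hm : m ≤ r) {H : ℝ × ℝ → ℝ × ℝ} {μ ν : ℝ ≃ₜ ℝ} {Q S : Set (ℝ × ℝ)}
    (hS : ∀ p ∈ S, ∃ q ∈ Q, H q = p ∧ q.1 - x0 ∈ Icc 0 m ∧ 0 < ς * q.2 ∧ ς * q.2 ≤ m ∧ 0 ≤ -ς * q.1 ∧ -ς * q.1 ≤ m ∧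
      H q = (μ (a2 (q.1 - x0) (ς * q.2)), ν (a1 (q.1 - x0) (ς * q.2))))
    {c : ℝ} {J : Set ℝ} (hJ : IsOpen J) (hJ2 : J.OrdConnected) (hSJ : S = {c} ×ˢ J ∨ S = J ×ˢ {c}) :
    ∃ γ I, IC (DirG G) γ I ∧ MapsTo γ I Q ∧ H '' (γ '' I) = S := by
  have hςς : ς * ς = 1 := by rcases R.hς with h | h <;> rw [h] <;> norm_num
  choose! pt hpt using hS
  -- general finishing step
  have fin : ∀ (σ : ℝ) (a a' : ℝ → ℝ → ℝ) (J' : Set ℝ) (c' : ℝ) (f : ℝ → ℝ × ℝ), (σ = 1 ∨ σ = -1) →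
      FI m s (Phi G ς x0 m σ) a → Lev m a → KeyFor m a a' → IsOpen J' → J'.OrdConnected → f '' J' = S →
      (∀ b ∈ J', a ((pt (f b)).1 - x0) (ς * (pt (f b)).2) = c' ∧ a' ((pt (f b)).1 - x0) (ς * (pt (f b)).2) = b) →
      ∃ γ I, IC (DirG G) γ I ∧ MapsTo γ I Q ∧ H '' (γ '' I) = S := by
    intro σ a a' J' c' f hσ hFI hL hk hJ' hJ2' hf hac
    have hfS : ∀ b ∈ J', f b ∈ S := fun b hb => hf ▸ mem_image_of_mem f hb
    obtain ⟨α, β, w, hαβ, hwν, hwd⟩ := leaf_bwd hFI hL hk (c := c') (τ := fun b => (pt (f b)).1 - x0)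
      (ν := fun b => ς * (pt (f b)).2) hJ' hJ2' (fun b hb => by
        obtain ⟨e1, e2, e3, e4, e5, e6, e7, e8⟩ := hpt _ (hfS b hb)
        exact ⟨e3, e4, (hac b hb).1, (hac b hb).2⟩)
    have hγ : ∀ b ∈ J', ((pt (f b)).1 - x0 + x0, ς * w ((pt (f b)).1 - x0)) = pt (f b) := by
      intro b hb
      have := hwν b hb
      rw [this, sub_add_cancel, ← mul_assoc, hςς, one_mul]
    refine ⟨fun t => (t + x0, ς * w t), Ioo α β, ?_, ?_, ?_⟩
    · apply curve_of_w h R.hς hσ hm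
      intro t ht
      refine ⟨hwd t ht, ?_⟩
      rw [hαβ] at ht
      obtain ⟨b, hb, rfl⟩ := ht
      obtain ⟨e1, e2, e3, e4, e5, e6, e7, e8⟩ := hpt _ (hfS b hb)
      have := hwν b hb
      simp only at this ⊢
      rw [this, sub_add_cancel]
      exact ⟨e4, e5, e6, e7⟩
    · intro t ht
      rw [hαβ] at ht
      obtain ⟨b, hb, rfl⟩ := ht
      simp only [hγ b hb]
      exact (hpt _ (hfS b hb)).1
    · rw [hαβ, image_image, image_image, ← hf]
      apply image_congr
      intro b hb
      simp only [hγ b hb]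
      exact (hpt _ (hfS b hb)).2.1
  rcases hSJ with hSJ | hSJ
  · set ν' := (Homeomorph.neg ℝ).trans ν with hν'
    have hν : ∀ x, ν' x = ν (-x) := fun x => by simp [hν']
    refine fin (-1) a2 (fun t v => - a1 t v) (ν'.symm '' J) (μ.symm c) (fun b => (c, ν' b)) (Or.inr rfl) R.h2 R.P.l2 R.k2
      (homeo_img _ hJ hJ2).1 (homeo_img _ hJ hJ2).2 ?_ ?_
    · rw [image_image, hSJ]
      ext p
      constructor
      · rintro ⟨b, hb, rfl⟩
        exact ⟨rfl, by simpa using hb⟩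
      · rintro ⟨h1, h2⟩
        exact ⟨p.2, h2, Prod.ext h1.symm (by simp)⟩
    · rintro _ ⟨b, hb, rfl⟩
      have hmem : (c, ν' (ν'.symm b)) ∈ S := by rw [hSJ]; exact ⟨rfl, by simpa using hb⟩
      obtain ⟨e1, e2, e3, e4, e5, e6, e7, e8⟩ := hpt _ hmem
      rw [e2] at e8
      have e9 := congrArg Prod.fst e8
      have e10 := congrArg Prod.snd e8
      simp only at e9 e10
      refine ⟨?_, ?_⟩
      · skip
        rw [e9, Homeomorph.symm_apply_apply]
        exact e9 ▸ rfl
      · skip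
        rw [hν] at e10 ⊢
        have := ν.injective e10
        linarith
  · refine fin 1 a1 a2 (μ.symm '' J) (ν.symm c) (fun b => (μ b, c)) (Or.inl rfl) R.h1 R.P.l1 R.k1
      (homeo_img _ hJ hJ2).1 (homeo_img _ hJ hJ2).2 ?_ ?_
    · rw [image_image, hSJ]
      ext p
      constructor
      · rintro ⟨b, hb, rfl⟩
        exact ⟨by simpa using hb, rfl⟩
      · rintro ⟨h1, h2⟩
        exact ⟨p.1, h1, Prod.ext (by simp) h2.symm⟩
    · rintro _ ⟨b, hb, rfl⟩
      have hmem : (μ (μ.symm b), c) ∈ S := by rw [hSJ]; exact ⟨by simpa using hb, rfl⟩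
      obtain ⟨e1, e2, e3, e4, e5, e6, e7, e8⟩ := hpt _ hmem
      rw [e2] at e8
      have e9 := congrArg Prod.fst e8
      have e10 := congrArg Prod.snd e8
      simp only at e9 e10
      refine ⟨?_, ?_⟩
      · skip
        rw [← ν.symm_apply_apply (a1 _ _), ← e10]
      · skip
        exact (μ.injective e9).symm

lemma CoreG.regA {G : ℝ → ℝ → ℝ → ℝ} {l κ e η r : ℝ} (h : CoreG G l κ e η r) {m : ℝ} (hm : 0 < m) (hmr : m ≤ r)
    (hm2 : m * (l + |κ| + e + 3 * η) ≤ 1 / 2) : ∃ s a1 a2, Reg G (-1) 0 m s a1 a2 := by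
  have hs0 : ∀ t ∈ Icc 0 m, 0 ≤ -(-1:ℝ) * (t + 0) := fun t ht => by linarith [ht.1]
  have hs1 : ∀ t ∈ Icc 0 m, -(-1:ℝ) * (t + 0) ≤ m := fun t ht => by linarith [ht.2]
  have hsp : ∀ t ∈ Ioo 0 m, 0 < -(-1:ℝ) * (t + 0) := fun t ht => by linarith [ht.1]
  have hS : ∀ t t0, 0 ≤ t → t ≤ t0 → t0 ≤ m → (-(-1:ℝ) * (t + 0)) * (t0 - t) / 2 ≤
      -(-1:ℝ) * (t0 + 0) ^ 2 / 2 - -(-1:ℝ) * (t + 0) ^ 2 / 2 := fun t t0 h1 h2 h3 => by nlinarith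
  obtain ⟨a1, h1⟩ := (h.strip (σ := 1) (Or.inr rfl) (Or.inl rfl) hm hmr hm2 hs0 hs1 hS).exists_FI
  obtain ⟨a2, h2⟩ := (h.strip (σ := -1) (Or.inr rfl) (Or.inr rfl) hm hmr hm2 hs0 hs1 hS).exists_FI
  exact ⟨_, a1, a2, Or.inr rfl, h1, h2, h1.pair h2 hm hs0 hsp (fun t ht v hv =>
    h.phi_lt (Or.inr rfl) hm hmr (hsp t ht) (hs1 t (Ioo_subset_Icc_self ht)) hv)⟩

lemma CoreG.regB {G : ℝ → ℝ → ℝ → ℝ} {l κ e η r : ℝ} (h : CoreG G l κ e η r) {m : ℝ} (hm : 0 < m) (hmr : m ≤ r)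
    (hm2 : m * (l + |κ| + e + 3 * η) ≤ 1 / 2) : ∃ s a1 a2, Reg G 1 (-m) m s a1 a2 := by
  have hs0 : ∀ t ∈ Icc 0 m, 0 ≤ -(1:ℝ) * (t + -m) := fun t ht => by linarith [ht.2]
  have hs1 : ∀ t ∈ Icc 0 m, -(1:ℝ) * (t + -m) ≤ m := fun t ht => by linarith [ht.1]
  have hsp : ∀ t ∈ Ioo 0 m, 0 < -(1:ℝ) * (t + -m) := fun t ht => by linarith [ht.2]
  have hS : ∀ t t0, 0 ≤ t → t ≤ t0 → t0 ≤ m → (-(1:ℝ) * (t + -m)) * (t0 - t) / 2 ≤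
      -(1:ℝ) * (t0 + -m) ^ 2 / 2 - -(1:ℝ) * (t + -m) ^ 2 / 2 := fun t t0 h1 h2 h3 => by nlinarith
  obtain ⟨a1, h1⟩ := (h.strip (σ := 1) (Or.inl rfl) (Or.inl rfl) hm hmr hm2 hs0 hs1 hS).exists_FI
  obtain ⟨a2, h2⟩ := (h.strip (σ := -1) (Or.inl rfl) (Or.inr rfl) hm hmr hm2 hs0 hs1 hS).exists_FI
  exact ⟨_, a1, a2, Or.inl rfl, h1, h2, h1.pair h2 hm hs0 hsp (fun t ht v hv =>
    h.phi_lt (Or.inl rfl) hm hmr (hsp t ht) (hs1 t (Ioo_subset_Icc_self ht)) hv)⟩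

lemma QQ_ball {ε : ℝ} {p : ℝ × ℝ} : p ∈ QQ ε ↔ |p.1| ≤ ε ∧ |p.2| ≤ ε := by
  unfold QQ
  rw [mem_prod, mem_Icc, mem_Icc, ← abs_le, ← abs_le]

theorem CoreG.nf {G : ℝ → ℝ → ℝ → ℝ} {l κ e η r : ℝ} (h : CoreG G l κ e η r) : NF (DirG G) := by
  intro N hN
  obtain ⟨d, hd, hdN⟩ := Metric.mem_nhds_iff.1 hN
  have hl := h.hl
  have he := h.he
  have hη := h.hη
  have hr := h.hr
  have hκ := abs_nonneg κ
  set L := l + |κ| + e + 3 * η with hL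
  have hL0 : 0 < L := by positivity
  set εA := min r (1 / (2 * L)) with hεA
  have hεA0 : 0 < εA := by positivity
  have hεAr : εA ≤ r := min_le_left _ _
  have hεA2 : εA * L ≤ 1 / 2 := by
    calc εA * L ≤ (1 / (2 * L)) * L := by gcongr; exact min_le_right _ _
      _ = 1 / 2 := by field_simp
  obtain ⟨sA, a1, a2, RA⟩ := h.regA hεA0 hεAr hεA2
  have hpos : ∀ t, 0 < t → t ≤ εA → 0 < a1 t 0 := by
    intro t h1 h2
    have := RA.P.l1.zero_mono le_rfl h1 h2
    rwa [RA.P.l1.zero 0 le_rfl] at this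
  obtain ⟨T, hT0, hTA, hT2⟩ : ∃ T, 0 < T ∧ T ≤ εA ∧ a2 T 0 ≤ a1 εA 0 := by
    have hc : Tendsto (fun t => a2 t 0) (nhds 0) (nhds (a2 0 0)) := by
      have : Continuous (fun t => a2 t 0) := RA.P.l2.cont.comp (f := fun t : ℝ => (t, (0:ℝ))) (by fun_prop)
      exact this.tendsto 0
    rw [RA.P.l2.zero 0 le_rfl] at hc
    have := hc.eventually (gt_mem_nhds (hpos εA hεA0 le_rfl))
    obtain ⟨t, ht, hball⟩ := Metric.eventually_nhds_iff.1 this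
    refine ⟨min (t/2) εA, by positivity, min_le_right _ _, (hball ?_).le⟩
    rw [dist_zero_right, Real.norm_eq_abs, abs_of_pos (by positivity)]
    have := min_le_left (t/2) εA
    linarith
  obtain ⟨ε, hε0, hεT, hεd, hsm⟩ : ∃ ε, 0 < ε ∧ ε ≤ T ∧ ε < d ∧ ∀ t ∈ Icc 0 ε, ∀ v ∈ Icc 0 ε, a1 t v ≤ a1 T 0 := by
    have hc := RA.P.l1.cont.tendsto ((0, 0) : ℝ × ℝ)
    simp only [RA.P.l1.zero 0 le_rfl] at hc
    have := hc.eventually (gt_mem_nhds (hpos T hT0 hTA))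
    obtain ⟨t, ht, hball⟩ := Metric.eventually_nhds_iff.1 this
    refine ⟨min (min (t/2) T) (d/2), by positivity, (min_le_left _ _).trans (min_le_right _ _),
      lt_of_le_of_lt (min_le_right _ _) (by linarith), ?_⟩
    intro u hu v hv
    have hm : min (min (t/2) T) (d/2) ≤ t/2 := (min_le_left _ _).trans (min_le_left _ _)
    apply (hball (y := (u, v)) ?_).le
    rw [Prod.dist_eq, Real.dist_eq, Real.dist_eq]
    simp only [sub_zero]
    rw [abs_of_nonneg hu.1, abs_of_nonneg hv.1]
    apply max_lt
    · linarith [hu.2]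
    · linarith [hv.2]
  have hεA' : ε ≤ εA := hεT.trans hTA
  have hεr : ε ≤ r := hεA'.trans hεAr
  have hεL : ε * L ≤ 1 / 2 := le_trans (by gcongr) hεA2
  obtain ⟨sB, b1, b2, RB⟩ := h.regB hε0 hεr hεL
  obtain ⟨H, k, θ, o, hHc, hHi, hH0, hHn, hHA, hHB, hWA, hWB⟩ := glue RA.P RB.P hεT hTA hT2 hsm
  set νA : ℝ ≃ₜ ℝ := k.toHomeomorph.trans (Homeomorph.mulLeft₀ (-2) (by norm_num)) with hνA
  have hνAe : ∀ x, νA x = -2 * k x := fun x => rfl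
  set μB : ℝ ≃ₜ ℝ := θ.toHomeomorph.trans (Homeomorph.subRight o) with hμB
  have hμBe : ∀ x, μB x = θ x - o := fun x => rfl
  have hHA' : ∀ p ∈ QQ ε, 0 < p.1 → p.2 < 0 → H p = (k.toHomeomorph (a2 (p.1 - 0) (-1 * p.2)), νA (a1 (p.1 - 0) (-1 * p.2))) := by
    intro p hp h1 h2
    rw [(hHA p hp h1 h2).1, sub_zero, neg_one_mul, hνAe]; rfl
  have hHB' : ∀ p ∈ QQ ε, p.1 < 0 → 0 < p.2 → H p = (μB (b2 (p.1 - -ε) (1 * p.2)), (Homeomorph.subRight o) (b1 (p.1 - -ε) (1 * p.2))) := by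
    intro p hp h1 h2
    rw [(hHB p hp h1 h2).1, sub_neg_eq_add, one_mul, hμBe, add_comm p.1]; rfl
  refine ⟨QQ ε, H, ?_, ?_, ?_, hHc.continuousOn, hHi, hH0, hHn, ?_, ?_⟩
  · intro p hp
    apply hdN
    rw [QQ_ball] at hp
    rw [Metric.mem_ball, dist_zero_right, Prod.norm_def]
    exact lt_of_le_of_lt (max_le hp.1 hp.2) hεd
  · exact isCompact_Icc.prod isCompact_Icc
  · exact prod_mem_nhds (Icc_mem_nhds (by linarith) hε0) (Icc_mem_nhds (by linarith) hε0)
  · rintro γ I ⟨⟨α, β, rfl⟩, dγ, hdc, hdγ⟩ hQ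
    obtain ⟨J, φ, dφ, hJo, hJc, hJe, hdφ, hJ⟩ := graph hdc (fun t ht => ⟨(hdγ t ht).1, (hdγ t ht).2.1⟩)
    have hxQ : ∀ x ∈ J, (x, φ x) ∈ QQ ε := by
      intro x hx
      obtain ⟨-, t, ht, h1, -⟩ := hJ x hx
      rw [← h1]; exact hQ ht
    have g : GraphSol G r J φ dφ := by
      refine ⟨hJo, hJc, fun x hx => (QQ_ball.1 (hxQ x hx)).1.trans hεr, fun x hx => (QQ_ball.1 (hxQ x hx)).2.trans hεr, hdφ, fun x hx => (hJ x hx).1, ?_⟩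
      intro x hx
      obtain ⟨-, t, ht, h1, h2⟩ := hJ x hx
      obtain ⟨-, h3, ρ, h4, h5⟩ := hdγ t ht
      refine ⟨ρ, ?_, ?_⟩
      · rw [h4, h1]
      · rw [h2, h5, h1]
        field_simp
    obtain ⟨σ, hσ, hσe⟩ := g.sign h
    obtain ⟨ς, hς, hside⟩ := g.side h
    rw [hJe]
    rcases hς with rfl | rfl
    · refine ⟨Or.inr ?_, reg_fwd RB g hσ hσe hside ?_ ?_ (H := H) (μ := μB) (ν := Homeomorph.subRight o) ?_⟩
      · rintro _ ⟨_, ⟨x, hx, rfl⟩, rfl⟩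
        have := hside x hx
        exact (hHB _ (hxQ x hx) (by simp only; linarith) (by simp only; linarith)).2
      · intro x hx
        have := hside x hx
        have h2 := abs_le.1 (QQ_ball.1 (hxQ x hx)).1
        simp only at h2
        constructor <;> linarith
      · intro x hx
        have h2 := abs_le.1 (QQ_ball.1 (hxQ x hx)).2
        simp only at h2
        linarith
      · intro x hx
        have := hside x hx
        exact hHB' _ (hxQ x hx) (by simp only; linarith) (by simp only; linarith)
    · refine ⟨Or.inl ?_, reg_fwd RA g hσ hσe hside ?_ ?_ (H := H) (μ := k.toHomeomorph) (ν := νA) ?_⟩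
      · rintro _ ⟨_, ⟨x, hx, rfl⟩, rfl⟩
        have := hside x hx
        exact (hHA _ (hxQ x hx) (by simp only; linarith) (by simp only; linarith)).2
      · intro x hx
        have := hside x hx
        have h2 := abs_le.1 (QQ_ball.1 (hxQ x hx)).1
        simp only at h2
        constructor <;> linarith
      · intro x hx
        have h2 := abs_le.1 (QQ_ball.1 (hxQ x hx)).2
        simp only at h2
        linarith
      · intro x hx
        have := hside x hx
        exact hHA' _ (hxQ x hx) (by simp only; linarith) (by simp only; linarith)
  · rintro S ⟨hSW, c, J, hJ, hJ2, hSJ⟩ hSQ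
    rcases hSW with hSW | hSW
    · apply reg_bwd h RA hεAr (μ := k.toHomeomorph) (ν := νA) _ hJ hJ2 hSJ
      intro p hp
      obtain ⟨q, hq, rfl⟩ := hSQ hp
      obtain ⟨h1, h2⟩ := hWA q hq (hSW hp)
      have h3 := abs_le.1 (QQ_ball.1 hq).1
      have h4 := abs_le.1 (QQ_ball.1 hq).2
      refine ⟨q, hq, rfl, ⟨by linarith, by linarith⟩, by linarith, by linarith, by linarith, by linarith, hHA' q hq h1 h2⟩
    · apply reg_bwd h RB hεr (μ := μB) (ν := Homeomorph.subRight o) _ hJ hJ2 hSJ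
      intro p hp
      obtain ⟨q, hq, rfl⟩ := hSQ hp
      obtain ⟨h1, h2⟩ := hWB q hq (hSW hp)
      have h3 := abs_le.1 (QQ_ball.1 hq).1
      have h4 := abs_le.1 (QQ_ball.1 hq).2
      refine ⟨q, hq, rfl, ⟨by linarith, by linarith⟩, by linarith, by linarith, by linarith, by linarith, hHB' q hq h1 h2⟩

lemma inv_cont {Q : Set (ℝ × ℝ)} {H : ℝ × ℝ → ℝ × ℝ} (hQ : IsCompact Q) (hc : ContinuousOn H Q) (hi : InjOn H Q) :
    ContinuousOn (Function.invFunOn H Q) (H '' Q) := by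
  have hl := hi.leftInvOn_invFunOn
  rw [continuousOn_iff_isClosed]
  intro C hC
  refine ⟨H '' (C ∩ Q), ((hQ.inter_left hC).image_of_continuousOn (hc.mono inter_subset_right)).isClosed, ?_⟩
  ext y
  constructor
  · rintro ⟨h1, ⟨x, hx, rfl⟩⟩
    rw [mem_preimage, hl hx] at h1
    exact ⟨⟨x, ⟨h1, hx⟩, rfl⟩, ⟨x, hx, rfl⟩⟩
  · rintro ⟨⟨x, ⟨h1, hx⟩, rfl⟩, h2⟩
    refine ⟨?_, h2⟩
    rw [mem_preimage, hl hx]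
    exact h1

structure Half (D : ℝ × ℝ → ℝ × ℝ → Prop) (Q : Set (ℝ × ℝ)) (H : ℝ × ℝ → ℝ × ℝ) : Prop where
  cpt : IsCompact Q
  nh : Q ∈ nhds (0 : ℝ × ℝ)
  cont : ContinuousOn H Q
  inj : InjOn H Q
  zero : H 0 = 0
  img : H '' Q ∈ nhds (0 : ℝ × ℝ)
  fwd : ∀ γ I, IC D γ I → MapsTo γ I Q → SegIn (H '' (γ '' I))
  bwd : ∀ S, SegIn S → S ⊆ H '' Q → ∃ γ I, IC D γ I ∧ MapsTo γ I Q ∧ H '' (γ '' I) = S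

lemma Half.closed {D : ℝ × ℝ → ℝ × ℝ → Prop} {Q : Set (ℝ × ℝ)} {H : ℝ × ℝ → ℝ × ℝ} (h : Half D Q H) :
    IsClosed (H '' (Q \ interior Q)) ∧ (0 : ℝ × ℝ) ∉ H '' (Q \ interior Q) := by
  constructor
  · exact ((h.cpt.diff isOpen_interior).image_of_continuousOn (h.cont.mono diff_subset)).isClosed
  · rintro ⟨x, hx, h0⟩
    have : x = 0 := h.inj hx.1 (mem_of_mem_nhds h.nh) (h0.trans h.zero.symm)
    rw [this] at hx
    exact hx.2 (mem_interior_iff_mem_nhds.2 h.nh)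

lemma Half.curves {D D' : ℝ × ℝ → ℝ × ℝ → Prop} {Q Q' : Set (ℝ × ℝ)} {H H' : ℝ × ℝ → ℝ × ℝ} (h : Half D Q H)
    (h' : Half D' Q' H') {B U : Set (ℝ × ℝ)} (hB : B ⊆ H' '' Q') (hU : U ⊆ Q) (hUB : MapsTo H U B)
    {γ : ℝ → ℝ × ℝ} {I : Set ℝ} (hγ : IC D γ I) (hγU : MapsTo γ I U) :
    ∃ σ J, IC D' σ J ∧ (fun p => Function.invFunOn H' Q' (H p)) '' (γ '' I) = σ '' J := by
  have h1 := h.fwd γ I hγ (hγU.mono_right hU)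
  have h2 : H '' (γ '' I) ⊆ H' '' Q' := by
    rintro _ ⟨_, ⟨t, ht, rfl⟩, rfl⟩
    exact hB (hUB (hγU ht))
  obtain ⟨σ, J, h3, h4, h5⟩ := h'.bwd _ h1 h2
  refine ⟨σ, J, h3, ?_⟩
  rw [← image_image (Function.invFunOn H' Q') H, ← h5, image_image]
  have hl := h'.inj.leftInvOn_invFunOn
  exact (LeftInvOn.mono hl h4.image_subset).image_image' (Subset.rfl) |> fun h => by
    rw [← image_image (Function.invFunOn H' Q') H']; exact h

lemma Half.maps {D' : ℝ × ℝ → ℝ × ℝ → Prop} {Q' : Set (ℝ × ℝ)} {H H' : ℝ × ℝ → ℝ × ℝ}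
    (h' : Half D' Q' H') {B : Set (ℝ × ℝ)} (hB : B ⊆ H' '' Q')
    (hB2 : ∀ p ∈ B, p ∉ H' '' (Q' \ interior Q')) {p : ℝ × ℝ} (hp : H p ∈ B) :
    Function.invFunOn H' Q' (H p) ∈ interior Q' ∩ H' ⁻¹' B ∧ H' (Function.invFunOn H' Q' (H p)) = H p := by
  have h1 := Function.invFunOn_mem (hB hp)
  have h2 := Function.invFunOn_eq (hB hp)
  refine ⟨⟨?_, ?_⟩, h2⟩
  · by_contra hcon
    exact hB2 _ hp ⟨_, ⟨h1, hcon⟩, h2⟩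
  · rw [mem_preimage, h2]; exact hp

theorem NF.topEquiv {ω Ω : (ℝ × ℝ) → (ℝ × ℝ) → ℝ} (h1 : NF (fun p v => v ≠ 0 ∧ ω p v = 0))
    (h2 : NF (fun p v => v ≠ 0 ∧ Ω p v = 0)) : TopEquivAt0 ω Ω := by
  obtain ⟨Q, H, -, e1, e2, e3, e4, e5, e6, e7, e8⟩ := h1 univ univ_mem
  obtain ⟨Q', H', -, f1, f2, f3, f4, f5, f6, f7, f8⟩ := h2 univ univ_mem
  have hh : Half (fun p v => v ≠ 0 ∧ ω p v = 0) Q H := ⟨e1, e2, e3, e4, e5, e6, e7, e8⟩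
  have hh' : Half (fun p v => v ≠ 0 ∧ Ω p v = 0) Q' H' := ⟨f1, f2, f3, f4, f5, f6, f7, f8⟩
  set B := (interior (H '' Q) ∩ interior (H' '' Q')) ∩ ((H '' (Q \ interior Q))ᶜ ∩ (H' '' (Q' \ interior Q'))ᶜ) with hBdef
  have hBo : IsOpen B := (isOpen_interior.inter isOpen_interior).inter (hh.closed.1.isOpen_compl.inter hh'.closed.1.isOpen_compl)
  have hB0 : (0 : ℝ × ℝ) ∈ B := ⟨⟨mem_interior_iff_mem_nhds.2 e6, mem_interior_iff_mem_nhds.2 f6⟩, hh.closed.2, hh'.closed.2⟩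
  have hBQ : B ⊆ H '' Q := fun p hp => interior_subset hp.1.1
  have hBQ' : B ⊆ H' '' Q' := fun p hp => interior_subset hp.1.2
  have hBn : ∀ p ∈ B, p ∉ H '' (Q \ interior Q) := fun p hp => hp.2.1
  have hBn' : ∀ p ∈ B, p ∉ H' '' (Q' \ interior Q') := fun p hp => hp.2.2
  have hl := e4.leftInvOn_invFunOn
  have hl' := f4.leftInvOn_invFunOn
  set g := Function.invFunOn H Q
  set g' := Function.invFunOn H' Q'
  have z : (0 : ℝ × ℝ) ∈ interior Q := mem_interior_iff_mem_nhds.2 e2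
  have z' : (0 : ℝ × ℝ) ∈ interior Q' := mem_interior_iff_mem_nhds.2 f2
  have hinv : InvOn (fun p => g (H' p)) (fun p => g' (H p)) (interior Q ∩ H ⁻¹' B) (interior Q' ∩ H' ⁻¹' B) := by
    constructor
    · intro p hp
      simp only
      rw [(hh'.maps hBQ' hBn' hp.2).2]
      exact hl (interior_subset hp.1)
    · intro p hp
      simp only
      rw [(hh.maps hBQ hBn hp.2).2]
      exact hl' (interior_subset hp.1)
  refine ⟨interior Q ∩ H ⁻¹' B, interior Q' ∩ H' ⁻¹' B, fun p => g' (H p), fun p => g (H' p),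
    (e3.mono interior_subset).isOpen_inter_preimage isOpen_interior hBo,
    (f3.mono interior_subset).isOpen_inter_preimage isOpen_interior hBo,
    ⟨z, by rw [mem_preimage, e5]; exact hB0⟩, ⟨z', by rw [mem_preimage, f5]; exact hB0⟩, ?_, ?_, ?_, ?_, hinv, ?_, ?_⟩
  · simp only
    rw [e5]
    have := hl' (interior_subset z')
    rwa [f5] at this
  · exact (inv_cont f1 f3 f4).comp (e3.mono (inter_subset_left.trans interior_subset)) (fun p hp => hBQ' hp.2)
  · exact (inv_cont e1 e3 e4).comp (f3.mono (inter_subset_left.trans interior_subset)) (fun p hp => hBQ hp.2)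
  · exact hinv.bijOn (fun p hp => (hh'.maps hBQ' hBn' hp.2).1) (fun p hp => (hh.maps hBQ hBn hp.2).1)
  · intro γ I hγ hm
    exact hh.curves hh' hBQ' (inter_subset_left.trans interior_subset) (fun p hp => hp.2) hγ hm
  · intro γ I hγ hm
    exact hh'.curves hh hBQ (inter_subset_left.trans interior_subset) (fun p hp => hp.2) hγ hm

lemma IC.map {D D' : ℝ × ℝ → ℝ × ℝ → Prop} {γ : ℝ → ℝ × ℝ} {I : Set ℝ} {M : Set (ℝ × ℝ)}
    {Ψ : ℝ × ℝ → ℝ × ℝ} {Ψ' : ℝ × ℝ → ((ℝ × ℝ) →L[ℝ] (ℝ × ℝ))} (hγ : IC D γ I) (hM : MapsTo γ I M)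
    (h1 : ∀ p ∈ M, HasFDerivAt Ψ (Ψ' p) p) (h2 : ContinuousOn Ψ' M)
    (h3 : ∀ p ∈ M, ∀ v, D p v → D' (Ψ p) (Ψ' p v)) : IC D' (fun t => Ψ (γ t)) I := by
  obtain ⟨hI, dγ, hc, hd⟩ := hγ
  have hγc : ContinuousOn γ I := fun t ht => (hd t ht).1.continuousAt.continuousWithinAt
  refine ⟨hI, fun t => Ψ' (γ t) (dγ t), (h2.comp hγc hM).clm_apply hc, fun t ht => ⟨?_, ?_⟩⟩
  · exact (h1 _ (hM ht)).comp_hasDerivAt t (hd t ht).1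
  · exact h3 _ (hM ht) _ (hd t ht).2

theorem NF.transfer {D D' : ℝ × ℝ → ℝ × ℝ → Prop} (h : NF D') (Ψ : OpenPartialHomeomorph (ℝ × ℝ) (ℝ × ℝ))
    {Ψ' Θ' : ℝ × ℝ → ((ℝ × ℝ) →L[ℝ] (ℝ × ℝ))} (h0 : (0 : ℝ × ℝ) ∈ Ψ.source) (hz : Ψ 0 = 0)
    (h1 : ∀ p ∈ Ψ.source, HasFDerivAt Ψ (Ψ' p) p) (h2 : ContinuousOn Ψ' Ψ.source)
    (h3 : ∀ p ∈ Ψ.source, ∀ v, D p v → D' (Ψ p) (Ψ' p v))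
    (k1 : ∀ p ∈ Ψ.target, HasFDerivAt Ψ.symm (Θ' p) p) (k2 : ContinuousOn Θ' Ψ.target)
    (k3 : ∀ p ∈ Ψ.target, ∀ v, D' p v → D (Ψ.symm p) (Θ' p v)) : NF D := by
  intro N hN
  have ht0 : (0 : ℝ × ℝ) ∈ Ψ.target := hz ▸ Ψ.map_source h0
  have hs0 : Ψ.symm 0 = 0 := by rw [← hz, Ψ.left_inv h0, hz]
  have hN' : Ψ.target ∩ Ψ.symm ⁻¹' N ∈ nhds (0 : ℝ × ℝ) := by
    apply inter_mem (Ψ.open_target.mem_nhds ht0)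
    apply (Ψ.continuousAt_symm ht0).preimage_mem_nhds
    rw [hs0]; exact hN
  obtain ⟨Q', H', e0, e1, e2, e3, e4, e5, e6, e7, e8⟩ := h _ hN'
  have hQt : Q' ⊆ Ψ.target := fun p hp => (e0 hp).1
  have hQ : Ψ.symm '' Q' ⊆ Ψ.source := by
    rintro _ ⟨p, hp, rfl⟩
    exact Ψ.map_target (hQt hp)
  have hm : MapsTo Ψ (Ψ.symm '' Q') Q' := by
    rintro _ ⟨p, hp, rfl⟩
    rw [Ψ.right_inv (hQt hp)]; exact hp
  have himg : Ψ '' (Ψ.symm '' Q') = Q' := by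
    rw [image_image]
    ext p
    constructor
    · rintro ⟨q, hq, rfl⟩
      simp only
      rw [Ψ.right_inv (hQt hq)]; exact hq
    · intro hp
      exact ⟨p, hp, Ψ.right_inv (hQt hp)⟩
  refine ⟨Ψ.symm '' Q', fun p => H' (Ψ p), ?_, ?_, ?_, ?_, ?_, ?_, ?_, ?_, ?_⟩
  · rintro _ ⟨p, hp, rfl⟩
    exact (e0 hp).2
  · exact e1.image_of_continuousOn (Ψ.continuousOn_symm.mono hQt)
  · have : Ψ.source ∩ Ψ ⁻¹' Q' ∈ nhds (0 : ℝ × ℝ) := by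
      apply inter_mem (Ψ.open_source.mem_nhds h0)
      apply (Ψ.continuousAt h0).preimage_mem_nhds
      rw [hz]; exact e2
    refine mem_of_superset this ?_
    rintro p ⟨hp1, hp2⟩
    exact ⟨Ψ p, hp2, Ψ.left_inv hp1⟩
  · exact e3.comp (Ψ.continuousOn.mono hQ) hm
  · intro p hp q hq hpq
    exact Ψ.injOn (hQ hp) (hQ hq) (e4 (hm hp) (hm hq) hpq)
  · simp only [hz, e5]
  · rw [← image_image H' Ψ, himg]; exact e6
  · intro γ I hγ hγQ
    have h4 := hγ.map (hγQ.mono_right hQ) h1 h2 h3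
    have h5 := e7 _ _ h4 (fun t ht => hm (hγQ ht))
    rw [image_image] at h5 ⊢
    exact h5
  · intro S hS hSQ
    rw [← image_image H' Ψ, himg] at hSQ
    obtain ⟨σ, I, h4, h5, h6⟩ := e8 S hS hSQ
    refine ⟨fun t => Ψ.symm (σ t), I, h4.map (fun t ht => hQt (h5 ht)) k1 k2 k3, fun t ht => ⟨σ t, h5 ht, rfl⟩, ?_⟩
    rw [← h6, image_image, image_image]
    apply image_congr
    intro t ht
    simp only [Ψ.right_inv (hQt (h5 ht))]

structure RedData (a b c D E F : ℝ × ℝ → ℝ) (τ : ℝ) : Prop where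
  ca : ContDiffAt ℝ 2 a 0
  cb : ContDiffAt ℝ 2 b 0
  cD : ContDiffAt ℝ 2 D 0
  cE : ContDiffAt ℝ 2 E 0
  cF : ContDiffAt ℝ 2 F 0
  ha : 0 < a 0
  hb : b 0 = 0
  hb' : fderiv ℝ b 0 (1, 0) = 0
  hτ : τ = 1 ∨ τ = -1
  hD : 0 < τ * D 0
  hE : E 0 = 0
  hEx : 0 < τ * fderiv ℝ E 0 (1, 0)
  disc : ∀ᶠ p in nhds (0 : ℝ × ℝ), b p ^ 2 - a p * c p = -(D p * ((p.1 + F p * p.2) * (p.2 + E p * p.1)))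

def mmF (a b D : ℝ × ℝ → ℝ) (τ : ℝ) (u : (ℝ × ℝ) × ℝ) : ℝ := (-b u.1 + τ * √(τ * D u.1) * u.2) / a u.1

def numF (a b D E : ℝ × ℝ → ℝ) (τ : ℝ) (u : (ℝ × ℝ) × ℝ) : ℝ :=
  τ * (mmF a b D τ u + E u.1 + u.1.1 * fderiv ℝ E u.1 (1, mmF a b D τ u))

def denF (a b D F : ℝ × ℝ → ℝ) (τ : ℝ) (u : (ℝ × ℝ) × ℝ) : ℝ :=
  1 + F u.1 * mmF a b D τ u + u.1.2 * fderiv ℝ F u.1 (1, mmF a b D τ u)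

def PsiF (E F : ℝ × ℝ → ℝ) (τ : ℝ) (p : ℝ × ℝ) : ℝ × ℝ := (p.1 + F p * p.2, τ * (p.2 + E p * p.1))

lemma line_comp {f : ℝ × ℝ → ℝ} {f' : ℝ × ℝ →L[ℝ] ℝ} (h : HasFDerivAt f f' 0) :
    HasDerivAt (fun t : ℝ => f (t, 0)) (f' (1, 0)) 0 := by
  have hline : HasDerivAt (fun t : ℝ => ((t, 0) : ℝ × ℝ)) (1, 0) 0 := (hasDerivAt_id (0:ℝ)).prodMk (hasDerivAt_const _ _)
  exact HasFDerivAt.comp_hasDerivAt_of_eq (0:ℝ) h hline rfl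

section
variable {a b c D E F : ℝ × ℝ → ℝ} {τ : ℝ}

lemma RedData.cmm (h : RedData a b c D E F τ) : ContDiffAt ℝ 1 (mmF a b D τ) 0 := by
  have l1 : ∀ f : ℝ × ℝ → ℝ, ContDiffAt ℝ 2 f 0 → ContDiffAt ℝ 1 (fun u : (ℝ × ℝ) × ℝ => f u.1) 0 := by
    intro f hf
    have : ContDiffAt ℝ 1 f (0 : (ℝ × ℝ) × ℝ).1 := hf.of_le (by norm_num)
    exact this.comp (0 : (ℝ × ℝ) × ℝ) contDiffAt_fst
  unfold mmF
  have hs : ContDiffAt ℝ 1 (fun u : (ℝ × ℝ) × ℝ => √(τ * D u.1)) 0 :=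
    (contDiffAt_const.mul (l1 D h.cD)).sqrt h.hD.ne'
  exact ((l1 b h.cb).neg.add ((contDiffAt_const.mul hs).mul contDiffAt_snd)).div (l1 a h.ca) h.ha.ne'

lemma fst_comp {f : ℝ × ℝ → ℝ} (hf : ContDiffAt ℝ 2 f 0) : ContDiffAt ℝ 1 (fun u : (ℝ × ℝ) × ℝ => f u.1) 0 := by
  have : ContDiffAt ℝ 1 f (0 : (ℝ × ℝ) × ℝ).1 := hf.of_le (by norm_num)
  exact this.comp (0 : (ℝ × ℝ) × ℝ) contDiffAt_fst

lemma fder_comp {f : ℝ × ℝ → ℝ} (hf : ContDiffAt ℝ 2 f 0) {m : (ℝ × ℝ) × ℝ → ℝ} (hm : ContDiffAt ℝ 1 m 0) :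
    ContDiffAt ℝ 1 (fun u : (ℝ × ℝ) × ℝ => fderiv ℝ f u.1 (1, m u)) 0 := by
  have : ContDiffAt ℝ 1 (fderiv ℝ f) (0 : (ℝ × ℝ) × ℝ).1 := hf.fderiv_right (by norm_num)
  exact (this.comp (0 : (ℝ × ℝ) × ℝ) contDiffAt_fst).clm_apply (contDiffAt_const.prodMk hm)

lemma RedData.cnum (h : RedData a b c D E F τ) : ContDiffAt ℝ 1 (numF a b D E τ) 0 := by
  unfold numF
  exact contDiffAt_const.mul ((h.cmm.add (fst_comp h.cE)).add ((contDiffAt_fst.comp _ contDiffAt_fst).mul (fder_comp h.cE h.cmm)))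

lemma RedData.cden (h : RedData a b c D E F τ) : ContDiffAt ℝ 1 (denF a b D F τ) 0 := by
  unfold denF
  exact (contDiffAt_const.add ((fst_comp h.cF).mul h.cmm)).add ((contDiffAt_snd.comp _ contDiffAt_fst).mul (fder_comp h.cF h.cmm))

lemma RedData.mm0 (h : RedData a b c D E F τ) : mmF a b D τ 0 = 0 := by
  simp [mmF, h.hb]

lemma RedData.num0 (h : RedData a b c D E F τ) : numF a b D E τ 0 = 0 := by
  simp [numF, h.mm0, h.hE]

lemma RedData.den0 (h : RedData a b c D E F τ) : denF a b D F τ 0 = 1 := by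
  simp [denF, h.mm0]

lemma RedData.cG (h : RedData a b c D E F τ) : ContDiffAt ℝ 1 (fun u => numF a b D E τ u / denF a b D F τ u) 0 :=
  h.cnum.div h.cden (by rw [h.den0]; norm_num)

lemma RedData.G_der (h : RedData a b c D E F τ) (v : (ℝ × ℝ) × ℝ) {n' : ℝ}
    (hn : HasDerivAt (fun t : ℝ => numF a b D E τ (t • v)) n' 0) :
    fderiv ℝ (fun u => numF a b D E τ u / denF a b D F τ u) 0 v = n' := by
  have hline : HasDerivAt (fun t : ℝ => t • v) v 0 := by
    simpa using (hasDerivAt_id (0:ℝ)).smul_const v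
  have hG := (h.cG.differentiableAt (by norm_num)).hasFDerivAt
  have h1 : HasDerivAt (fun t : ℝ => numF a b D E τ (t • v) / denF a b D F τ (t • v))
      (fderiv ℝ (fun u => numF a b D E τ u / denF a b D F τ u) 0 v) 0 := by
    have hG' : HasFDerivAt (fun u => numF a b D E τ u / denF a b D F τ u)
      (fderiv ℝ (fun u => numF a b D E τ u / denF a b D F τ u) 0) ((0:ℝ) • v) := by rw [zero_smul]; exact hG
    exact hG'.comp_hasDerivAt (0:ℝ) hline
  have hd : DifferentiableAt ℝ (fun t : ℝ => denF a b D F τ (t • v)) 0 := by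
    have hd' : DifferentiableAt ℝ (denF a b D F τ) ((0:ℝ) • v) := by
      rw [zero_smul]; exact h.cden.differentiableAt (by norm_num)
    exact hd'.comp (0:ℝ) hline.differentiableAt
  have h2 := hn.div hd.hasDerivAt (by simp [h.den0])
  have h3 := h1.unique h2
  rw [h3]
  simp [h.den0, h.num0]

lemma RedData.mm_der1 (h : RedData a b c D E F τ) :
    HasDerivAt (fun t : ℝ => mmF a b D τ (t • ((1, 0), 0))) 0 0 := by
  have hline : HasDerivAt (fun t : ℝ => ((t, 0) : ℝ × ℝ)) (1, 0) 0 := (hasDerivAt_id (0:ℝ)).prodMk (hasDerivAt_const _ _)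
  have hb : HasDerivAt (fun t : ℝ => b (t, 0)) 0 0 := by
    have h1 : HasFDerivAt b (fderiv ℝ b 0) 0 := (h.cb.differentiableAt (by norm_num)).hasFDerivAt
    have := line_comp h1
    rwa [h.hb'] at this
  have ha : HasDerivAt (fun t : ℝ => a (t, 0)) (fderiv ℝ a 0 (1, 0)) 0 := by
    have h1 : HasFDerivAt a (fderiv ℝ a 0) 0 := (h.ca.differentiableAt (by norm_num)).hasFDerivAt
    exact line_comp h1
  have hb0 : b ((0:ℝ), (0:ℝ)) = 0 := h.hb
  have ha0 : a ((0:ℝ), (0:ℝ)) ≠ 0 := h.ha.ne'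
  have := hb.neg.div ha ha0
  simp only [Pi.neg_apply, hb0] at this
  refine (this.congr_deriv (by simp)).congr_of_eventuallyEq (Eventually.of_forall fun t => ?_)
  simp [mmF]

lemma RedData.K1 (h : RedData a b c D E F τ) :
    fderiv ℝ (fun u => numF a b D E τ u / denF a b D F τ u) 0 ((1, 0), 0) = 2 * (τ * fderiv ℝ E 0 (1, 0)) := by
  apply h.G_der
  have hline : HasDerivAt (fun t : ℝ => ((t, 0) : ℝ × ℝ)) (1, 0) 0 := (hasDerivAt_id (0:ℝ)).prodMk (hasDerivAt_const _ _)
  have hE : HasDerivAt (fun t : ℝ => E (t, 0)) (fderiv ℝ E 0 (1, 0)) 0 := by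
    have h1 : HasFDerivAt E (fderiv ℝ E 0) 0 := (h.cE.differentiableAt (by norm_num)).hasFDerivAt
    exact line_comp h1
  have hlin3 : HasDerivAt (fun t : ℝ => t • (((1, 0), 0) : (ℝ × ℝ) × ℝ)) ((1, 0), 0) 0 := by
    simpa using (hasDerivAt_id (0:ℝ)).smul_const (((1, 0), 0) : (ℝ × ℝ) × ℝ)
  have hh : DifferentiableAt ℝ (fun t : ℝ => fderiv ℝ E (t, 0) (1, mmF a b D τ (t • ((1, 0), 0)))) 0 := by
    have h1 : DifferentiableAt ℝ (fun u : (ℝ × ℝ) × ℝ => fderiv ℝ E u.1 (1, mmF a b D τ u)) ((0:ℝ) • (((1, 0), 0) : (ℝ × ℝ) × ℝ)) := by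
      rw [zero_smul]; exact (fder_comp h.cE h.cmm).differentiableAt (by norm_num)
    have h2 := h1.comp (0:ℝ) hlin3.differentiableAt
    refine h2.congr_of_eventuallyEq (Eventually.of_forall fun t => ?_)
    simp
  have h4 := (((h.mm_der1.add hE).add ((hasDerivAt_id (0:ℝ)).mul hh.hasDerivAt)).const_mul τ)
  refine (h4.congr_deriv ?_).congr_of_eventuallyEq (Eventually.of_forall fun t => ?_)
  · simp [h.mm0]
    have : ((0:ℝ), (0:ℝ)) = (0 : ℝ × ℝ) := rfl
    rw [this]
    ring
  · simp [numF]

lemma RedData.K3 (h : RedData a b c D E F τ) :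
    fderiv ℝ (fun u => numF a b D E τ u / denF a b D F τ u) 0 ((0, 0), 1) = √(τ * D 0) / a 0 := by
  apply h.G_der
  have hττ : τ * τ = 1 := by rcases h.hτ with h | h <;> rw [h] <;> norm_num
  have h4 := (hasDerivAt_id (0:ℝ)).const_mul (√(τ * D 0) / a 0)
  refine (h4.congr_deriv (by simp)).congr_of_eventuallyEq (Eventually.of_forall fun t => ?_)
  have h0 : ((0:ℝ), (0:ℝ)) = (0 : ℝ × ℝ) := rfl
  simp only [numF, mmF, Prod.smul_mk, smul_zero, smul_eq_mul, mul_one, h0, h.hb, h.hE, Prod.fst_zero, zero_mul, add_zero, neg_zero, zero_add, id]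
  have e1 : τ * (τ * √(τ * D 0) * t / a 0) = (τ * τ) * (√(τ * D 0) / a 0 * t) := by ring
  rw [e1, hττ, one_mul]

end

lemma psi_hasFDeriv {E F : ℝ × ℝ → ℝ} {τ : ℝ} {p : ℝ × ℝ} (hE : DifferentiableAt ℝ E p) (hF : DifferentiableAt ℝ F p) :
    DifferentiableAt ℝ (PsiF E F τ) p ∧ ∀ v, fderiv ℝ (PsiF E F τ) p v =
      (v.1 + F p * v.2 + p.2 * fderiv ℝ F p v, τ * (v.2 + E p * v.1 + p.1 * fderiv ℝ E p v)) := by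
  have h1 : HasFDerivAt (fun p : ℝ × ℝ => p.1) (ContinuousLinearMap.fst ℝ ℝ ℝ) p := hasFDerivAt_fst
  have h2 : HasFDerivAt (fun p : ℝ × ℝ => p.2) (ContinuousLinearMap.snd ℝ ℝ ℝ) p := hasFDerivAt_snd
  have h3 := (h1.add (hF.hasFDerivAt.mul h2)).prodMk ((h2.add (hE.hasFDerivAt.mul h1)).const_mul τ)
  have h4 : HasFDerivAt (PsiF E F τ) _ p := h3
  refine ⟨h4.differentiableAt, fun v => ?_⟩
  rw [h4.fderiv]
  simp
  constructor <;> ring_nf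

section
variable {a b c D E F : ℝ × ℝ → ℝ} {τ : ℝ}

lemma RedData.cPsi (h : RedData a b c D E F τ) : ContDiffAt ℝ 2 (PsiF E F τ) 0 := by
  unfold PsiF
  exact (contDiffAt_fst.add (h.cF.mul contDiffAt_snd)).prodMk
    (contDiffAt_const.mul (contDiffAt_snd.add (h.cE.mul contDiffAt_fst)))

structure GoodP (a b c D E F : ℝ × ℝ → ℝ) (τ : ℝ) (p : ℝ × ℝ) : Prop where
  c2 : ContDiffAt ℝ 2 (PsiF E F τ) p
  dE : DifferentiableAt ℝ E p
  dF : DifferentiableAt ℝ F p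
  ha : 0 < a p
  hD : 0 < τ * D p
  disc : b p ^ 2 - a p * c p = -(D p * ((p.1 + F p * p.2) * (p.2 + E p * p.1)))
  den : ∀ ρ : ℝ, ρ ^ 2 = -((PsiF E F τ p).1 * (PsiF E F τ p).2) → denF a b D F τ (p, ρ) ≠ 0

lemma RedData.good (h : RedData a b c D E F τ) : ∀ᶠ p in nhds (0 : ℝ × ℝ), GoodP a b c D E F τ p := by
  have e1 := h.cPsi.eventually (by decide)
  have e2 := (h.cE.eventually (by decide)).mono fun p hp => hp.differentiableAt (by norm_num)
  have e3 := (h.cF.eventually (by decide)).mono fun p hp => hp.differentiableAt (by norm_num)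
  have e4 := h.ca.continuousAt.eventually (lt_mem_nhds h.ha)
  have e5 : ∀ᶠ p in nhds (0 : ℝ × ℝ), 0 < τ * D p := (continuousAt_const.mul h.cD.continuousAt).eventually (lt_mem_nhds h.hD)
  have e6 : ∀ᶠ p in nhds (0 : ℝ × ℝ), ∀ ρ : ℝ, ρ ^ 2 = -((PsiF E F τ p).1 * (PsiF E F τ p).2) → denF a b D F τ (p, ρ) ≠ 0 := by
    have hd : ∀ᶠ u in nhds (0 : (ℝ × ℝ) × ℝ), denF a b D F τ u ≠ 0 :=
      h.cden.continuousAt.eventually_ne (by rw [h.den0]; norm_num)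
    have hd' : ∀ᶠ u in nhds (0 : ℝ × ℝ) ×ˢ nhds (0:ℝ), denF a b D F τ u ≠ 0 := by
      rw [← nhds_prod_eq]; exact hd
    obtain ⟨pa, hpa, pb, hpb, hab⟩ := eventually_prod_iff.1 hd'
    obtain ⟨ε, hε, hb⟩ := Metric.eventually_nhds_iff.1 hpb
    have hX : ContinuousAt (fun p => |(PsiF E F τ p).1 * (PsiF E F τ p).2|) 0 := by
      have := h.cPsi.continuousAt
      exact (this.fst.mul this.snd).abs
    have hX2 : ∀ᶠ p in nhds (0 : ℝ × ℝ), |(PsiF E F τ p).1 * (PsiF E F τ p).2| < ε ^ 2 := by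
      apply hX.eventually (gt_mem_nhds _)
      simp [PsiF]; positivity
    filter_upwards [hpa, hX2] with p h1 h2 ρ hρ
    apply hab h1
    apply hb
    rw [Real.dist_eq, sub_zero]
    have : ρ ^ 2 < ε ^ 2 := by rw [hρ]; exact lt_of_le_of_lt (neg_le_abs _) h2
    exact abs_lt_of_sq_lt_sq this hε.le
  filter_upwards [e1, e2, e3, e4, e5, e6, h.disc] with p h1 h2 h3 h4 h5 h6 h7
  exact ⟨h1, h2, h3, h4, h5, h7, h6⟩

lemma RedData.chart (h : RedData a b c D E F τ) : ∃ Φ : OpenPartialHomeomorph (ℝ × ℝ) (ℝ × ℝ),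
    (Φ : ℝ × ℝ → ℝ × ℝ) = PsiF E F τ ∧ (0 : ℝ × ℝ) ∈ Φ.source ∧ (∀ p ∈ Φ.source, GoodP a b c D E F τ p) ∧
    ∀ w ∈ Φ.target, ContDiffAt ℝ 2 Φ.symm w := by
  have hττ : τ * τ = 1 := by rcases h.hτ with h | h <;> rw [h] <;> norm_num
  obtain ⟨hd, hf⟩ := psi_hasFDeriv (τ := τ) (h.cE.differentiableAt (by norm_num)) (h.cF.differentiableAt (by norm_num))
  let e : (ℝ × ℝ) ≃L[ℝ] (ℝ × ℝ) := ContinuousLinearEquiv.equivOfInverse (fderiv ℝ (PsiF E F τ) 0)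
    ((ContinuousLinearMap.fst ℝ ℝ ℝ - (F 0 * τ) • ContinuousLinearMap.snd ℝ ℝ ℝ).prod (τ • ContinuousLinearMap.snd ℝ ℝ ℝ))
    (by intro v; rw [hf]; ext <;> simp [h.hE]
        · linear_combination (-(F 0) * v.2) * hττ
        · linear_combination v.2 * hττ)
    (by intro v; rw [hf]; ext <;> simp [h.hE]
        · ring
        · linear_combination v.2 * hττ)
  have he : HasFDerivAt (PsiF E F τ) (e : (ℝ × ℝ) →L[ℝ] (ℝ × ℝ)) 0 := hd.hasFDerivAt
  let Φ := h.cPsi.toOpenPartialHomeomorph (PsiF E F τ) he (by norm_num)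
  have hs : (0 : ℝ × ℝ) ∈ Φ.source := h.cPsi.mem_toOpenPartialHomeomorph_source he (by norm_num)
  have hc : ContDiffAt ℝ 2 Φ.symm (Φ 0) := h.cPsi.to_localInverse he (by norm_num)
  have hc' : ∀ᶠ p in nhds (0 : ℝ × ℝ), ContDiffAt ℝ 2 Φ.symm (Φ p) :=
    (Φ.continuousAt hs).eventually (hc.eventually (by decide))
  obtain ⟨M, hM, hMo, h0M⟩ := eventually_nhds_iff.1 (hc'.and h.good)
  refine ⟨Φ.restrOpen M hMo, rfl, ⟨hs, h0M⟩, fun p hp => (hM p hp.2).2, fun w hw => ?_⟩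
  have h1 := (Φ.restrOpen M hMo).map_target hw
  have h2 := (hM _ h1.2).1
  have h3 := (Φ.restrOpen M hMo).right_inv hw
  change ContDiffAt ℝ 2 Φ.symm (Φ.restrOpen M hMo ((Φ.restrOpen M hMo).symm w)) at h2
  rw [h3] at h2
  exact h2

lemma RedData.fwd (h : RedData a b c D E F τ) {p v : ℝ × ℝ} (g : GoodP a b c D E F τ p) (hv : v ≠ 0)
    (hω : BDE a b c p v = 0) : v.1 ≠ 0 ∧ ∃ ρ : ℝ, ρ ^ 2 = -((PsiF E F τ p).1 * (PsiF E F τ p).2) ∧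
      (fderiv ℝ (PsiF E F τ) p v).1 = v.1 * denF a b D F τ (p, ρ) ∧
      (fderiv ℝ (PsiF E F τ) p v).2 = v.1 * numF a b D E τ (p, ρ) := by
  have hττ : τ * τ = 1 := by rcases h.hτ with h | h <;> rw [h] <;> norm_num
  have ha := g.ha
  have hv1 : v.1 ≠ 0 := by
    intro h1
    apply hv
    simp [BDE, h1, ha.ne'] at hω
    exact Prod.ext h1 hω
  refine ⟨hv1, ?_⟩
  obtain ⟨m, hm⟩ : ∃ m, v.2 = v.1 * m := ⟨v.2 / v.1, by field_simp⟩
  have hv' : v = v.1 • (1, m) := by ext <;> simp [hm]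
  have hq : a p * m ^ 2 + 2 * b p * m + c p = 0 := by
    have : v.1 ^ 2 * (a p * m ^ 2 + 2 * b p * m + c p) = 0 := by
      rw [← hω]; simp only [BDE, hm]; ring
    exact (mul_eq_zero.1 this).resolve_left (pow_ne_zero _ hv1)
  have hs : √(τ * D p) ≠ 0 := (Real.sqrt_pos.2 g.hD).ne'
  have hs2 : √(τ * D p) ^ 2 = τ * D p := Real.sq_sqrt g.hD.le
  have hmm : mmF a b D τ (p, τ * (a p * m + b p) / √(τ * D p)) = m := by
    simp only [mmF]
    have : τ * √(τ * D p) * (τ * (a p * m + b p) / √(τ * D p)) = (τ * τ) * (a p * m + b p) := by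
      field_simp
    rw [this, hττ]
    field_simp
    ring
  refine ⟨τ * (a p * m + b p) / √(τ * D p), ?_, ?_, ?_⟩
  · rw [div_pow, hs2, div_eq_iff g.hD.ne']
    have h1 : (a p * m + b p) ^ 2 = b p ^ 2 - a p * c p := by linear_combination a p * hq
    rw [mul_pow, h1, g.disc]
    simp only [PsiF]
    ring
  · rw [(psi_hasFDeriv g.dE g.dF).2, denF, hmm]
    have hl : fderiv ℝ F p v = v.1 * fderiv ℝ F p (1, m) := by
      conv_lhs => rw [hv', map_smul]
      rfl
    simp only [hl, hm]
    ring
  · rw [(psi_hasFDeriv g.dE g.dF).2, numF, hmm]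
    have hl : fderiv ℝ E p v = v.1 * fderiv ℝ E p (1, m) := by
      conv_lhs => rw [hv', map_smul]
      rfl
    simp only [hl, hm]
    ring

lemma RedData.bwd (h : RedData a b c D E F τ) {p : ℝ × ℝ} (g : GoodP a b c D E F τ p) {ρ : ℝ}
    (hρ : ρ ^ 2 = -((PsiF E F τ p).1 * (PsiF E F τ p).2)) :
    (∀ s : ℝ, BDE a b c p (s • (1, mmF a b D τ (p, ρ))) = 0) ∧
      fderiv ℝ (PsiF E F τ) p (1, mmF a b D τ (p, ρ)) = (denF a b D F τ (p, ρ), numF a b D E τ (p, ρ)) := by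
  have hττ : τ * τ = 1 := by rcases h.hτ with h | h <;> rw [h] <;> norm_num
  have ha := g.ha
  have hs2 : √(τ * D p) ^ 2 = τ * D p := Real.sq_sqrt g.hD.le
  set m := mmF a b D τ (p, ρ) with hm
  have h1 : a p * m + b p = τ * √(τ * D p) * ρ := by
    rw [hm]; simp only [mmF]; field_simp; ring
  have h2 : a p * (a p * m ^ 2 + 2 * b p * m + c p) = 0 := by
    have h3 : (a p * m + b p) ^ 2 = b p ^ 2 - a p * c p := by
      rw [h1, mul_pow, mul_pow, hs2, hρ, g.disc]
      simp only [PsiF]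
      linear_combination (-(D p * ((p.1 + F p * p.2) * (p.2 + E p * p.1))) * (τ * τ + 1)) * hττ
    linear_combination h3
  have h3 := (mul_eq_zero.1 h2).resolve_left ha.ne'
  refine ⟨fun s => ?_, ?_⟩
  · simp only [BDE, Prod.smul_mk, smul_eq_mul]
    linear_combination s ^ 2 * h3
  · rw [(psi_hasFDeriv g.dE g.dF).2]
    simp only [denF, numF, ← hm]
    ext <;> simp

theorem RedData.nf (h : RedData a b c D E F τ) : NF (fun p v => v ≠ 0 ∧ BDE a b c p v = 0) := by
  obtain ⟨Φ, hΦ, h0, hg, hsym⟩ := h.chart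
  have hz : Φ 0 = 0 := by rw [hΦ]; simp [PsiF]
  have ht0 : (0 : ℝ × ℝ) ∈ Φ.target := hz ▸ Φ.map_source h0
  have hs0 : Φ.symm 0 = 0 := by rw [← hz, Φ.left_inv h0, hz]
  have hinv : ∀ p ∈ Φ.source, ∀ v, fderiv ℝ Φ.symm (Φ p) (fderiv ℝ (PsiF E F τ) p v) = v := by
    intro p hp v
    have h1 : HasFDerivAt Φ.symm (fderiv ℝ Φ.symm (Φ p)) (Φ p) := ((hsym _ (Φ.map_source hp)).differentiableAt (by norm_num)).hasFDerivAt
    have h2 : HasFDerivAt Φ (fderiv ℝ (PsiF E F τ) p) p := by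
      rw [hΦ]; exact ((hg p hp).c2.differentiableAt (by norm_num)).hasFDerivAt
    have h3 := h1.comp p h2
    have h4 : HasFDerivAt (Φ.symm ∘ Φ) (ContinuousLinearMap.id ℝ (ℝ × ℝ)) p :=
      (hasFDerivAt_id p).congr_of_eventuallyEq (by
        filter_upwards [Φ.open_source.mem_nhds hp] with z hz
        exact Φ.left_inv hz)
    have := congrArg (fun L => L v) (h3.unique h4)
    simpa using this
  let 𝒢 : (ℝ × ℝ) × ℝ → ℝ := fun u => numF a b D E τ u / denF a b D F τ u
  let G : ℝ → ℝ → ℝ → ℝ := fun x q ρ => 𝒢 (Φ.symm (x, q), ρ)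
  -- core
  have hT1 : ContDiffAt ℝ 2 (fun u : (ℝ × ℝ) × ℝ => (Φ.symm u.1, u.2)) 0 := by
    have : ContDiffAt ℝ 2 Φ.symm (0 : (ℝ × ℝ) × ℝ).1 := hsym 0 ht0
    exact (this.comp (0 : (ℝ × ℝ) × ℝ) contDiffAt_fst).prodMk contDiffAt_snd
  have hT1z : (fun u : (ℝ × ℝ) × ℝ => (Φ.symm u.1, u.2)) 0 = 0 := by simp [hs0]
  have hT : ContDiffAt ℝ 1 (fun u : (ℝ × ℝ) × ℝ => 𝒢 (Φ.symm u.1, u.2)) 0 :=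
    ContDiffAt.comp (g := 𝒢) (0 : (ℝ × ℝ) × ℝ) (by
      show ContDiffAt ℝ 1 𝒢 ((fun u : (ℝ × ℝ) × ℝ => (Φ.symm u.1, u.2)) 0)
      rw [hT1z]; exact h.cG) (hT1.of_le (by norm_num))
  have hst := hT.hasStrictFDerivAt (by norm_num)
  set L := fderiv ℝ (fun u : (ℝ × ℝ) × ℝ => 𝒢 (Φ.symm u.1, u.2)) 0 with hL
  have hLv : ∀ v : ℝ × ℝ, ∀ s : ℝ, L (v, s) = fderiv ℝ 𝒢 0 (fderiv ℝ Φ.symm 0 v, s) := by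
    intro v s
    have h1 : HasFDerivAt Φ.symm (fderiv ℝ Φ.symm 0) (0 : (ℝ × ℝ) × ℝ).1 := ((hsym _ ht0).differentiableAt (by norm_num)).hasFDerivAt
    have h2 := (h1.comp (0 : (ℝ × ℝ) × ℝ) hasFDerivAt_fst).prodMk (hasFDerivAt_snd (𝕜 := ℝ) (p := (0 : (ℝ × ℝ) × ℝ)))
    have h3 : HasFDerivAt 𝒢 (fderiv ℝ 𝒢 0) ((Φ.symm (0 : (ℝ × ℝ) × ℝ).1, (0 : (ℝ × ℝ) × ℝ).2)) := by
      have : ((Φ.symm (0 : (ℝ × ℝ) × ℝ).1, (0 : (ℝ × ℝ) × ℝ).2)) = 0 := hT1z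
      rw [this]
      exact (h.cG.differentiableAt (by norm_num)).hasFDerivAt
    have h4 := HasFDerivAt.comp (g := 𝒢) (0 : (ℝ × ℝ) × ℝ) h3 h2
    have h5 := h4.fderiv
    rw [hL]
    have : (fun u : (ℝ × ℝ) × ℝ => 𝒢 (Φ.symm u.1, u.2)) = (𝒢 ∘ fun x : (ℝ × ℝ) × ℝ => ((Φ.symm ∘ Prod.fst) x, x.2)) := rfl
    rw [this, h5]
    simp
  have hΘ10 : fderiv ℝ Φ.symm 0 (1, 0) = (1, 0) := by
    have := hinv 0 h0 (1, 0)
    rw [hz, (psi_hasFDeriv (hg 0 h0).dE (hg 0 h0).dF).2] at this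
    simpa [h.hE] using this
  have l1 : L ((1, 0), 0) = 2 * (τ * fderiv ℝ E 0 (1, 0)) := by rw [hLv, hΘ10]; exact h.K1
  have l3 : L ((0, 0), 1) = √(τ * D 0) / a 0 := by
    rw [hLv]
    have : ((0:ℝ), (0:ℝ)) = (0 : ℝ × ℝ) := rfl
    rw [this, map_zero]; exact h.K3
  have l1p : 0 < L ((1, 0), 0) := by rw [l1]; have := h.hEx; positivity
  have l3p : 0 < L ((0, 0), 1) := by rw [l3]; have := h.ha; have := Real.sqrt_pos.2 h.hD; positivity
  have hLg : ∀ x q ρ : ℝ, L ((x, q), ρ) = L ((1, 0), 0) * x + L ((0, 1), 0) * q + L ((0, 0), 1) * ρ := by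
    intro x q ρ
    have : (((x, q), ρ) : (ℝ × ℝ) × ℝ) = x • ((1, 0), 0) + q • ((0, 1), 0) + ρ • ((0, 0), 1) := by
      ext <;> simp
    rw [this]
    simp only [map_add, map_smul, smul_eq_mul]
    ring
  set η := min (L ((1, 0), 0)) (L ((0, 0), 1)) / 4 with hη
  have hηp : 0 < η := by have := lt_min l1p l3p; positivity
  have hb := hst.isLittleO.def hηp
  rw [Metric.eventually_nhds_iff] at hb
  obtain ⟨ε, hε, hb⟩ := hb
  have hcore : CoreG G (L ((1, 0), 0)) (L ((0, 1), 0)) (L ((0, 0), 1)) η (ε / 2) := by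
    refine ⟨l1p, l3p, hηp, ?_, ?_, by positivity, ?_, ?_⟩
    · have := min_le_left (L ((1, 0), 0)) (L ((0, 0), 1)); linarith
    · have := min_le_right (L ((1, 0), 0)) (L ((0, 0), 1)); linarith
    · have : ((0:ℝ), (0:ℝ)) = (0 : ℝ × ℝ) := rfl
      have h' : ((0 : ℝ × ℝ), (0:ℝ)) = (0 : (ℝ × ℝ) × ℝ) := rfl
      simp only [G, 𝒢]
      rw [this, hs0, h', h.num0, zero_div]
    · intro x q ρ x' q' ρ' h1 h2 h3 h4 h5 h6
      have := @hb (((x, q), ρ), ((x', q'), ρ')) (by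
        rw [dist_eq_norm, Prod.norm_def, Prod.norm_def, Prod.norm_def, Prod.norm_def, Prod.norm_def]
        simp only [Prod.fst_sub, Prod.snd_sub, Prod.fst_zero, Prod.snd_zero, sub_zero, Real.norm_eq_abs, max_lt_iff]
        refine ⟨⟨⟨?_, ?_⟩, ?_⟩, ⟨⟨?_, ?_⟩, ?_⟩⟩ <;> linarith)
      rw [Real.norm_eq_abs] at this
      have h7 : (((x, q), ρ) : (ℝ × ℝ) × ℝ) - ((x', q'), ρ') = ((x - x', q - q'), ρ - ρ') := rfl
      have h8 := hLg (x - x') (q - q') (ρ - ρ')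
      simp only [h7] at this
      rw [h8] at this
      refine this.trans ?_
      apply mul_le_mul_of_nonneg_left _ hηp.le
      rw [Prod.norm_def, Prod.norm_def]
      simp only [Real.norm_eq_abs]
      have := abs_nonneg (x - x'); have := abs_nonneg (q - q'); have := abs_nonneg (ρ - ρ')
      apply max_le (max_le _ _) _ <;> linarith
  refine hcore.nf.transfer Φ (Ψ' := fderiv ℝ (PsiF E F τ)) (Θ' := fderiv ℝ Φ.symm) h0 hz ?_ ?_ ?_ ?_ ?_ ?_
  · intro p hp
    rw [hΦ]; exact ((hg p hp).c2.differentiableAt (by norm_num)).hasFDerivAt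
  · intro p hp
    exact (((hg p hp).c2.fderiv_right (m := 1) (by norm_num)).continuousAt).continuousWithinAt
  · rintro p hp v ⟨hv, hω⟩
    obtain ⟨hv1, ρ, hρ, e1, e2⟩ := h.fwd (hg p hp) hv hω
    have hd := (hg p hp).den ρ hρ
    refine ⟨by rw [e1]; exact mul_ne_zero hv1 hd, ρ, by rw [hΦ]; exact hρ, ?_⟩
    rw [e1, e2]
    simp only [G, 𝒢]
    rw [show ((Φ p).1, (Φ p).2) = Φ p from rfl, Φ.left_inv hp]
    field_simp
  · intro p hp
    exact ((hsym p hp).differentiableAt (by norm_num)).hasFDerivAt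
  · intro p hp
    exact (((hsym p hp).fderiv_right (m := 1) (by norm_num)).continuousAt).continuousWithinAt
  · rintro w hw u ⟨hu1, ρ, hρ, hu2⟩
    have hp := Φ.map_target hw
    have hw' := Φ.right_inv hw
    set p := Φ.symm w with hpd
    have hρ' : ρ ^ 2 = -((PsiF E F τ p).1 * (PsiF E F τ p).2) := by rw [← hΦ, hw', hρ]
    have hd := (hg p hp).den ρ hρ'
    obtain ⟨b1, b2⟩ := h.bwd (hg p hp) hρ'
    have hu : u = (u.1 / denF a b D F τ (p, ρ)) • fderiv ℝ (PsiF E F τ) p (1, mmF a b D τ (p, ρ)) := by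
      rw [b2]
      ext
      · simp; field_simp
      · simp only [Prod.smul_mk, smul_eq_mul]
        rw [hu2]
        simp only [G, 𝒢]
        rw [show (w.1, w.2) = w from rfl, ← hpd]
        field_simp
    have h3 := hinv p hp (1, mmF a b D τ (p, ρ))
    rw [hw'] at h3
    have hΘ : fderiv ℝ Φ.symm w u = (u.1 / denF a b D F τ (p, ρ)) • (1, mmF a b D τ (p, ρ)) := by
      conv_lhs => rw [hu]
      rw [map_smul, h3]
    rw [hΘ]
    refine ⟨?_, b1 _⟩
    intro h0
    have := congrArg Prod.fst h0
    simp at this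
    rcases this with h | h
    · exact hu1 h
    · exact hd h

end

lemma exists_redData {a b c A B C : ℝ × ℝ → ℝ} (ca : ContDiffAt ℝ 2 a 0) (cb : ContDiffAt ℝ 2 b 0)
    (cA : ContDiffAt ℝ 2 A 0) (cB : ContDiffAt ℝ 2 B 0) (cC : ContDiffAt ℝ 2 C 0)
    (ha : 0 < a 0) (hb : b 0 = 0) (hb' : fderiv ℝ b 0 (1, 0) = 0) (hB : B 0 ≠ 0) (hC : C 0 = 0)
    (hCx : 0 < fderiv ℝ C 0 (1, 0))
    (hdisc : ∀ p : ℝ × ℝ, b p ^ 2 - a p * c p = -(A p * p.2 ^ 2 + 2 * B p * (p.1 * p.2) + C p * p.1 ^ 2)) :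
    NF (fun p v => v ≠ 0 ∧ BDE a b c p v = 0) := by
  obtain ⟨τ, hτ, hτB⟩ : ∃ τ : ℝ, (τ = 1 ∨ τ = -1) ∧ 0 < τ * B 0 := by
    rcases lt_or_gt_of_ne hB with h | h
    · exact ⟨-1, Or.inr rfl, by linarith⟩
    · exact ⟨1, Or.inl rfl, by linarith⟩
  have hττ : τ * τ = 1 := by rcases hτ with h | h <;> rw [h] <;> norm_num
  let D : ℝ × ℝ → ℝ := fun p => B p * (1 + √(1 - A p * C p / B p ^ 2))
  have hD0 : D 0 = 2 * B 0 := by simp [D, hC]; ring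
  have hD0' : D 0 ≠ 0 := by rw [hD0]; simpa using hB
  have cin : ContDiffAt ℝ 2 (fun p => 1 - A p * C p / B p ^ 2) 0 :=
    contDiffAt_const.sub ((cA.mul cC).div (cB.pow 2) (pow_ne_zero _ hB))
  have cD : ContDiffAt ℝ 2 D 0 := cB.mul (contDiffAt_const.add (cin.sqrt (by simp [hC])))
  have hEx : fderiv ℝ (fun p => C p / D p) 0 (1, 0) = fderiv ℝ C 0 (1, 0) / D 0 := by
    have h1 := line_comp (cC.differentiableAt (by norm_num)).hasFDerivAt
    have h2 := line_comp (cD.differentiableAt (by norm_num)).hasFDerivAt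
    have h3 := line_comp ((cC.div cD hD0').differentiableAt (by norm_num)).hasFDerivAt
    have h4 := h3.unique (h1.div h2 hD0')
    refine h4.trans ?_
    have e : ((0:ℝ), (0:ℝ)) = (0 : ℝ × ℝ) := rfl
    rw [e, hC]
    field_simp
    ring
  apply RedData.nf (D := D) (E := fun p => C p / D p) (F := fun p => A p / D p) (τ := τ)
  refine ⟨ca, cb, cD, cC.div cD hD0', cA.div cD hD0', ha, hb, hb', hτ, ?_, ?_, ?_, ?_⟩
  · rw [hD0]; linarith
  · simp [hC]
  · rw [hEx, hD0]
    have : τ * (fderiv ℝ C 0 (1, 0) / (2 * B 0)) = fderiv ℝ C 0 (1, 0) / (2 * (τ * B 0)) := by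
      have hτ0 : τ ≠ 0 := by rcases hτ with h | h <;> rw [h] <;> norm_num
      field_simp
      linear_combination hττ
    rw [this]; positivity
  · have e1 : ∀ᶠ p in nhds (0 : ℝ × ℝ), B p ≠ 0 := cB.continuousAt.eventually_ne hB
    have e2 : ∀ᶠ p in nhds (0 : ℝ × ℝ), D p ≠ 0 := cD.continuousAt.eventually_ne hD0'
    have e3 : ∀ᶠ p in nhds (0 : ℝ × ℝ), 0 < 1 - A p * C p / B p ^ 2 :=
      cin.continuousAt.eventually (lt_mem_nhds (by simp [hC]))
    filter_upwards [e1, e2, e3] with p h1 h2 h3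
    rw [hdisc p]
    have hs := Real.sq_sqrt h3.le
    have hq : D p ^ 2 - 2 * B p * D p + A p * C p = 0 := by
      have : A p * C p = B p ^ 2 * (A p * C p / B p ^ 2) := by field_simp
      have h4 : D p ^ 2 - 2 * B p * D p = B p ^ 2 * (√(1 - A p * C p / B p ^ 2) ^ 2 - 1) := by simp only [D]; ring
      rw [h4, hs]
      linear_combination this
    rw [neg_inj]
    field_simp
    linear_combination (-(p.1 * p.2)) * hq

lemma model_nf : NF (fun p v => v ≠ 0 ∧ BDE (fun _ => 1) (fun _ => 0) (fun p : ℝ × ℝ => p.1 * p.2 + p.1 ^ 3) p v = 0) := by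
  refine exists_redData (A := fun _ => 0) (B := fun _ => 1 / 2) (C := fun p => p.1) contDiffAt_const contDiffAt_const
    contDiffAt_const contDiffAt_const contDiffAt_fst (by norm_num) rfl (by simp) (by norm_num) rfl ?_ ?_
  · have : fderiv ℝ (fun p : ℝ × ℝ => p.1) 0 = ContinuousLinearMap.fst ℝ ℝ ℝ := hasFDerivAt_fst.fderiv
    rw [this]; simp
  · intro p; ring

lemma param_hasFDeriv {E : Type} [NormedAddCommGroup E] [NormedSpace ℝ E] [CompleteSpace E] (m : ℕ)
    {g : ℝ × ℝ → E} (hg : ContDiff ℝ (⊤ : ℕ∞) g) (p₀ : ℝ × ℝ) :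
    HasFDerivAt (fun p => ∫ t in (0:ℝ)..1, t ^ m • g (t • p))
      (∫ t in (0:ℝ)..1, t ^ (m + 1) • fderiv ℝ g (t • p₀)) p₀ := by
  have hg1 : Continuous (fderiv ℝ g) := hg.continuous_fderiv (by simp)
  have hgc := hg.continuous
  obtain ⟨K, hK⟩ := (isCompact_closedBall (0 : ℝ × ℝ) (‖p₀‖ + 1)).exists_bound_of_continuousOn hg1.continuousOn
  have hder : ∀ p : ℝ × ℝ, ∀ t : ℝ, HasFDerivAt (fun p => t ^ m • g (t • p)) (t ^ (m + 1) • fderiv ℝ g (t • p)) p := by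
    intro p t
    have h1 : HasFDerivAt g (fderiv ℝ g (t • p)) (t • p) := (hg.differentiable (by simp) _).hasFDerivAt
    have h2 : HasFDerivAt (fun p : ℝ × ℝ => t • p) (t • ContinuousLinearMap.id ℝ (ℝ × ℝ)) p := (hasFDerivAt_id p).const_smul t
    refine ((h1.comp p h2).const_smul (t ^ m)).congr_fderiv ?_
    ext v <;> simp [smul_smul, pow_succ]
  refine intervalIntegral.hasFDerivAt_integral_of_dominated_of_fderiv_le (F := fun p t => t ^ m • g (t • p)) (F' := fun p t => t ^ (m + 1) • fderiv ℝ g (t • p)) (bound := fun _ => K)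
    (Metric.ball_mem_nhds p₀ one_pos) ?_ ?_ ?_ ?_ ?_ ?_
  · refine Eventually.of_forall fun p => Continuous.aestronglyMeasurable ?_
    fun_prop
  · apply Continuous.intervalIntegrable
    fun_prop
  · have hcc : Continuous (fun t : ℝ => t ^ (m + 1) • fderiv ℝ g (t • p₀)) := by fun_prop
    have hst : SecondCountableTopologyEither ℝ (ℝ × ℝ →L[ℝ] E) := secondCountableTopologyEither_of_left ℝ _
    exact hcc.aestronglyMeasurable
  · refine Eventually.of_forall fun t ht p hp => ?_
    rw [uIoc_of_le zero_le_one] at ht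
    have h1 : ‖p‖ ≤ ‖p₀‖ + 1 := by
      have := norm_le_norm_add_norm_sub' p p₀
      rw [mem_ball_iff_norm] at hp
      linarith
    have h2 : ‖t • p‖ ≤ ‖p₀‖ + 1 := by
      rw [norm_smul, Real.norm_eq_abs, abs_of_pos ht.1]
      have := norm_nonneg p
      nlinarith [ht.2]
    have h3 := hK (t • p) (by simpa using h2)
    rw [norm_smul, norm_pow, Real.norm_eq_abs, abs_of_pos ht.1]
    have h4 : t ^ (m + 1) ≤ 1 := pow_le_one₀ ht.1.le ht.2
    have := norm_nonneg (fderiv ℝ g (t • p))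
    nlinarith
  · exact intervalIntegrable_const
  · exact Eventually.of_forall fun t ht p hp => hder p t

lemma param_contDiff (n : ℕ) : ∀ (E : Type) [NormedAddCommGroup E] [NormedSpace ℝ E] [CompleteSpace E] (m : ℕ)
    (g : ℝ × ℝ → E) (_ : ContDiff ℝ (⊤ : ℕ∞) g),
    ContDiff ℝ n (fun p => ∫ t in (0:ℝ)..1, t ^ m • g (t • p)) := by
  induction n with
  | zero =>
    intro E _ _ _ m g hg
    exact contDiff_zero.2 (continuous_iff_continuousAt.2 fun p => (param_hasFDeriv m hg p).continuousAt)
  | succ n ih =>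
    intro E _ _ _ m g hg
    push_cast
    rw [contDiff_succ_iff_hasFDerivAt]
    exact ⟨_, ih _ (m + 1) (fderiv ℝ g) (hg.fderiv_right (by simp)), param_hasFDeriv m hg⟩

lemma hadamard {F : ℝ × ℝ → ℝ} (hF : ContDiff ℝ (⊤ : ℕ∞) F) : ∃ u w : ℝ × ℝ → ℝ,
    ContDiff ℝ (⊤ : ℕ∞) u ∧ ContDiff ℝ (⊤ : ℕ∞) w ∧ ∀ p, F p = F 0 + (p.1 * u p + p.2 * w p) := by
  have hd : ContDiff ℝ (⊤ : ℕ∞) (fderiv ℝ F) := hF.fderiv_right (by simp)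
  let J : ℝ × ℝ → ((ℝ × ℝ) →L[ℝ] ℝ) := fun p => ∫ t in (0:ℝ)..1, t ^ 0 • fderiv ℝ F (t • p)
  have hJ : ContDiff ℝ (⊤ : ℕ∞) J := contDiff_infty.2 fun n => param_contDiff n _ 0 _ hd
  refine ⟨fun p => J p (1, 0), fun p => J p (0, 1), hJ.clm_apply contDiff_const, hJ.clm_apply contDiff_const, fun p => ?_⟩
  have e1 : p.1 * J p (1, 0) + p.2 * J p (0, 1) = J p p := by
    have : p = p.1 • (1, 0) + p.2 • (0, 1) := by ext <;> simp
    conv_rhs => arg 2; rw [this]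
    rw [map_add, map_smul, map_smul]; rfl
  have hc : Continuous (fun t : ℝ => fderiv ℝ F (t • p)) := by
    have := hd.continuous
    fun_prop
  have e2 : J p p = ∫ t in (0:ℝ)..1, fderiv ℝ F (t • p) p := by
    simp only [J, pow_zero, one_smul]
    exact ContinuousLinearMap.intervalIntegral_apply (hc.intervalIntegrable _ _) p
  have e3 : ∫ t in (0:ℝ)..1, fderiv ℝ F (t • p) p = F p - F 0 := by
    have := intervalIntegral.integral_eq_sub_of_hasDerivAt (a := 0) (b := 1) (f := fun t : ℝ => F (t • p)) (f' := fun t => fderiv ℝ F (t • p) p)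
      (fun t _ => by
        have h1 : HasFDerivAt F (fderiv ℝ F (t • p)) (t • p) := (hF.differentiable (by simp) _).hasFDerivAt
        have h2 : HasDerivAt (fun t : ℝ => t • p) p t := by simpa using (hasDerivAt_id t).smul_const p
        exact h1.comp_hasDerivAt t h2)
      ((hc.clm_apply continuous_const).intervalIntegrable _ _)
    simpa using this
  rw [e1, e2, e3]; ring

lemma pdx_eq {F : ℝ × ℝ → ℝ} {p : ℝ × ℝ} (hF : DifferentiableAt ℝ F p) : pdx F p = fderiv ℝ F p (1, 0) := by
  have h2 : HasDerivAt (fun s : ℝ => ((s, p.2) : ℝ × ℝ)) (1, 0) p.1 := (hasDerivAt_id _).prodMk (hasDerivAt_const _ _)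
  exact (HasFDerivAt.comp_hasDerivAt_of_eq p.1 hF.hasFDerivAt h2 rfl).deriv

lemma pdy_eq {F : ℝ × ℝ → ℝ} {p : ℝ × ℝ} (hF : DifferentiableAt ℝ F p) : pdy F p = fderiv ℝ F p (0, 1) := by
  have h2 : HasDerivAt (fun s : ℝ => ((p.1, s) : ℝ × ℝ)) (0, 1) p.2 := (hasDerivAt_const _ _).prodMk (hasDerivAt_id _)
  exact (HasFDerivAt.comp_hasDerivAt_of_eq p.2 hF.hasFDerivAt h2 rfl).deriv

lemma sm_diff {F : ℝ × ℝ → ℝ} (hF : ContDiff ℝ (⊤ : ℕ∞) F) (p : ℝ × ℝ) : DifferentiableAt ℝ F p :=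
  hF.differentiable (by simp) p

lemma pdx_smooth {F : ℝ × ℝ → ℝ} (hF : ContDiff ℝ (⊤ : ℕ∞) F) : ContDiff ℝ (⊤ : ℕ∞) (pdx F) := by
  have : pdx F = fun p => fderiv ℝ F p (1, 0) := funext fun p => pdx_eq (sm_diff hF p)
  rw [this]
  exact (hF.fderiv_right (by simp)).clm_apply contDiff_const

lemma pdy_smooth {F : ℝ × ℝ → ℝ} (hF : ContDiff ℝ (⊤ : ℕ∞) F) : ContDiff ℝ (⊤ : ℕ∞) (pdy F) := by
  have : pdy F = fun p => fderiv ℝ F p (0, 1) := funext fun p => pdy_eq (sm_diff hF p)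
  rw [this]
  exact (hF.fderiv_right (by simp)).clm_apply contDiff_const

lemma pdx_add {F G : ℝ × ℝ → ℝ} (hF : ContDiff ℝ (⊤ : ℕ∞) F) (hG : ContDiff ℝ (⊤ : ℕ∞) G) (p : ℝ × ℝ) :
    pdx (fun p => F p + G p) p = pdx F p + pdx G p := by
  rw [pdx_eq (sm_diff hF p), pdx_eq (sm_diff hG p), pdx_eq (F := fun p => F p + G p) ((sm_diff hF p).add (sm_diff hG p)), fderiv_fun_add (sm_diff hF p) (sm_diff hG p)]
  rfl

lemma pdy_add {F G : ℝ × ℝ → ℝ} (hF : ContDiff ℝ (⊤ : ℕ∞) F) (hG : ContDiff ℝ (⊤ : ℕ∞) G) (p : ℝ × ℝ) :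
    pdy (fun p => F p + G p) p = pdy F p + pdy G p := by
  rw [pdy_eq (sm_diff hF p), pdy_eq (sm_diff hG p), pdy_eq (F := fun p => F p + G p) ((sm_diff hF p).add (sm_diff hG p)), fderiv_fun_add (sm_diff hF p) (sm_diff hG p)]
  rfl

def IK : ℕ → (ℝ × ℝ → ℝ) → Prop
  | 0, F => ContDiff ℝ (⊤ : ℕ∞) F
  | k + 1, F => ∃ u w, IK k u ∧ IK k w ∧ ∀ p, F p = p.1 * u p + p.2 * w p

lemma IK.smooth : ∀ {k : ℕ} {F : ℝ × ℝ → ℝ}, IK k F → ContDiff ℝ (⊤ : ℕ∞) F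
  | 0, _, h => h
  | _ + 1, F, ⟨u, w, hu, hw, h⟩ => by
    have : F = fun p => p.1 * u p + p.2 * w p := funext h
    rw [this]
    exact (contDiff_fst.mul hu.smooth).add (contDiff_snd.mul hw.smooth)

lemma IK.add : ∀ {k : ℕ} {F G : ℝ × ℝ → ℝ}, IK k F → IK k G → IK k (fun p => F p + G p)
  | 0, _, _, h, h' => ContDiff.add h h'
  | _ + 1, _, _, ⟨u, w, hu, hw, h⟩, ⟨u', w', hu', hw', h'⟩ =>
    ⟨_, _, hu.add hu', hw.add hw', fun p => by simp only [h, h']; ring⟩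

lemma IK.smul : ∀ {k : ℕ} {F g : ℝ × ℝ → ℝ}, ContDiff ℝ (⊤ : ℕ∞) g → IK k F → IK k (fun p => g p * F p)
  | 0, _, _, hg, h => ContDiff.mul hg h
  | _ + 1, _, _, hg, ⟨u, w, hu, hw, h⟩ =>
    ⟨_, _, hu.smul hg, hw.smul hg, fun p => by simp only [h]; ring⟩

lemma IK.weaken {k : ℕ} {F : ℝ × ℝ → ℝ} (h : IK (k + 1) F) : IK k F := by
  obtain ⟨u, w, hu, hw, h⟩ := h
  have : F = fun p => p.1 * u p + p.2 * w p := funext h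
  rw [this]
  exact (hu.smul contDiff_fst).add (hw.smul contDiff_snd)

lemma IK.xmul {k : ℕ} {F : ℝ × ℝ → ℝ} (h : IK k F) : IK (k + 1) (fun p => p.1 * F p) :=
  ⟨F, fun p => 0 * F p, h, h.smul contDiff_const, fun p => by ring⟩

lemma IK.ymul {k : ℕ} {F : ℝ × ℝ → ℝ} (h : IK k F) : IK (k + 1) (fun p => p.2 * F p) :=
  ⟨fun p => 0 * F p, F, h.smul contDiff_const, h, fun p => by ring⟩

lemma IK.pdx : ∀ {k : ℕ} {F : ℝ × ℝ → ℝ}, IK (k + 1) F → IK k (pdx F)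
  | 0, _, h => pdx_smooth h.smooth
  | k + 1, F, ⟨u, w, hu, hw, h⟩ => by
    have e : F = fun p => p.1 * u p + p.2 * w p := funext h
    have : _root_.pdx F = fun p => u p + (p.1 * _root_.pdx u p + p.2 * _root_.pdx w p) := by
      funext p
      have hu' := sm_diff hu.smooth p
      have hw' := sm_diff hw.smooth p
      have h1 : HasFDerivAt (fun p : ℝ × ℝ => p.1) (ContinuousLinearMap.fst ℝ ℝ ℝ) p := hasFDerivAt_fst
      have h2 : HasFDerivAt (fun p : ℝ × ℝ => p.2) (ContinuousLinearMap.snd ℝ ℝ ℝ) p := hasFDerivAt_snd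
      have h3 := ((h1.mul hu'.hasFDerivAt).add (h2.mul hw'.hasFDerivAt)).congr_of_eventuallyEq (f₁ := F) (Eventually.of_forall h)
      rw [pdx_eq h3.differentiableAt, h3.fderiv, pdx_eq hu', pdx_eq hw']
      simp
      ring
    rw [this]
    exact hu.add ((hu.pdx.xmul).add hw.pdx.ymul)

lemma IK.pdy : ∀ {k : ℕ} {F : ℝ × ℝ → ℝ}, IK (k + 1) F → IK k (pdy F)
  | 0, _, h => pdy_smooth h.smooth
  | k + 1, F, ⟨u, w, hu, hw, h⟩ => by
    have e : F = fun p => p.1 * u p + p.2 * w p := funext h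
    have : _root_.pdy F = fun p => w p + (p.1 * _root_.pdy u p + p.2 * _root_.pdy w p) := by
      funext p
      have hu' := sm_diff hu.smooth p
      have hw' := sm_diff hw.smooth p
      have h1 : HasFDerivAt (fun p : ℝ × ℝ => p.1) (ContinuousLinearMap.fst ℝ ℝ ℝ) p := hasFDerivAt_fst
      have h2 : HasFDerivAt (fun p : ℝ × ℝ => p.2) (ContinuousLinearMap.snd ℝ ℝ ℝ) p := hasFDerivAt_snd
      have h3 := ((h1.mul hu'.hasFDerivAt).add (h2.mul hw'.hasFDerivAt)).congr_of_eventuallyEq (f₁ := F) (Eventually.of_forall h)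
      rw [pdy_eq h3.differentiableAt, h3.fderiv, pdy_eq hu', pdy_eq hw']
      simp
      ring
    rw [this]
    exact hw.add ((hu.pdy.xmul).add hw.pdy.ymul)

lemma IK.zero {k : ℕ} {F : ℝ × ℝ → ℝ} (h : IK (k + 1) F) : F 0 = 0 := by
  obtain ⟨u, w, hu, hw, h⟩ := h
  simp [h]

lemma IK.bigO : ∀ {k : ℕ} {F : ℝ × ℝ → ℝ}, IK k F → F =O[nhds (0 : ℝ × ℝ)] fun p => ‖p‖ ^ k
  | 0, F, h => by
    have h' : ContDiff ℝ (⊤ : ℕ∞) F := h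
    simpa using h'.continuous.continuousAt.norm.isBoundedUnder_le.isBigO_one ℝ
  | k + 1, F, ⟨u, w, hu, hw, h⟩ => by
    have e : F = fun p => p.1 * u p + p.2 * w p := funext h
    have h1 : (fun p : ℝ × ℝ => p.1) =O[nhds (0 : ℝ × ℝ)] fun p => ‖p‖ :=
      IsBigO.of_bound 1 (Eventually.of_forall fun p => by simpa using norm_fst_le p)
    have h2 : (fun p : ℝ × ℝ => p.2) =O[nhds (0 : ℝ × ℝ)] fun p => ‖p‖ :=
      IsBigO.of_bound 1 (Eventually.of_forall fun p => by simpa using norm_snd_le p)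
    rw [e]
    have : (fun p : ℝ × ℝ => ‖p‖ ^ (k + 1)) = fun p => ‖p‖ * ‖p‖ ^ k := funext fun p => by ring
    rw [this]
    exact (h1.mul hu.bigO).add (h2.mul hw.bigO)

lemma IK.littleO {k : ℕ} {F : ℝ × ℝ → ℝ} (h : IK (k + 1) F) : F =o[nhds (0 : ℝ × ℝ)] fun p => ‖p‖ ^ k := by
  refine h.bigO.trans_isLittleO ?_
  have h1 : (fun p : ℝ × ℝ => ‖p‖) =o[nhds (0 : ℝ × ℝ)] fun _ => (1:ℝ) := by
    rw [isLittleO_one_iff]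
    simpa using (continuous_norm (E := ℝ × ℝ)).tendsto 0
  simpa [pow_succ'] using h1.mul_isBigO (isBigO_refl (fun p : ℝ × ℝ => ‖p‖ ^ k) _)

lemma IK.homog : ∀ {k : ℕ} {F : ℝ × ℝ → ℝ}, IK k F → ∃ P : ℝ × ℝ → ℝ,
    (∀ (t : ℝ) p, P (t • p) = t ^ k * P p) ∧ IK (k + 1) (fun p => F p - P p)
  | 0, F, h => by
    obtain ⟨u, w, hu, hw, e⟩ := hadamard h
    exact ⟨fun _ => F 0, fun t p => by simp, u, w, hu, hw, fun p => by simp only []; rw [e p]; ring⟩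
  | k + 1, F, ⟨u, w, hu, hw, h⟩ => by
    obtain ⟨P, hP, h1⟩ := hu.homog
    obtain ⟨Q, hQ, h2⟩ := hw.homog
    refine ⟨fun p => p.1 * P p + p.2 * Q p, fun t p => ?_, _, _, h1, h2, fun p => ?_⟩
    · simp [hP, hQ]; ring
    · simp only [h]; ring

lemma homog_zero {k : ℕ} {P : ℝ × ℝ → ℝ} (hP : ∀ (t : ℝ) p, P (t • p) = t ^ k * P p)
    (ho : P =o[nhds (0 : ℝ × ℝ)] fun p => ‖p‖ ^ k) (p : ℝ × ℝ) : P p = 0 := by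
  by_contra hne
  have hpos : 0 < |P p| := abs_pos.2 hne
  set N := ‖p‖ ^ k with hN
  have hN0 : 0 ≤ N := by positivity
  have hc : 0 < |P p| / (2 * N + 1) := by positivity
  have h1 := ho.def hc
  have ht : Tendsto (fun t : ℝ => t • p) (nhdsWithin 0 (Ioi 0)) (nhds 0) := by
    have : Continuous (fun t : ℝ => t • p) := by fun_prop
    have := this.tendsto 0
    rw [zero_smul] at this
    exact this.mono_left nhdsWithin_le_nhds
  obtain ⟨t, ht1, ht2⟩ := ((ht.eventually h1).and self_mem_nhdsWithin).exists
  have ht2 : 0 < t := ht2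
  rw [hP, norm_smul, norm_mul, norm_pow, norm_pow, norm_mul, norm_norm, norm_norm, Real.norm_eq_abs, Real.norm_eq_abs,
    mul_pow, abs_of_pos ht2, ← hN] at ht1
  have htk : 0 < t ^ k := by positivity
  have h2 : |P p| ≤ |P p| / (2 * N + 1) * N := by
    have : t ^ k * |P p| ≤ t ^ k * (|P p| / (2 * N + 1) * N) := by linarith
    exact le_of_mul_le_mul_left this htk
  have h3 : |P p| / (2 * N + 1) * (2 * N + 1) = |P p| := by field_simp
  nlinarith

lemma IK.of_littleO {k : ℕ} {F : ℝ × ℝ → ℝ} (hF : ContDiff ℝ (⊤ : ℕ∞) F)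
    (ho : F =o[nhds (0 : ℝ × ℝ)] fun p => ‖p‖ ^ k) : ∀ j, j ≤ k + 1 → IK j F := by
  intro j
  induction j with
  | zero => intro _; exact hF
  | succ j ih =>
    intro hj
    obtain ⟨P, hP, h1⟩ := (ih (by omega)).homog
    have ho' : F =o[nhds (0 : ℝ × ℝ)] fun p => ‖p‖ ^ j := by
      refine ho.trans_isBigO (IsBigO.of_bound 1 ?_)
      filter_upwards [Metric.ball_mem_nhds (0 : ℝ × ℝ) one_pos] with p hp
      rw [mem_ball_zero_iff] at hp
      simp only [norm_pow, norm_norm, one_mul]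
      exact pow_le_pow_of_le_one (norm_nonneg _) hp.le (by omega)
    have hPo : P =o[nhds (0 : ℝ × ℝ)] fun p => ‖p‖ ^ j := by
      have := ho'.sub h1.littleO
      simpa using this
    have hz : ∀ p, P p = 0 := homog_zero hP hPo
    simpa [hz] using h1

lemma IK.quad {k : ℕ} {F : ℝ × ℝ → ℝ} (h : IK (k + 2) F) : ∃ α β γ, IK k α ∧ IK k β ∧ IK k γ ∧
    ∀ p, F p = p.1 ^ 2 * α p + p.1 * p.2 * β p + p.2 ^ 2 * γ p := by
  obtain ⟨u, w, ⟨u1, u2, h1, h2, eu⟩, ⟨w1, w2, h3, h4, ew⟩, e⟩ := h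
  exact ⟨u1, _, w2, h1, h2.add h3, h4, fun p => by simp only [e, eu, ew]; ring⟩

lemma IK.fd {k : ℕ} {F : ℝ × ℝ → ℝ} (h : IK (k + 2) F) : fderiv ℝ F 0 (1, 0) = 0 := by
  rw [← pdx_eq (sm_diff h.smooth 0)]
  exact h.pdx.zero

lemma poly_deriv (c0 c1 c2 c3 c4 c5 s : ℝ) : deriv (fun s => c0 + c1 * s + c2 * s ^ 2 + c3 * s ^ 3 + c4 * s ^ 4 + c5 * s ^ 5) s =
    c1 + 2 * c2 * s + 3 * c3 * s ^ 2 + 4 * c4 * s ^ 3 + 5 * c5 * s ^ 4 := by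
  have h := (((((hasDerivAt_const s c0).add ((hasDerivAt_id s).const_mul c1)).add ((hasDerivAt_pow 2 s).const_mul c2)).add
    ((hasDerivAt_pow 3 s).const_mul c3)).add ((hasDerivAt_pow 4 s).const_mul c4)).add ((hasDerivAt_pow 5 s).const_mul c5)
  have := h.deriv
  refine Eq.trans this ?_
  norm_num
  ring

lemma pdx_poly {F : ℝ × ℝ → ℝ} (c0 c1 c2 c3 c4 c5 : ℝ) (p : ℝ × ℝ)
    (h : ∀ s, F (s, p.2) = c0 + c1 * s + c2 * s ^ 2 + c3 * s ^ 3 + c4 * s ^ 4 + c5 * s ^ 5) :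
    pdx F p = c1 + 2 * c2 * p.1 + 3 * c3 * p.1 ^ 2 + 4 * c4 * p.1 ^ 3 + 5 * c5 * p.1 ^ 4 := by
  unfold pdx
  rw [funext h, poly_deriv]

lemma pdy_poly {F : ℝ × ℝ → ℝ} (c0 c1 c2 c3 c4 c5 : ℝ) (p : ℝ × ℝ)
    (h : ∀ s, F (p.1, s) = c0 + c1 * s + c2 * s ^ 2 + c3 * s ^ 3 + c4 * s ^ 4 + c5 * s ^ 5) :
    pdy F p = c1 + 2 * c2 * p.2 + 3 * c3 * p.2 ^ 2 + 4 * c4 * p.2 ^ 3 + 5 * c5 * p.2 ^ 4 := by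
  unfold pdy
  rw [funext h, poly_deriv]

lemma ik1 {F : ℝ × ℝ → ℝ} (hF : ContDiff ℝ (⊤ : ℕ∞) F) : IK 1 (fun p => F p - F 0) := by
  obtain ⟨u, w, hu, hw, e⟩ := hadamard hF
  exact ⟨u, w, hu, hw, fun p => by simp only []; rw [e p]; ring⟩

lemma jet_part {c31 c22 : ℝ} {δ A B C : ℝ × ℝ → ℝ} (cA : ContDiff ℝ (⊤ : ℕ∞) A) (cB : ContDiff ℝ (⊤ : ℕ∞) B)
    (cC : ContDiff ℝ (⊤ : ℕ∞) C) (hA : A 0 = 4 * c22) (hB : B 0 = 6 * c31) (hC : C 0 = 0)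
    (hδ : ∀ p : ℝ × ℝ, δ p = -(A p * p.2 ^ 2 + 2 * B p * (p.1 * p.2) + C p * p.1 ^ 2)) :
    δ 0 = 0 ∧ (pdx δ 0, pdy δ 0) = (0, 0) ∧
    HasJetAt0 δ (fun p => -12 * c31 * p.1 * p.2 - 4 * c22 * p.2 ^ 2) 2 ∧
    Matrix.det !![pdx (pdx δ) 0, pdy (pdx δ) 0; pdx (pdy δ) 0, pdy (pdy δ) 0] = -144 * c31 ^ 2 := by
  let Q : ℝ × ℝ → ℝ := fun p => -12 * c31 * p.1 * p.2 - 4 * c22 * p.2 ^ 2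
  let R : ℝ × ℝ → ℝ := fun p => -1 * (p.2 * (p.2 * (A p - A 0)) + (2 * (p.1 * (p.2 * (B p - B 0))) + p.1 * (p.1 * (C p - C 0))))
  have hR : IK 3 R := by
    refine IK.smul (g := fun _ => -1) contDiff_const ?_
    exact (ik1 cA).ymul.ymul.add (((ik1 cB).ymul.xmul.smul (g := fun _ => 2) contDiff_const).add (ik1 cC).xmul.xmul)
  have cQ : ContDiff ℝ (⊤ : ℕ∞) Q := by simp only [Q]; fun_prop
  have e : δ = fun p => Q p + R p := by
    funext p; simp only [Q, R, hδ, hA, hB, hC]; ring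
  have ex : pdx δ = fun p => -12 * c31 * p.2 + pdx R p := by
    funext p; rw [e, pdx_add cQ hR.smooth, pdx_poly (-4 * c22 * p.2 ^ 2) (-12 * c31 * p.2) 0 0 0 0 p (fun s => by simp only [Q]; ring)]; ring
  have ey : pdy δ = fun p => (-12 * c31 * p.1 - 8 * c22 * p.2) + pdy R p := by
    funext p; rw [e, pdy_add cQ hR.smooth, pdy_poly 0 (-12 * c31 * p.1) (-4 * c22) 0 0 0 p (fun s => by simp only [Q]; ring)]; ring
  have c1 : ContDiff ℝ (⊤ : ℕ∞) (fun p : ℝ × ℝ => -12 * c31 * p.2) := by fun_prop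
  have c2 : ContDiff ℝ (⊤ : ℕ∞) (fun p : ℝ × ℝ => -12 * c31 * p.1 - 8 * c22 * p.2) := by fun_prop
  have hx : pdx (pdx δ) 0 = 0 := by
    rw [ex, pdx_add c1 hR.pdx.smooth, hR.pdx.pdx.zero, pdx_poly (-12 * c31 * 0) 0 0 0 0 0 0 (fun s => by simp)]; simp
  have hxy : pdy (pdx δ) 0 = -12 * c31 := by
    rw [ex, pdy_add c1 hR.pdx.smooth, hR.pdx.pdy.zero, pdy_poly 0 (-12 * c31) 0 0 0 0 0 (fun s => by simp)]; simp
  have hyx : pdx (pdy δ) 0 = -12 * c31 := by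
    rw [ey, pdx_add c2 hR.pdy.smooth, hR.pdy.pdx.zero, pdx_poly 0 (-12 * c31) 0 0 0 0 0 (fun s => by simp)]; simp
  refine ⟨by simp [hδ], ?_, ?_, ?_⟩
  · rw [ex, ey]
    simp [hR.pdx.zero, hR.pdy.zero]
  · unfold HasJetAt0
    have : (fun p => δ p - (-12 * c31 * p.1 * p.2 - 4 * c22 * p.2 ^ 2)) = R := by
      funext p; rw [e]; simp only [Q]; ring
    rw [this]; exact hR.littleO
  · rw [Matrix.det_fin_two_of, hx, hxy, hyx]; ring

lemma quad_decomp {c31 c22 c13 c04 d40 d31 d22 d13 d04 : ℝ} {f : ℝ × ℝ → ℝ}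
    (hf : ContDiff ℝ (⊤ : ℕ∞) f)
    (hjet : HasJetAt0 f
      (fun p => p.2 ^ 2 + p.1 ^ 5 +
        p.2 * ((c31 * p.1 ^ 3 + c22 * p.1 ^ 2 * p.2 + c13 * p.1 * p.2 ^ 2 + c04 * p.2 ^ 3) +
          (d40 * p.1 ^ 4 + d31 * p.1 ^ 3 * p.2 + d22 * p.1 ^ 2 * p.2 ^ 2 +
            d13 * p.1 * p.2 ^ 3 + d04 * p.2 ^ 4))) 5) :
    ∃ A B C : ℝ × ℝ → ℝ, ContDiff ℝ (⊤ : ℕ∞) A ∧ ContDiff ℝ (⊤ : ℕ∞) B ∧ ContDiff ℝ (⊤ : ℕ∞) C ∧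
      ContDiff ℝ (⊤ : ℕ∞) (fyy f) ∧ ContDiff ℝ (⊤ : ℕ∞) (fxy f) ∧
      A 0 = 4 * c22 ∧ B 0 = 6 * c31 ∧ C 0 = 0 ∧ 0 < fderiv ℝ C 0 (1, 0) ∧ 0 < fyy f 0 ∧ fxy f 0 = 0 ∧
      fderiv ℝ (fxy f) 0 (1, 0) = 0 ∧
      ∀ p : ℝ × ℝ, fxy f p ^ 2 - fyy f p * fxx f p = -(A p * p.2 ^ 2 + 2 * B p * (p.1 * p.2) + C p * p.1 ^ 2) := by
  let P : ℝ × ℝ → ℝ := fun p => p.2 ^ 2 + p.1 ^ 5 +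
        p.2 * ((c31 * p.1 ^ 3 + c22 * p.1 ^ 2 * p.2 + c13 * p.1 * p.2 ^ 2 + c04 * p.2 ^ 3) +
          (d40 * p.1 ^ 4 + d31 * p.1 ^ 3 * p.2 + d22 * p.1 ^ 2 * p.2 ^ 2 +
            d13 * p.1 * p.2 ^ 3 + d04 * p.2 ^ 4))
  let Px : ℝ × ℝ → ℝ := fun p => (c13 * p.2 ^ 3 + d13 * p.2 ^ 4) + 2 * (c22 * p.2 ^ 2 + d22 * p.2 ^ 3) * p.1 +
    3 * (c31 * p.2 + d31 * p.2 ^ 2) * p.1 ^ 2 + 4 * (d40 * p.2) * p.1 ^ 3 + 5 * p.1 ^ 4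
  let Py : ℝ × ℝ → ℝ := fun p => (c31 * p.1 ^ 3 + d40 * p.1 ^ 4) + 2 * (1 + c22 * p.1 ^ 2 + d31 * p.1 ^ 3) * p.2 +
    3 * (c13 * p.1 + d22 * p.1 ^ 2) * p.2 ^ 2 + 4 * (c04 + d13 * p.1) * p.2 ^ 3 + 5 * d04 * p.2 ^ 4
  have cP : ContDiff ℝ (⊤ : ℕ∞) P := by simp only [P]; fun_prop
  have cPx : ContDiff ℝ (⊤ : ℕ∞) Px := by simp only [Px]; fun_prop
  have cPy : ContDiff ℝ (⊤ : ℕ∞) Py := by simp only [Py]; fun_prop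
  let R : ℝ × ℝ → ℝ := fun p => f p - P p
  have hR : IK 6 R := IK.of_littleO (hf.sub cP) hjet 6 le_rfl
  have e : f = fun p => P p + R p := by funext p; simp only [R]; ring
  have ex : pdx f = fun p => Px p + pdx R p := by
    funext p
    conv_lhs => rw [e]
    rw [pdx_add cP hR.smooth, pdx_poly (p.2 ^ 2 + c04 * p.2 ^ 4 + d04 * p.2 ^ 5) (c13 * p.2 ^ 3 + d13 * p.2 ^ 4) (c22 * p.2 ^ 2 + d22 * p.2 ^ 3) (c31 * p.2 + d31 * p.2 ^ 2) (d40 * p.2) 1 p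
      (fun s => by simp only [P]; ring)]
    simp only [Px]; ring
  have ey : pdy f = fun p => Py p + pdy R p := by
    funext p
    conv_lhs => rw [e]
    rw [pdy_add cP hR.smooth, pdy_poly (p.1 ^ 5) (c31 * p.1 ^ 3 + d40 * p.1 ^ 4) (1 + c22 * p.1 ^ 2 + d31 * p.1 ^ 3) (c13 * p.1 + d22 * p.1 ^ 2) (c04 + d13 * p.1) d04 p
      (fun s => by simp only [P]; ring)]
  have exx : ∀ p, fxx f p = 2 * (c22 * p.2 ^ 2 + d22 * p.2 ^ 3) + 6 * (c31 * p.2 + d31 * p.2 ^ 2) * p.1 + 12 * d40 * p.2 * p.1 ^ 2 + 20 * p.1 ^ 3 + pdx (pdx R) p := by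
    intro p
    rw [fxx, ex, pdx_add cPx hR.pdx.smooth, pdx_poly (c13 * p.2 ^ 3 + d13 * p.2 ^ 4) (2 * (c22 * p.2 ^ 2 + d22 * p.2 ^ 3)) (3 * (c31 * p.2 + d31 * p.2 ^ 2)) (4 * (d40 * p.2)) 5 0 p
      (fun s => by simp only [Px]; ring)]
    ring
  have exy : ∀ p, fxy f p = 3 * c31 * p.1 ^ 2 + 4 * d40 * p.1 ^ 3 + 2 * (2 * c22 * p.1 + 3 * d31 * p.1 ^ 2) * p.2 + 3 * (c13 + 2 * d22 * p.1) * p.2 ^ 2 + 4 * d13 * p.2 ^ 3 + pdy (pdx R) p := by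
    intro p
    rw [fxy, ex, pdy_add cPx hR.pdx.smooth, pdy_poly (5 * p.1 ^ 4) (3 * c31 * p.1 ^ 2 + 4 * d40 * p.1 ^ 3) (2 * c22 * p.1 + 3 * d31 * p.1 ^ 2) (c13 + 2 * d22 * p.1) d13 0 p
      (fun s => by simp only [Px]; ring)]
    ring
  have eyy0 : fyy f 0 = 2 := by
    rw [fyy, ey, pdy_add cPy hR.pdy.smooth, hR.pdy.pdy.zero, pdy_poly 0 2 0 (4 * c04) (5 * d04) 0 0
      (fun s => by simp [Py])]
    simp
  have cS : ContDiff ℝ (⊤ : ℕ∞) (fyy f) := pdy_smooth (pdy_smooth hf)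
  have cT : ContDiff ℝ (⊤ : ℕ∞) (fxy f) := pdy_smooth (pdx_smooth hf)
  obtain ⟨α1, β1, γ1, hα1, hβ1, hγ1, q1⟩ := hR.pdx.pdx.quad
  obtain ⟨α2, β2, γ2, hα2, hβ2, hγ2, q2⟩ := hR.pdx.pdy.quad
  let u1 : ℝ × ℝ → ℝ := fun p => 20 * p.1 + 12 * d40 * p.2 + α1 p
  let v1 : ℝ × ℝ → ℝ := fun p => 6 * c31 + 6 * d31 * p.2 + β1 p
  let w1 : ℝ × ℝ → ℝ := fun p => 2 * c22 + 2 * d22 * p.2 + γ1 p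
  let u2 : ℝ × ℝ → ℝ := fun p => 3 * c31 + 4 * d40 * p.1 + 6 * d31 * p.2 + α2 p
  let v2 : ℝ × ℝ → ℝ := fun p => 4 * c22 + 6 * d22 * p.2 + β2 p
  let w2 : ℝ × ℝ → ℝ := fun p => 3 * c13 + 4 * d13 * p.2 + γ2 p
  have ca1 := hα1.smooth
  have cb1 := hβ1.smooth
  have cc1 := hγ1.smooth
  have ca2 := hα2.smooth
  have cb2 := hβ2.smooth
  have cc2 := hγ2.smooth
  have cu1 : ContDiff ℝ (⊤ : ℕ∞) u1 := by simp only [u1]; fun_prop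
  have cv1 : ContDiff ℝ (⊤ : ℕ∞) v1 := by simp only [v1]; fun_prop
  have cw1 : ContDiff ℝ (⊤ : ℕ∞) w1 := by simp only [w1]; fun_prop
  have cu2 : ContDiff ℝ (⊤ : ℕ∞) u2 := by simp only [u2]; fun_prop
  have cv2 : ContDiff ℝ (⊤ : ℕ∞) v2 := by simp only [v2]; fun_prop
  have cw2 : ContDiff ℝ (⊤ : ℕ∞) w2 := by simp only [w2]; fun_prop
  have fxxq : ∀ p, fxx f p = p.1 ^ 2 * u1 p + p.1 * p.2 * v1 p + p.2 ^ 2 * w1 p := by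
    intro p; rw [exx, q1]; simp only [u1, v1, w1]; ring
  have fxyq : ∀ p, fxy f p = p.1 ^ 2 * u2 p + p.1 * p.2 * v2 p + p.2 ^ 2 * w2 p := by
    intro p; rw [exy, q2]; simp only [u2, v2, w2]; ring
  have hT : IK 2 (fxy f) := by
    have : fxy f = fun p => p.1 * (p.1 * u2 p + p.2 * v2 p) + p.2 * (p.2 * w2 p) := by
      funext p; rw [fxyq]; ring
    rw [this]
    have i1 : IK 0 u2 := cu2
    have i2 : IK 0 v2 := cv2
    have i3 : IK 0 w2 := cw2
    exact (i1.xmul.add i2.ymul).xmul.add i3.ymul.ymul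
  have u10 : u1 0 = 0 := by simp [u1, hα1.zero]
  have v10 : v1 0 = 6 * c31 := by simp [v1, hβ1.zero]
  have w10 : w1 0 = 2 * c22 := by simp [w1, hγ1.zero]
  have du1 : HasDerivAt (fun t : ℝ => u1 (t, 0)) 20 0 := by
    have h1 := line_comp (sm_diff ca1 0).hasFDerivAt
    rw [hα1.fd] at h1
    have h2 := ((hasDerivAt_id (0:ℝ)).const_mul 20).add h1
    refine (h2.congr_deriv (by norm_num)).congr_of_eventuallyEq (Eventually.of_forall fun t => ?_)
    simp [u1]
  have hCder : fderiv ℝ (fun p => fyy f p * u1 p - fxy f p * u2 p) 0 (1, 0) = 40 := by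
    have cC : ContDiff ℝ (⊤ : ℕ∞) (fun p => fyy f p * u1 p - fxy f p * u2 p) := (cS.mul cu1).sub (cT.mul cu2)
    have h0 := line_comp (sm_diff cC 0).hasFDerivAt
    have hS := line_comp (sm_diff cS 0).hasFDerivAt
    have hT' := line_comp (sm_diff cT 0).hasFDerivAt
    have hu2 := line_comp (sm_diff cu2 0).hasFDerivAt
    have h1 := h0.unique ((hS.mul du1).sub (hT'.mul hu2))
    rw [h1, hT.fd]
    have e0 : ((0:ℝ), (0:ℝ)) = (0 : ℝ × ℝ) := rfl
    rw [e0, u10, hT.zero, eyy0]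
    norm_num
  refine ⟨fun p => fyy f p * w1 p - fxy f p * w2 p, fun p => (fyy f p * v1 p - fxy f p * v2 p) / 2,
    fun p => fyy f p * u1 p - fxy f p * u2 p, (cS.mul cw1).sub (cT.mul cw2), ((cS.mul cv1).sub (cT.mul cv2)).div_const 2,
    (cS.mul cu1).sub (cT.mul cu2), cS, cT, ?_, ?_, ?_, ?_, ?_, hT.zero, hT.fd, ?_⟩
  · simp only [hT.zero, eyy0, w10]; ring
  · simp only [hT.zero, eyy0, v10]; ring
  · simp only [hT.zero, u10]; ring
  · rw [hCder]; norm_num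
  · rw [eyy0]; norm_num
  · intro p
    simp only []
    linear_combination (fxy f p) * fxyq p - fyy f p * fxxq p

/-- class `Π^p_{v,3}`: for smooth `f` with
`j⁵f(0) = y² + x⁵ + y(φ₃ + φ₄)`, `φ₃, φ₄` homogeneous of degrees 3 and 4, with
`c₃₁, c₂₂` the coefficients of `x³y, x²y²` in `f`, the discriminant `δ`
vanishes to first order at `0` with `j²δ(0) = −12c₃₁xy − 4c₂₂y²` and
`det Hess δ(0) = −144c₃₁²`; moreover if `c₃₁ ≠ 0` the asymptotic BDE of `f` is
topologically equivalent at `0` to `dy² + (xy + x³)dx² = 0`. -/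
theorem stmt10 (c31 c22 c13 c04 d40 d31 d22 d13 d04 : ℝ) (f : ℝ × ℝ → ℝ)
    (hf : ContDiff ℝ (⊤ : ℕ∞) f)
    (hjet : HasJetAt0 f
      (fun p => p.2 ^ 2 + p.1 ^ 5 +
        p.2 * ((c31 * p.1 ^ 3 + c22 * p.1 ^ 2 * p.2 + c13 * p.1 * p.2 ^ 2 + c04 * p.2 ^ 3) +
          (d40 * p.1 ^ 4 + d31 * p.1 ^ 3 * p.2 + d22 * p.1 ^ 2 * p.2 ^ 2 +
            d13 * p.1 * p.2 ^ 3 + d04 * p.2 ^ 4))) 5) :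
    bdeDiscr f 0 = 0 ∧
    (pdx (bdeDiscr f) 0, pdy (bdeDiscr f) 0) = (0, 0) ∧
    HasJetAt0 (bdeDiscr f) (fun p => -12 * c31 * p.1 * p.2 - 4 * c22 * p.2 ^ 2) 2 ∧
    Matrix.det !![pdx (pdx (bdeDiscr f)) 0, pdy (pdx (bdeDiscr f)) 0;
        pdx (pdy (bdeDiscr f)) 0, pdy (pdy (bdeDiscr f)) 0] = -144 * c31 ^ 2 ∧
    (c31 ≠ 0 →
      TopEquivAt0 (asymBDE f)
        (BDE (fun _ => 1) (fun _ => 0) (fun p => p.1 * p.2 + p.1 ^ 3))) := by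
  obtain ⟨A, B, C, cA, cB, cC, cS, cT, hA, hB, hC, hCx, ha, hb, hb', hd⟩ := quad_decomp hf hjet
  obtain ⟨j1, j2, j3, j4⟩ := jet_part (δ := bdeDiscr f) cA cB cC hA hB hC (fun p => by
    rw [← hd p, bdeDiscr]; ring)
  refine ⟨j1, j2, j3, j4, fun hne => ?_⟩
  have at2 : ∀ {F : ℝ × ℝ → ℝ}, ContDiff ℝ (⊤ : ℕ∞) F → ContDiffAt ℝ 2 F 0 := fun hF =>
    (contDiff_infty.1 hF 2).contDiffAt
  exact NF.topEquiv (exists_redData (at2 cS) (at2 cT) (at2 cA) (at2 cB) (at2 cC) ha hb hb'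
    (by rw [hB]; simpa using hne) hC hCx hd) model_nf
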